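/- Let h > 0 be an integer and let G be a finite simple graph. If tw(G) ≥ 6·2^h − 4, then G contains as a minor a double wheel DW_r for some integer r > 2 with r ≥ (2^{h/2} − 2)/(2h − 3). -/

import Mathlib

/-- `IsMinor H G` : there is a minor model of `H` in `G`. -/
def IsMinor {α : Type*} {β : Type*} (H : SimpleGraph α) (G : SimpleGraph β) : Prop :=
  ∃ M : α → Set β,
    (∀ v, (G.induce (M v)).Connected) ∧
    (Pairwise fun u v => Disjoint (M u) (M v)) ∧
    (∀ ⦃u v : α⦄, H.Adj u v → ∃ a ∈ M u, ∃ b ∈ M v, G.Adj a b)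

/-- The treewidth of a finite simple graph: the least `w` such that `G` admits a tree
decomposition all of whose bags have at most `w + 1` vertices. -/
noncomputable def treewidth {V : Type*} [Fintype V] (G : SimpleGraph V) : ℕ :=
  sInf { w : ℕ | ∃ (ι : Type) (_ : Fintype ι) (t : SimpleGraph ι) (bag : ι → Finset V),
    t.IsTree ∧
    (∀ v : V, ∃ i, v ∈ bag i) ∧
    (∀ u v : V, G.Adj u v → ∃ i, u ∈ bag i ∧ v ∈ bag i) ∧
    (∀ v : V, (t.induce {i : ι | v ∈ bag i}).Connected) ∧
    (∀ i, (bag i).card ≤ w + 1) }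

/-- The double wheel of order `r` : a cycle `w_1 … w_r` (the `inl` vertices) together
with two hubs `o_1, o_2` (the `inr` vertices), each adjacent to every cycle vertex. -/
def doubleWheel (r : ℕ) : SimpleGraph (Fin r ⊕ Fin 2) :=
  SimpleGraph.fromRel (fun u v =>
    match u, v with
    | Sum.inl i, Sum.inl j => (j : ℕ) = ((i : ℕ) + 1) % r
    | Sum.inl _, Sum.inr _ => True
    | _, _ => False)

namespace DoubleWheelMinor

section

variable {V : Type*}

/-- A set of vertices is connected if it is nonempty and it is contained in every set that it
meets and that is closed under adjacency inside it. -/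
def ConnSet (G : SimpleGraph V) (S : Set V) : Prop :=
  S.Nonempty ∧ ∀ T : Set V, (∃ v ∈ S, v ∈ T) →
    (∀ a ∈ S, a ∈ T → ∀ b ∈ S, G.Adj a b → b ∈ T) → S ⊆ T

/-- Some vertex of `A` is adjacent to some vertex of `B`. -/
def AdjSet (G : SimpleGraph V) (A B : Set V) : Prop := ∃ a ∈ A, ∃ b ∈ B, G.Adj a b

/-- The component of `v` in the subgraph induced by `S`. -/
def comp (G : SimpleGraph V) (S : Set V) (v : V) : Set V :=
  {w | ∃ C, ConnSet G C ∧ C ⊆ S ∧ v ∈ C ∧ w ∈ C}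

variable {G : SimpleGraph V}

theorem AdjSet.symm {A B : Set V} (h : AdjSet G A B) : AdjSet G B A := by
  obtain ⟨a, ha, b, hb, hab⟩ := h
  exact ⟨b, hb, a, ha, hab.symm⟩

theorem AdjSet.mono {A B A' B' : Set V} (h : AdjSet G A B) (hA : A ⊆ A') (hB : B ⊆ B') :
    AdjSet G A' B' := by
  obtain ⟨a, ha, b, hb, hab⟩ := h
  exact ⟨a, hA ha, b, hB hb, hab⟩

theorem ConnSet.singleton (v : V) : ConnSet G {v} := by
  refine ⟨⟨v, rfl⟩, ?_⟩
  rintro T ⟨_, rfl, hw⟩ _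
  simpa using hw

theorem ConnSet.exit {S T : Set V} (hS : ConnSet G S) (h₁ : ∃ v ∈ S, v ∈ T)
    (h₂ : ∃ v ∈ S, v ∉ T) : ∃ a ∈ S, a ∈ T ∧ ∃ b ∈ S, b ∉ T ∧ G.Adj a b := by
  by_contra hcon
  obtain ⟨w, hw, hwT⟩ := h₂
  refine hwT (hS.2 T h₁ (fun a ha haT b hb hab => ?_) hw)
  by_contra hbT
  exact hcon ⟨a, ha, haT, b, hb, hbT, hab⟩

theorem ConnSet.of_hub {S K : Set V} (hK : ConnSet G K) (hKS : K ⊆ S)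
    (h : ∀ v ∈ S, ∃ C, ConnSet G C ∧ C ⊆ S ∧ v ∈ C ∧ (C ∩ K).Nonempty) : ConnSet G S := by
  refine ⟨hK.1.mono hKS, fun T hT hcl => ?_⟩
  have sub : ∀ C, ConnSet G C → C ⊆ S → (∃ v ∈ C, v ∈ T) → C ⊆ T := fun C hC hCS hv =>
    hC.2 T hv fun a ha haT b hb hab => hcl a (hCS ha) haT b (hCS hb) hab
  obtain ⟨v, hvS, hvT⟩ := hT
  obtain ⟨C, hC, hCS, hvC, k, hkC, hkK⟩ := h v hvS
  have hKT := sub K hK hKS ⟨k, hkK, sub C hC hCS ⟨v, hvC, hvT⟩ hkC⟩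
  intro w hw
  obtain ⟨C', hC', hCS', hwC, k', hkC', hkK'⟩ := h w hw
  exact sub C' hC' hCS' ⟨k', hkC', hKT hkK'⟩ hwC

theorem ConnSet.union {A B : Set V} (hA : ConnSet G A) (hB : ConnSet G B)
    (h : (A ∩ B).Nonempty) : ConnSet G (A ∪ B) := by
  refine hA.of_hub Set.subset_union_left ?_
  rintro v (hv | hv)
  · exact ⟨A, hA, Set.subset_union_left, hv, by simpa using hA.1⟩
  · exact ⟨B, hB, Set.subset_union_right, hv, by rwa [Set.inter_comm]⟩

theorem ConnSet.pair {a b : V} (h : G.Adj a b) : ConnSet G {a, b} := by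
  refine ⟨⟨a, by simp⟩, ?_⟩
  rintro T ⟨v, hv, hvT⟩ hcl
  rintro w hw
  simp only [Set.mem_insert_iff, Set.mem_singleton_iff] at hv hw
  rcases hv with rfl | rfl <;> rcases hw with rfl | rfl
  · exact hvT
  · exact hcl v (by simp) hvT w (by simp) h
  · exact hcl v (by simp) hvT w (by simp) h.symm
  · exact hvT

theorem ConnSet.union_adj {A B : Set V} (hA : ConnSet G A) (hB : ConnSet G B)
    (h : AdjSet G A B) : ConnSet G (A ∪ B) := by
  obtain ⟨a, ha, b, hb, hab⟩ := h
  have h₁ := hA.union (ConnSet.pair hab) ⟨a, ha, by simp⟩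
  have h₂ := h₁.union hB ⟨b, by simp, hb⟩
  convert h₂ using 1
  ext v
  simp only [Set.mem_union, Set.mem_insert_iff, Set.mem_singleton_iff]
  constructor
  · tauto
  · rintro ((h | rfl | rfl) | h) <;> tauto

theorem ConnSet.insert_adj {A : Set V} {v w : V} (hA : ConnSet G A) (hw : w ∈ A)
    (h : G.Adj v w) : ConnSet G (insert v A) := by
  rw [Set.insert_eq]
  exact (ConnSet.singleton v).union_adj hA ⟨v, rfl, w, hw, h⟩

theorem ConnSet.mono_graph {G' : SimpleGraph V} {S : Set V} (hS : ConnSet G S)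
    (h : ∀ a ∈ S, ∀ b ∈ S, G.Adj a b → G'.Adj a b) : ConnSet G' S :=
  ⟨hS.1, fun T hT hcl => hS.2 T hT fun a ha haT b hb hab => hcl a ha haT b hb (h a ha b hb hab)⟩

theorem comp_subset {S : Set V} {v : V} : comp G S v ⊆ S := by
  rintro w ⟨C, -, hCS, -, hw⟩
  exact hCS hw

theorem mem_comp_self {S : Set V} {v : V} (hv : v ∈ S) : v ∈ comp G S v :=
  ⟨{v}, ConnSet.singleton v, by simpa using hv, rfl, rfl⟩

theorem subset_comp {S C : Set V} {v : V} (hC : ConnSet G C) (hCS : C ⊆ S) (hv : v ∈ C) :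
    C ⊆ comp G S v := fun _ hw => ⟨C, hC, hCS, hv, hw⟩

theorem comp_conn {S : Set V} {v : V} (hv : v ∈ S) : ConnSet G (comp G S v) := by
  refine (ConnSet.singleton v).of_hub (by simpa using mem_comp_self hv) ?_
  rintro w ⟨C, hC, hCS, hvC, hw⟩
  exact ⟨C, hC, subset_comp hC hCS hvC, hw, v, hvC, rfl⟩

theorem comp_max {S C : Set V} {v : V} (hC : ConnSet G C) (hCS : C ⊆ S)
    (h : (C ∩ comp G S v).Nonempty) : C ⊆ comp G S v := by
  obtain ⟨w, hwC, D, hD, hDS, hvD, hwD⟩ := h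
  exact fun u hu => ⟨C ∪ D, hC.union hD ⟨w, hwC, hwD⟩, Set.union_subset hCS hDS, Or.inr hvD,
    Or.inl hu⟩

theorem comp_closed {S : Set V} {v a b : V} (ha : a ∈ comp G S v) (hb : b ∈ S)
    (h : G.Adj a b) : b ∈ comp G S v := by
  refine comp_max (ConnSet.pair h) ?_ ⟨a, by simp, ha⟩ (by simp)
  rintro w (rfl | rfl)
  · exact comp_subset ha
  · exact hb

theorem comp_mono {S S' : Set V} (h : S ⊆ S') (v : V) : comp G S v ⊆ comp G S' v := by
  rintro w ⟨C, hC, hCS, hv, hw⟩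
  exact ⟨C, hC, hCS.trans h, hv, hw⟩

theorem comp_symm {S : Set V} {v w : V} (h : w ∈ comp G S v) : v ∈ comp G S w := by
  obtain ⟨C, hC, hCS, hv, hw⟩ := h
  exact ⟨C, hC, hCS, hw, hv⟩

theorem comp_eq {S : Set V} {v w : V} (h : w ∈ comp G S v) : comp G S w = comp G S v := by
  have hw : w ∈ S := comp_subset h
  have hv : v ∈ S := comp_subset (comp_symm h)
  exact (comp_max (comp_conn hw) comp_subset ⟨w, mem_comp_self hw, h⟩).antisymm
    (comp_max (comp_conn hv) comp_subset ⟨w, h, mem_comp_self hw⟩)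

/-- In a connected set, every component of the complement of a nonempty subset is adjacent to
that subset. -/
theorem ConnSet.comp_adj {W K : Set V} {v : V} (hW : ConnSet G W) (hKW : K ⊆ W)
    (hK : K.Nonempty) (hv : v ∈ W \ K) : AdjSet G (comp G (W \ K) v) K := by
  obtain ⟨k, hk⟩ := hK
  obtain ⟨a, -, haC, b, hb, hbC, hab⟩ := hW.exit (T := comp G (W \ K) v)
    ⟨v, hv.1, mem_comp_self hv⟩ ⟨k, hKW hk, fun h => (comp_subset h).2 hk⟩
  refine ⟨a, haC, b, ?_, hab⟩
  by_contra hbK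
  exact hbC (comp_closed haC ⟨hb, hbK⟩ hab)

theorem ConnSet.diff_comp {W K : Set V} {v : V} (hW : ConnSet G W) (hKW : K ⊆ W)
    (hK : ConnSet G K) : ConnSet G (W \ comp G (W \ K) v) := by
  refine hK.of_hub (fun k hk => ⟨hKW hk, fun h => (comp_subset h).2 hk⟩) fun u hu => ?_
  by_cases huK : u ∈ K
  · exact ⟨K, hK, fun k hk => ⟨hKW hk, fun h => (comp_subset h).2 hk⟩, huK, by simpa using hK.1⟩
  have huW : u ∈ W \ K := ⟨hu.1, huK⟩
  refine ⟨comp G (W \ K) u ∪ K, (comp_conn huW).union_adj hK (hW.comp_adj hKW hK.1 huW), ?_,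
    Or.inl (mem_comp_self huW), ?_⟩
  · rintro w (hw | hw)
    · refine ⟨(comp_subset hw).1, fun hwv => hu.2 ?_⟩
      rw [← comp_eq hwv, comp_eq hw]
      exact mem_comp_self huW
    · exact ⟨hKW hw, fun h => (comp_subset h).2 hw⟩
  · obtain ⟨k, hk⟩ := hK.1
    exact ⟨k, Or.inr hk, hk⟩

theorem ConnSet.induce_connected {S : Set V} (hS : ConnSet G S) : (G.induce S).Connected := by
  rw [SimpleGraph.connected_iff]
  obtain ⟨v, hv⟩ := hS.1
  have key : ∀ w (hw : w ∈ S), (G.induce S).Reachable ⟨v, hv⟩ ⟨w, hw⟩ := by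
    have := hS.2 {w | ∃ hw : w ∈ S, (G.induce S).Reachable ⟨v, hv⟩ ⟨w, hw⟩}
      ⟨v, hv, hv, SimpleGraph.Reachable.refl _⟩ ?_
    · intro w hw
      exact (this hw).2
    · rintro a ha ⟨_, har⟩ b hb hab
      refine ⟨hb, har.trans (SimpleGraph.Adj.reachable ?_)⟩
      simpa using hab
  refine ⟨?_, ⟨v, hv⟩⟩
  rintro ⟨a, ha⟩ ⟨b, hb⟩
  exact (key a ha).symm.trans (key b hb)

/-- The graph obtained from `G` by keeping only the edges inside `R`. -/
def restr (G : SimpleGraph V) (R : Set V) : SimpleGraph V where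
  Adj a b := G.Adj a b ∧ a ∈ R ∧ b ∈ R
  symm := ⟨fun _ _ h => ⟨h.1.symm, h.2.2, h.2.1⟩⟩
  loopless := ⟨fun _ h => h.1.ne rfl⟩

theorem restr_le (R : Set V) : restr G R ≤ G := fun _ _ h => h.1

theorem ConnSet.of_le {G' : SimpleGraph V} {S : Set V} (hS : ConnSet G S) (h : G ≤ G') :
    ConnSet G' S := hS.mono_graph fun _ _ _ _ hab => h hab

theorem ConnSet.restr {S R : Set V} (hS : ConnSet G S) (h : S ⊆ R) : ConnSet (restr G R) S :=
  hS.mono_graph fun _ ha _ hb hab => ⟨hab, h ha, h hb⟩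

theorem ConnSet.subset_of_restr {S R : Set V} (hS : ConnSet (DoubleWheelMinor.restr G R) S)
    (h : (S ∩ R).Nonempty) : S ⊆ R :=
  hS.2 R h fun _ _ _ _ _ hab => hab.2.2

/-- A connected set that contains `v ∉ A` and meets `A` contains a connected set through `v`
that avoids `A` and is adjacent to a vertex of `A`. -/
theorem ConnSet.exists_to {C A : Set V} {v : V} (hC : ConnSet G C) (hv : v ∈ C) (hvA : v ∉ A)
    (h : (C ∩ A).Nonempty) :
    ∃ D ⊆ C \ A, ConnSet G D ∧ v ∈ D ∧ ∃ d ∈ D, ∃ a ∈ C ∩ A, G.Adj d a := by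
  refine ⟨comp G (C \ A) v, comp_subset, comp_conn ⟨hv, hvA⟩, mem_comp_self ⟨hv, hvA⟩, ?_⟩
  have := hC.comp_adj (K := C ∩ A) (v := v) Set.inter_subset_left h ⟨hv, fun h => hvA h.2⟩
  simpa [AdjSet, Set.sdiff_self_inter] using this

end

section

variable {V : Type*} {G : SimpleGraph V}

/-- The vertices outside `S` that can be reached from `A` in the complement of `S`. -/
def reach (G : SimpleGraph V) (S A : Set V) : Set V :=
  {v | ∃ C, ConnSet G C ∧ Disjoint C S ∧ v ∈ C ∧ (C ∩ A).Nonempty}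

theorem subset_reach {S A C : Set V} (hC : ConnSet G C) (hCS : Disjoint C S)
    (hA : (C ∩ A).Nonempty) : C ⊆ reach G S A := fun _ hv => ⟨C, hC, hCS, hv, hA⟩

theorem reach_disjoint {S A B : Set V}
    (h : ¬ ∃ C, ConnSet G C ∧ Disjoint C S ∧ (C ∩ A).Nonempty ∧ (C ∩ B).Nonempty) {v : V}
    (hA : v ∈ reach G S A) (hB : v ∈ reach G S B) : False := by
  obtain ⟨C, hC, hCS, hvC, a, haC, haA⟩ := hA
  obtain ⟨D, hD, hDS, hvD, b, hbD, hbB⟩ := hB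
  exact h ⟨C ∪ D, hC.union hD ⟨v, hvC, hvD⟩, by simp [hCS, hDS], ⟨a, Or.inl haC, haA⟩,
    ⟨b, Or.inr hbD, hbB⟩⟩

theorem menger_side {G' : SimpleGraph V} {x y : V} {S A B : Set V} {k : ℕ}
    (hsplit : ∀ a b, G.Adj a b → G'.Adj a b ∨ (a = x ∧ b = y) ∨ (a = y ∧ b = x))
    (hcond : ∀ T : Set V, T.ncard < k →
      ∃ C, ConnSet G C ∧ Disjoint C T ∧ (C ∩ A).Nonempty ∧ (C ∩ B).Nonempty)
    (hS : ¬ ∃ C, ConnSet G' C ∧ Disjoint C S ∧ (C ∩ A).Nonempty ∧ (C ∩ B).Nonempty)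
    (hx : x ∈ reach G' S A) (hy : y ∈ reach G' S B) (T : Set V) (hT : T.ncard < k) :
    ∃ C, ConnSet (restr G' (reach G' S A ∪ S)) C ∧ Disjoint C T ∧ (C ∩ A).Nonempty ∧
      (C ∩ insert x S).Nonempty := by
  have toG' : ∀ D, ConnSet G D → x ∉ D → ConnSet G' D := fun D hD hxD =>
    hD.mono_graph fun a ha b hb hab => by
      rcases hsplit a b hab with h | ⟨rfl, rfl⟩ | ⟨rfl, rfl⟩
      · exact h
      · exact (hxD ha).elim
      · exact (hxD hb).elim
  obtain ⟨C, hC, hCT, ⟨a, haC, haA⟩, hCB⟩ := hcond T hT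
  by_cases ha : a ∈ insert x S
  · exact ⟨{a}, ConnSet.singleton a, hCT.mono_left (by simpa using haC), ⟨a, rfl, haA⟩,
      ⟨a, rfl, ha⟩⟩
  have hmeet : (C ∩ insert x S).Nonempty := by
    by_contra hcon
    rw [Set.not_nonempty_iff_eq_empty, ← Set.disjoint_iff_inter_eq_empty,
      Set.disjoint_insert_right] at hcon
    exact hS ⟨C, toG' C hC hcon.1, hcon.2, ⟨a, haC, haA⟩, hCB⟩
  obtain ⟨D, hDC, hD, haD, d, hd, s, ⟨hsC, hs⟩, hds⟩ := hC.exists_to haC ha hmeet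
  have hxD : x ∉ D := fun h => (hDC h).2 (Set.mem_insert _ _)
  have hDS : Disjoint D S := Set.disjoint_left.2 fun v hv hvS => (hDC hv).2 (Or.inr hvS)
  have hD' := toG' D hD hxD
  have hDr : D ⊆ reach G' S A := subset_reach hD' hDS ⟨a, haD, haA⟩
  have hds' : G'.Adj d s := by
    rcases hsplit d s hds with h | ⟨rfl, rfl⟩ | ⟨rfl, rfl⟩
    · exact h
    · exact (hxD hd).elim
    · exact (reach_disjoint hS (hDr hd) hy).elim
  refine ⟨insert s D, (hD'.insert_adj hd hds'.symm).restr ?_, hCT.mono_left ?_,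
    ⟨a, Or.inr haD, haA⟩, ⟨s, Or.inl rfl, hs⟩⟩
  · rintro v (rfl | hv)
    · rcases hs with rfl | hs
      · exact Or.inl hx
      · exact Or.inr hs
    · exact Or.inl (hDr hv)
  · rintro v (rfl | hv)
    · exact hsC
    · exact (hDC hv).1

/-- Disjoint sets meeting a set of exactly as many elements pick these elements one each. -/
theorem exists_surj_choice [Finite V] {k : ℕ} {P : Fin k → Set V}
    (hP : Pairwise fun i j => Disjoint (P i) (P j)) {S : Set V} (hS : S.ncard = k)
    (hPS : ∀ i, (P i ∩ S).Nonempty) :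
    ∃ p : Fin k → V, (∀ i, p i ∈ P i) ∧ (∀ i, p i ∈ S) ∧ Function.Injective p ∧
      ∀ s ∈ S, ∃ i, p i = s := by
  choose p hp hpS using hPS
  have hinj : Function.Injective p := fun i j hij => by
    by_contra hne
    exact Set.disjoint_left.1 (hP hne) (hp i) (hij ▸ hp j)
  refine ⟨p, hp, hpS, hinj, fun s hs => ?_⟩
  have hr : Set.range p = S := by
    refine Set.eq_of_subset_of_ncard_le (Set.range_subset_iff.2 hpS) ?_ (Set.toFinite _)
    rw [hS, ← Set.image_univ, Set.ncard_image_of_injective _ hinj, Set.ncard_univ]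
    simp
  rw [← hr] at hs
  exact hs

/-- **Menger's theorem** for disjoint connected sets joining `A` to `B`. -/
theorem menger [Finite V] (G : SimpleGraph V) (A B : Set V) (k : ℕ)
    (h : ∀ S : Set V, S.ncard < k →
      ∃ C, ConnSet G C ∧ Disjoint C S ∧ (C ∩ A).Nonempty ∧ (C ∩ B).Nonempty) :
    ∃ P : Fin k → Set V, (∀ i, ConnSet G (P i)) ∧ (Pairwise fun i j => Disjoint (P i) (P j)) ∧
      ∀ i, (P i ∩ A).Nonempty ∧ (P i ∩ B).Nonempty := by
  induction hn : G.edgeSet.ncard using Nat.strong_induction_on generalizing G A B with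
  | _ n ih =>
  by_cases hE : ∃ x y, G.Adj x y
  swap
  · have hk : k ≤ (A ∩ B).ncard := by
      by_contra hlt
      obtain ⟨C, hC, hCS, ⟨a, haC, haA⟩, b, hbC, hbB⟩ := h (A ∩ B) (by omega)
      have hCa : C ⊆ {a} := hC.2 {a} ⟨a, haC, rfl⟩ fun u _ _ v _ huv => (hE ⟨u, v, huv⟩).elim
      have hba : b = a := hCa hbC
      exact Set.disjoint_left.1 hCS haC ⟨haA, hba ▸ hbB⟩
    obtain ⟨T, hT, hTk⟩ := Set.exists_subset_card_eq hk
    have e : Fin k ≃ T := (Finite.equivFinOfCardEq (by rw [← hTk]; rfl)).symm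
    refine ⟨fun i => {(e i : V)}, fun i => ConnSet.singleton _, fun i j hij => ?_, fun i => ?_⟩
    · simpa using fun heq => hij (e.injective (Subtype.ext heq.symm)).symm
    · exact ⟨⟨_, rfl, (hT (e i).2).1⟩, ⟨_, rfl, (hT (e i).2).2⟩⟩
  obtain ⟨x₀, y₀, hxy₀⟩ := hE
  set G' := G.deleteEdges {s(x₀, y₀)} with hG'
  have hle : G' ≤ G := G.deleteEdges_le _
  have hlt : ∀ H : SimpleGraph V, H ≤ G' → H.edgeSet.ncard < n := by
    intro H hH
    rw [← hn]
    refine Set.ncard_lt_ncard ?_ (Set.toFinite _)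
    refine ⟨SimpleGraph.edgeSet_mono (hH.trans hle), fun hcon => ?_⟩
    have h1 : s(x₀, y₀) ∈ H.edgeSet := hcon hxy₀
    have h2 : G'.Adj x₀ y₀ := hH h1
    simp [hG'] at h2
  by_cases hcond : ∀ S : Set V, S.ncard < k →
      ∃ C, ConnSet G' C ∧ Disjoint C S ∧ (C ∩ A).Nonempty ∧ (C ∩ B).Nonempty
  · obtain ⟨P, hP, hP'⟩ := ih _ (hlt G' le_rfl) G' A B hcond rfl
    exact ⟨P, fun i => (hP i).of_le hle, hP'⟩
  push Not at hcond
  obtain ⟨S, hSk, hS'⟩ := hcond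
  have hS : ¬ ∃ C, ConnSet G' C ∧ Disjoint C S ∧ (C ∩ A).Nonempty ∧ (C ∩ B).Nonempty := by
    rintro ⟨C, h1, h2, h3, h4⟩
    have := hS' C h1 h2 h3
    simp_all
  clear hS'
  obtain ⟨C, hC, hCS, ⟨a, haC, haA⟩, b, hbC, hbB⟩ := h S hSk
  have hsplit₀ : ∀ a b, G.Adj a b → G'.Adj a b ∨ (a = x₀ ∧ b = y₀) ∨ (a = y₀ ∧ b = x₀) := by
    intro a b hab
    simp only [hG', SimpleGraph.deleteEdges_adj, Set.mem_singleton_iff, Sym2.eq_iff]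
    tauto
  have toG' : ∀ D, ConnSet G D → (x₀ ∉ D ∨ y₀ ∉ D) → ConnSet G' D := fun D hD hxD =>
    hD.mono_graph fun a ha b hb hab => by
      rcases hsplit₀ a b hab with h | ⟨rfl, rfl⟩ | ⟨rfl, rfl⟩ <;> tauto
  have hx₀C : x₀ ∈ C ∧ y₀ ∈ C := by
    by_contra hcon
    exact hS ⟨C, toG' C hC (by tauto), hCS, ⟨a, haC, haA⟩, b, hbC, hbB⟩
  have hcov : ∀ v ∈ C, v ∈ comp G' C x₀ ∨ v ∈ comp G' C y₀ := by
    refine hC.2 {v | v ∈ comp G' C x₀ ∨ v ∈ comp G' C y₀}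
      ⟨x₀, hx₀C.1, Or.inl (mem_comp_self hx₀C.1)⟩ ?_
    rintro u hu hu' v hv huv
    rcases hsplit₀ u v huv with h | ⟨rfl, rfl⟩ | ⟨rfl, rfl⟩
    · exact hu'.imp (fun hu' => comp_closed hu' hv h) (fun hu' => comp_closed hu' hv h)
    · exact Or.inr (mem_comp_self hv)
    · exact Or.inl (mem_comp_self hv)
  obtain ⟨x, y, hxy, hsplit, hx, hy⟩ : ∃ x y, G.Adj x y ∧
      (∀ a b, G.Adj a b → G'.Adj a b ∨ (a = x ∧ b = y) ∨ (a = y ∧ b = x)) ∧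
      x ∈ reach G' S A ∧ y ∈ reach G' S B := by
    have hcomp : ∀ z ∈ C, ConnSet G' (comp G' C z) ∧ Disjoint (comp G' C z) S := fun z hz =>
      ⟨comp_conn hz, hCS.mono_left comp_subset⟩
    have hmem : ∀ z ∈ C, ∀ w ∈ comp G' C z, ∀ A : Set V, w ∈ A → z ∈ reach G' S A :=
      fun z hz w hw A hwA =>
        ⟨_, (hcomp z hz).1, (hcomp z hz).2, mem_comp_self hz, w, hw, hwA⟩
    rcases hcov a haC with ha | ha <;> rcases hcov b hbC with hb | hb
    · exact (reach_disjoint hS (hmem _ hx₀C.1 _ ha _ haA) (hmem _ hx₀C.1 _ hb _ hbB)).elim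
    · exact ⟨x₀, y₀, hxy₀, hsplit₀, hmem _ hx₀C.1 _ ha _ haA, hmem _ hx₀C.2 _ hb _ hbB⟩
    · exact ⟨y₀, x₀, hxy₀.symm, fun a b hab => (hsplit₀ a b hab).imp_right Or.symm,
        hmem _ hx₀C.2 _ ha _ haA, hmem _ hx₀C.1 _ hb _ hbB⟩
    · exact (reach_disjoint hS (hmem _ hx₀C.2 _ ha _ haA) (hmem _ hx₀C.2 _ hb _ hbB)).elim
  have notS : ∀ {A : Set V} {z : V}, z ∈ reach G' S A → z ∉ S := by
    rintro A z ⟨D, -, hDS, hz, -⟩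
    exact Set.disjoint_left.1 hDS hz
  have hcard : ∀ z, z ∉ S → (z = x₀ ∨ z = y₀) → (insert z S).ncard = k := by
    intro z hz hz'
    rw [Set.ncard_insert_of_notMem hz]
    by_contra hne
    obtain ⟨D, hD, hDS, hDA, hDB⟩ := h (insert z S) (by
      rw [Set.ncard_insert_of_notMem hz]; omega)
    rw [Set.disjoint_insert_right] at hDS
    refine hS ⟨D, toG' D hD ?_, hDS.2, hDA, hDB⟩
    rcases hz' with rfl | rfl <;> tauto
  have hxy' : (x = x₀ ∧ y = y₀) ∨ (x = y₀ ∧ y = x₀) := by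
    rcases hsplit₀ x y hxy with h | h
    · obtain ⟨D, hD, hDS, hxD, hDA⟩ := hx
      obtain ⟨D', hD', hDS', hyD', hDB⟩ := hy
      exact (hS ⟨D ∪ D', hD.union_adj hD' ⟨x, hxD, y, hyD', h⟩, by simp [hDS, hDS'],
        hDA.mono (by gcongr; simp), hDB.mono (by gcongr; simp)⟩).elim
    · exact h
  have hkx := hcard x (notS hx) (by tauto)
  have hky := hcard y (notS hy) (by tauto)
  have hS₂ : ¬ ∃ C, ConnSet G' C ∧ Disjoint C S ∧ (C ∩ B).Nonempty ∧ (C ∩ A).Nonempty := by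
    rintro ⟨C, h1, h2, h3, h4⟩
    exact hS ⟨C, h1, h2, h4, h3⟩
  obtain ⟨P, hP, hPd, hPm⟩ := ih _ (hlt _ (restr_le _)) (restr G' (reach G' S A ∪ S)) A
    (insert x S) (menger_side hsplit h hS hx hy) rfl
  obtain ⟨Q, hQ, hQd, hQm⟩ := ih _ (hlt _ (restr_le _)) (restr G' (reach G' S B ∪ S)) B
    (insert y S) (menger_side (fun a b hab => (hsplit a b hab).imp_right Or.symm)
      (fun T hT => by obtain ⟨C, h1, h2, h3, h4⟩ := h T hT; exact ⟨C, h1, h2, h4, h3⟩)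
      hS₂ hy hx) rfl
  obtain ⟨p, hp, hpS, hpi, hps⟩ := exists_surj_choice hPd hkx fun i => (hPm i).2
  obtain ⟨q, hq, hqS, hqi, hqs⟩ := exists_surj_choice hQd hky fun i => (hQm i).2
  have hPsub : ∀ i, P i ⊆ reach G' S A ∪ S := fun i => (hP i).subset_of_restr
    ⟨p i, hp i, (hpS i).elim (fun h => Or.inl (h ▸ hx)) Or.inr⟩
  have hQsub : ∀ i, Q i ⊆ reach G' S B ∪ S := fun i => (hQ i).subset_of_restr
    ⟨q i, hq i, (hqS i).elim (fun h => Or.inl (h ▸ hy)) Or.inr⟩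
  have hpart : ∀ i, ∃ j, (p i = x ∧ q j = y) ∨ (p i ∈ S ∧ q j = p i) := by
    intro i
    rcases hpS i with hi | hi
    · obtain ⟨j, hj⟩ := hqs y (Or.inl rfl)
      exact ⟨j, Or.inl ⟨hi, hj⟩⟩
    · obtain ⟨j, hj⟩ := hqs (p i) (Or.inr hi)
      exact ⟨j, Or.inr ⟨hi, hj⟩⟩
  choose f hf using hpart
  have hPQ : ∀ i i' v, v ∈ P i → v ∈ Q (f i') → i = i' := by
    intro i i' v hvP hvQ
    have hvS : v ∈ S := by
      rcases hPsub i hvP with h1 | h1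
      · rcases hQsub _ hvQ with h2 | h2
        · exact (reach_disjoint hS h1 h2).elim
        · exact h2
      · exact h1
    obtain ⟨i₁, hi₁⟩ := hps v (Or.inr hvS)
    obtain ⟨j₁, hj₁⟩ := hqs v (Or.inr hvS)
    have e1 : i₁ = i := by
      by_contra hne
      exact Set.disjoint_left.1 (hPd hne) (hp i₁) (hi₁ ▸ hvP)
    have e2 : j₁ = f i' := by
      by_contra hne
      exact Set.disjoint_left.1 (hQd hne) (hq j₁) (hj₁ ▸ hvQ)
    subst e1
    rw [e2] at hj₁
    rcases hf i' with ⟨-, h2⟩ | ⟨-, h2⟩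
    · rw [← hj₁, h2] at hvS
      exact (notS hy hvS).elim
    · exact hpi (by rw [hi₁, ← h2, hj₁])
  refine ⟨fun i => P i ∪ Q (f i), fun i => ?_, fun i i' hne => ?_, fun i => ⟨?_, ?_⟩⟩
  · have h1 := ((hP i).of_le (restr_le _)).of_le hle
    have h2 := ((hQ (f i)).of_le (restr_le _)).of_le hle
    rcases hf i with ⟨h3, h4⟩ | ⟨h3, h4⟩
    · exact h1.union_adj h2 ⟨p i, hp i, q (f i), hq _, by rwa [h3, h4]⟩
    · exact h1.union h2 ⟨p i, hp i, h4 ▸ hq (f i)⟩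
  · refine Set.disjoint_left.2 ?_
    rintro v (hv | hv) (hv' | hv')
    · exact Set.disjoint_left.1 (hPd hne) hv hv'
    · exact hne (hPQ _ _ _ hv hv')
    · exact hne (hPQ _ _ _ hv' hv).symm
    · have : f i = f i' := by
        by_contra hne'
        exact Set.disjoint_left.1 (hQd hne') hv hv'
      refine hne (hpi ?_)
      rcases hf i with ⟨h3, h4⟩ | ⟨h3, h4⟩ <;> rcases hf i' with ⟨h5, h6⟩ | ⟨h5, h6⟩
      · rw [h3, h5]
      · rw [this, h6] at h4
        exact (notS hy (h4 ▸ h5)).elim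
      · rw [← this, h4] at h6
        exact (notS hy (h6 ▸ h3)).elim
      · rw [← h4, ← h6, this]
  · exact (hPm i).1.mono (by gcongr; simp)
  · exact (hQm (f i)).1.mono (by gcongr; simp)

end

section

variable {V : Type*} {G : SimpleGraph V}

/-- `TreeDec G b U 𝓑` : the subgraph of `G` induced by `U` has a tree decomposition with set of
bags `𝓑`, each of size at most `b`. -/
inductive TreeDec (G : SimpleGraph V) (b : ℕ) : Set V → Set (Set V) → Prop
  | leaf (B : Set V) (h : B.ncard ≤ b) : TreeDec G b B {B}
  | glue {U₁ U₂ B₁ B₂ : Set V} {𝓑₁ 𝓑₂ : Set (Set V)} (h₁ : TreeDec G b U₁ 𝓑₁)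
      (h₂ : TreeDec G b U₂ 𝓑₂) (hB₁ : B₁ ∈ 𝓑₁) (hB₂ : B₂ ∈ 𝓑₂) (hi : U₁ ∩ U₂ ⊆ B₁ ∩ B₂)
      (he : ∀ a ∈ U₁, a ∉ U₂ → ∀ c ∈ U₂, c ∉ U₁ → ¬ G.Adj a c) :
      TreeDec G b (U₁ ∪ U₂) (𝓑₁ ∪ 𝓑₂)

theorem TreeDec.anti {G' : SimpleGraph V} {b : ℕ} {U : Set V} {𝓑 : Set (Set V)}
    (h : TreeDec G b U 𝓑) (hle : G' ≤ G) : TreeDec G' b U 𝓑 := by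
  induction h with
  | leaf B h => exact .leaf B h
  | glue _ _ hB₁ hB₂ hi he ih₁ ih₂ =>
    exact .glue ih₁ ih₂ hB₁ hB₂ hi fun a ha ha' c hc hc' hac => he a ha ha' c hc hc' (hle hac)

theorem TreeDec.exists_clique_subset {b : ℕ} {U : Set V} {𝓑 : Set (Set V)}
    (h : TreeDec G b U 𝓑) {K : Set V} (hKU : K ⊆ U)
    (hK : ∀ a ∈ K, ∀ c ∈ K, a ≠ c → G.Adj a c) : ∃ B ∈ 𝓑, K ⊆ B := by
  induction h with
  | leaf B h => exact ⟨B, rfl, hKU⟩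
  | @glue U₁ U₂ _ _ _ _ _ _ hB₁ hB₂ hi he ih₁ ih₂ =>
    by_cases h₁ : K ⊆ U₁
    · obtain ⟨B, hB, hKB⟩ := ih₁ h₁
      exact ⟨B, Or.inl hB, hKB⟩
    by_cases h₂ : K ⊆ U₂
    · obtain ⟨B, hB, hKB⟩ := ih₂ h₂
      exact ⟨B, Or.inr hB, hKB⟩
    obtain ⟨a, haK, ha⟩ := Set.not_subset.1 h₂
    obtain ⟨c, hcK, hc⟩ := Set.not_subset.1 h₁
    have ha' : a ∈ U₁ := (hKU haK).resolve_right ha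
    have hc' : c ∈ U₂ := (hKU hcK).resolve_left hc
    exact (he a ha' ha c hc' hc (hK a haK c hcK fun h => ha (h ▸ hc'))).elim

theorem ConnSet.image {W : Type*} {H : SimpleGraph W} {S : Set V} (hS : ConnSet G S) {f : V → W}
    (hf : ∀ a b, G.Adj a b → H.Adj (f a) (f b)) : ConnSet H (f '' S) := by
  refine ⟨hS.1.image f, ?_⟩
  rintro T ⟨_, ⟨v, hv, rfl⟩, hvT⟩ hcl _ ⟨w, hw, rfl⟩
  exact hS.2 (f ⁻¹' T) ⟨v, hv, hvT⟩ (fun a ha haT b hb hab =>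
    hcl _ ⟨a, ha, rfl⟩ haT _ ⟨b, hb, rfl⟩ (hf a b hab)) hw

theorem ConnSet.isTree {ι : Type*} [Finite ι] {t : SimpleGraph ι} (h : ConnSet t Set.univ)
    (hc : Nat.card t.edgeSet + 1 = Nat.card ι) : t.IsTree := by
  rw [SimpleGraph.isTree_iff_connected_and_card]
  exact ⟨(SimpleGraph.induceUnivIso t).connected_iff.1 h.induce_connected, hc⟩

theorem TreeDec.exists_tree {b : ℕ} {U : Set V} {𝓑 : Set (Set V)} (h : TreeDec G b U 𝓑) :
    ∃ (ι : Type) (_ : Fintype ι) (t : SimpleGraph ι) (bag : ι → Set V),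
      (ConnSet t Set.univ ∧ Nat.card t.edgeSet + 1 = Nat.card ι) ∧
      (∀ a ∈ U, ∀ c ∈ U, (a = c ∨ G.Adj a c) → ∃ i, a ∈ bag i ∧ c ∈ bag i) ∧
      (∀ v ∈ U, ConnSet t {i | v ∈ bag i}) ∧ (∀ i, (bag i).ncard ≤ b) ∧
      (∀ B ∈ 𝓑, ∃ i, bag i = B) ∧ ∀ i, bag i ⊆ U := by
  induction h with
  | leaf B h =>
    refine ⟨Unit, inferInstance, ⊥, fun _ => B, ⟨?_, by simp⟩, ?_, fun v hv => ?_, fun _ => h, ?_,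
      fun _ => le_rfl⟩
    · convert ConnSet.singleton (G := (⊥ : SimpleGraph Unit)) ()
      ext
      simp
    · exact fun a ha c hc _ => ⟨(), ha, hc⟩
    · convert ConnSet.singleton (G := (⊥ : SimpleGraph Unit)) ()
      ext
      simpa using hv
    · rintro _ rfl
      exact ⟨(), rfl⟩
  | @glue U₁ U₂ B₁ B₂ 𝓑₁ 𝓑₂ _ _ hB₁ hB₂ hi he ih₁ ih₂ =>
    obtain ⟨ι₁, _, t₁, bag₁, ⟨hc₁, hn₁⟩, hadj₁, hv₁, hb₁, hB₁', hU₁⟩ := ih₁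
    obtain ⟨ι₂, _, t₂, bag₂, ⟨hc₂, hn₂⟩, hadj₂, hv₂, hb₂, hB₂', hU₂⟩ := ih₂
    obtain ⟨i₁, hi₁⟩ := hB₁' _ hB₁
    obtain ⟨i₂, hi₂⟩ := hB₂' _ hB₂
    set t : SimpleGraph (ι₁ ⊕ ι₂) := (t₁.sum t₂) ⊔ SimpleGraph.edge (.inl i₁) (.inr i₂) with ht
    have hl : ∀ a b, t₁.Adj a b → t.Adj (.inl a) (.inl b) := fun a b hab => Or.inl (by simpa)
    have hr : ∀ a b, t₂.Adj a b → t.Adj (.inr a) (.inr b) := fun a b hab => Or.inl (by simpa)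
    have hlr : t.Adj (.inl i₁) (.inr i₂) := by
      simp [ht, SimpleGraph.sup_adj, SimpleGraph.edge_adj]
    refine ⟨ι₁ ⊕ ι₂, inferInstance, t, Sum.elim bag₁ bag₂, ⟨?_, ?_⟩, ?_, ?_, ?_, ?_, ?_⟩
    · have := (hc₁.image hl).union_adj (hc₂.image hr)
        ⟨_, ⟨i₁, trivial, rfl⟩, _, ⟨i₂, trivial, rfl⟩, hlr⟩
      convert this
      ext (i | i) <;> simp
    · have h1 : t.edgeSet = insert s(.inl i₁, .inr i₂) (t₁.sum t₂).edgeSet := by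
        rw [ht, SimpleGraph.edgeSet_sup, SimpleGraph.edgeSet_edge_of_ne (by simp),
          Set.union_comm, Set.insert_eq]
      have h2 : Nat.card t.edgeSet = (t₁.sum t₂).edgeSet.ncard + 1 := by
        rw [Nat.card_coe_set_eq, h1, Set.ncard_insert_of_notMem (by simp)]
      have h3 : (t₁.sum t₂).edgeSet.ncard = Nat.card t₁.edgeSet + Nat.card t₂.edgeSet := by
        rw [← Nat.card_coe_set_eq, Nat.card_congr SimpleGraph.edgeSetSumEquiv, Nat.card_sum]
      rw [h2, h3, Nat.card_sum]
      omega
    · have key : ∀ a ∈ U₁ ∪ U₂, ∀ c ∈ U₁ ∪ U₂, (a = c ∨ G.Adj a c) →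
          (a ∈ U₁ ∧ c ∈ U₁) ∨ (a ∈ U₂ ∧ c ∈ U₂) := by
        intro a ha c hc hac
        by_contra hcon
        rcases hac with rfl | hac
        · rcases ha with ha | ha <;> tauto
        · rcases ha with ha | ha <;> rcases hc with hc | hc
          · tauto
          · exact he a ha (by tauto) c hc (by tauto) hac
          · exact he c hc (by tauto) a ha (by tauto) hac.symm
          · tauto
      intro a ha c hc hac
      rcases key a ha c hc hac with ⟨h1, h2⟩ | ⟨h1, h2⟩
      · obtain ⟨i, hi⟩ := hadj₁ a h1 c h2 hac
        exact ⟨.inl i, hi⟩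
      · obtain ⟨i, hi⟩ := hadj₂ a h1 c h2 hac
        exact ⟨.inr i, hi⟩
    · intro v hv
      have e : {i | v ∈ Sum.elim bag₁ bag₂ i} =
          Sum.inl '' {i | v ∈ bag₁ i} ∪ Sum.inr '' {i | v ∈ bag₂ i} := by
        ext (i | i) <;> simp
      rw [e]
      by_cases h1 : v ∈ U₁
      · by_cases h2 : v ∈ U₂
        · have := hi ⟨h1, h2⟩
          exact ((hv₁ v h1).image hl).union_adj ((hv₂ v h2).image hr)
            ⟨_, ⟨i₁, by simpa [hi₁] using this.1, rfl⟩, _, ⟨i₂, by simpa [hi₂] using this.2, rfl⟩,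
              hlr⟩
        · have : {i | v ∈ bag₂ i} = ∅ := by
            ext i
            simpa using fun h => h2 (hU₂ i h)
          rw [this, Set.image_empty, Set.union_empty]
          exact (hv₁ v h1).image hl
      · have : {i | v ∈ bag₁ i} = ∅ := by
          ext i
          simpa using fun h => h1 (hU₁ i h)
        rw [this, Set.image_empty, Set.empty_union]
        exact (hv₂ v (hv.resolve_left h1)).image hr
    · rintro (i | i)
      · exact hb₁ i
      · exact hb₂ i
    · rintro B (hB | hB)
      · obtain ⟨i, hi⟩ := hB₁' B hB
        exact ⟨.inl i, hi⟩
      · obtain ⟨i, hi⟩ := hB₂' B hB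
        exact ⟨.inr i, hi⟩
    · rintro (i | i)
      · exact (hU₁ i).trans Set.subset_union_left
      · exact (hU₂ i).trans Set.subset_union_right

theorem TreeDec.treewidth_le [Fintype V] {b : ℕ} {𝓑 : Set (Set V)}
    (h : TreeDec G (b + 1) Set.univ 𝓑) : treewidth G ≤ b := by
  classical
  obtain ⟨ι, hι, t, bag, ht, hadj, hv, hb, -, -⟩ := h.exists_tree
  refine Nat.sInf_le ⟨ι, hι, t, fun i => (bag i).toFinset, ht.1.isTree ht.2, fun v => ?_,
    fun u v huv => ?_, fun v => ?_, fun i => ?_⟩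
  · obtain ⟨i, hi, -⟩ := hadj v trivial v trivial (Or.inl rfl)
    exact ⟨i, by simpa using hi⟩
  · simpa using hadj u trivial v trivial (Or.inr huv)
  · have e : {i | v ∈ (bag i).toFinset} = {i | v ∈ bag i} := by
      ext
      simp
    rw [e]
    exact (hv v trivial).induce_connected
  · rw [← Set.ncard_eq_toFinset_card']
    exact hb i

/-- Decompositions of the components of `D` together with their neighbourhoods can be attached to
a bag `B` containing these neighbourhoods. -/
theorem treeDec_attach [Finite V] {b : ℕ} {B D : Set V} (hB : B.ncard ≤ b) (hBD : Disjoint B D)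
    (h : ∀ v ∈ D, ∃ 𝓑, TreeDec G b (comp G D v ∪ {w ∈ B | ∃ a ∈ comp G D v, G.Adj a w}) 𝓑 ∧
      ∃ B' ∈ 𝓑, {w ∈ B | ∃ a ∈ comp G D v, G.Adj a w} ⊆ B') :
    ∃ 𝓑, TreeDec G b (B ∪ D) 𝓑 ∧ B ∈ 𝓑 := by
  have key : ∀ n, ∀ E ⊆ D, E.ncard = n → (∀ a ∈ E, ∀ c ∈ D, G.Adj a c → c ∈ E) →
      ∃ 𝓑, TreeDec G b (B ∪ E) 𝓑 ∧ B ∈ 𝓑 := by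
    intro n
    induction n using Nat.strong_induction_on with
    | _ n ih =>
    intro E hED hn hcl
    rcases E.eq_empty_or_nonempty with rfl | ⟨v, hv⟩
    · exact ⟨{B}, by simpa using TreeDec.leaf B hB, rfl⟩
    set K := comp G D v with hK
    have hvK : v ∈ K := mem_comp_self (hED hv)
    have hKD : K ⊆ D := comp_subset
    have hKE : K ⊆ E := (comp_conn (hED hv)).2 E ⟨v, hvK, hv⟩ fun a _ haE c hc hac =>
      hcl a haE c (hKD hc) hac
    obtain ⟨𝓑₁, h₁, hB₁⟩ := ih (E \ K).ncard (by
      rw [← hn]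
      exact Set.ncard_lt_ncard ⟨Set.sdiff_subset, fun hc => (hc hv).2 hvK⟩ (Set.toFinite _))
      (E \ K) (Set.sdiff_subset.trans hED) rfl fun a ha c hc hac => ⟨hcl a ha.1 c hc hac,
        fun hcK => ha.2 (comp_closed hcK (hED ha.1) hac.symm)⟩
    obtain ⟨𝓑₂, h₂, B₂, hB₂, hB₂'⟩ := h v (hED hv)
    refine ⟨𝓑₁ ∪ 𝓑₂, ?_, Or.inl hB₁⟩
    have := TreeDec.glue h₁ h₂ hB₁ hB₂ ?_ ?_
    · convert this using 1
      ext w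
      have := @hKE w
      simp only [Set.mem_union, Set.mem_sdiff, Set.mem_ofPred_eq]
      tauto
    · rintro w ⟨hw₁, hw₂⟩
      have hwK : w ∉ K := fun hwK => by
        rcases hw₁ with hw₁ | hw₁
        · exact Set.disjoint_left.1 hBD hw₁ (hKD hwK)
        · exact hw₁.2 hwK
      have := hw₂.resolve_left hwK
      exact ⟨this.1, hB₂' this⟩
    · rintro a ha ha' c hc hc' hac
      simp only [Set.mem_union, not_or] at ha' hc'
      have hcK : c ∈ K := hc.resolve_right fun h => hc'.1 h.1
      rcases ha with ha | ha
      · exact ha'.2 ⟨ha, c, hcK, hac.symm⟩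
      · exact ha'.1 (comp_closed hcK (hED ha.1) hac.symm)
  exact key _ D le_rfl rfl fun _ _ _ hc _ => hc

/-- If every small set has a small balanced separator, then there is a tree decomposition of
small width. -/
theorem treeDec_of_balanced [Finite V] (k : ℕ)
    (hbal : ∀ Ω : Set V, Ω.ncard ≤ 2 * k + 1 → ∃ Z : Set V, Z.ncard ≤ k ∧
      ∀ C, ConnSet G C → Disjoint C Z → 2 * (C ∩ Ω).ncard ≤ Ω.ncard) :
    ∃ 𝓑, TreeDec G (3 * k + 1) Set.univ 𝓑 := by
  have key : ∀ n, ∀ C W : Set V, C.ncard = n → Disjoint C W →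
      (∀ a ∈ C, ∀ c, G.Adj a c → c ∈ C ∪ W) → W.ncard ≤ 2 * k →
      ∃ 𝓑, TreeDec G (3 * k + 1) (C ∪ W) 𝓑 ∧ ∃ B ∈ 𝓑, W ⊆ B := by
    intro n
    induction n using Nat.strong_induction_on with
    | _ n ih =>
    intro C W hn hCW hN hW
    rcases C.eq_empty_or_nonempty with rfl | ⟨u, hu⟩
    · exact ⟨{W}, by simpa using TreeDec.leaf W (by omega), W, rfl, le_rfl⟩
    have hΩ : (insert u W).ncard ≤ 2 * k + 1 := (Set.ncard_insert_le _ _).trans (by omega)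
    obtain ⟨Z, hZk, hZ⟩ := hbal (insert u W) hΩ
    set B := insert u W ∪ (Z ∩ C) with hB
    have hBk : B.ncard ≤ 3 * k + 1 := by
      have h1 := Set.ncard_union_le (insert u W) (Z ∩ C)
      have h2 := Set.ncard_le_ncard (Set.inter_subset_left (s := Z) (t := C)) (Set.toFinite _)
      rw [hB]
      omega
    obtain ⟨𝓑, h𝓑, hB𝓑⟩ := treeDec_attach (G := G) (B := B) (D := C \ B) hBk
      Set.disjoint_sdiff_right fun v hv => by
        set K := comp G (C \ B) v with hK
        have hKC : K ⊆ C \ B := comp_subset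
        set N := {w ∈ B | ∃ a ∈ K, G.Adj a w} with hN'
        refine (ih K.ncard ?_ K N rfl ?_ ?_ ?_).imp fun 𝓑 h => h
        · rw [← hn]
          refine Set.ncard_lt_ncard ⟨fun w hw => (hKC hw).1, fun hc => (hKC (hc hu)).2 ?_⟩
            (Set.toFinite _)
          exact Or.inl (Or.inl rfl)
        · exact Set.disjoint_left.2 fun w hw hw' => (hKC hw).2 hw'.1
        · intro a ha c hac
          by_cases hcB : c ∈ B
          · exact Or.inr ⟨hcB, a, ha, hac⟩
          · refine Or.inl (comp_closed ha ⟨(hN a (hKC ha).1 c hac).resolve_right fun hcW => hcB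
              (Or.inl (Or.inr hcW)), hcB⟩ hac)
        · set M := (N ∩ insert u W) \ Z with hM
          have hKM : ConnSet G (K ∪ M) := by
            refine (comp_conn hv).of_hub Set.subset_union_left ?_
            rintro w (hw | hw)
            · exact ⟨K, comp_conn hv, Set.subset_union_left, hw, w, hw, hw⟩
            · obtain ⟨a, ha, haw⟩ := hw.1.1.2
              exact ⟨{a, w}, ConnSet.pair haw, by
                rintro x (rfl | rfl)
                · exact Or.inl ha
                · exact Or.inr hw, by simp, a, by simp, ha⟩
          have h1 := hZ _ hKM (by
            refine Set.disjoint_left.2 ?_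
            rintro w (hw | hw) hwZ
            · exact (hKC hw).2 (Or.inr ⟨hwZ, (hKC hw).1⟩)
            · exact hw.2 hwZ)
          have h2 : M.ncard ≤ ((K ∪ M) ∩ insert u W).ncard :=
            Set.ncard_le_ncard (fun w hw => ⟨Or.inr hw, hw.1.2⟩) (Set.toFinite _)
          have h3 : N ⊆ M ∪ Z := by
            intro w hw
            by_cases hwZ : w ∈ Z
            · exact Or.inr hwZ
            · exact Or.inl ⟨⟨hw, hw.1.resolve_right fun h => hwZ h.1⟩, hwZ⟩
          have h4 := Set.ncard_le_ncard h3 (Set.toFinite _)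
          have h5 := Set.ncard_union_le M Z
          omega
    refine ⟨𝓑, ?_, B, hB𝓑, fun w hw => Or.inl (Or.inr hw)⟩
    convert h𝓑 using 1
    ext w
    simp only [hB, Set.mem_union, Set.mem_insert_iff, Set.mem_inter_iff, Set.mem_sdiff]
    by_cases hw : w = u
    · simp [hw, hu]
    · tauto
  obtain ⟨𝓑, h𝓑, -⟩ := key _ Set.univ ∅ rfl (by simp) (by simp) (by simp)
  exact ⟨𝓑, by simpa using h𝓑⟩

/-- A haven of order `k + 1`. -/
structure Haven (G : SimpleGraph V) (k : ℕ) (β : Set V → Set V) : Prop where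
  conn : ∀ Z : Set V, Z.ncard ≤ k → ConnSet G (β Z)
  disj : ∀ Z : Set V, Z.ncard ≤ k → Disjoint (β Z) Z
  closed : ∀ Z : Set V, Z.ncard ≤ k → ∀ a ∈ β Z, ∀ b, G.Adj a b → b ∉ Z → b ∈ β Z
  inter : ∀ Z Z' : Set V, Z.ncard ≤ k → Z'.ncard ≤ k → (β Z ∩ β Z').Nonempty

theorem exists_haven [Fintype V] {k : ℕ} (h : 3 * k < treewidth G) : ∃ β, Haven G k β := by
  have hbal : ∃ Ω : Set V, ∀ Z : Set V, Z.ncard ≤ k →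
      ∃ C, ConnSet G C ∧ Disjoint C Z ∧ Ω.ncard < 2 * (C ∩ Ω).ncard := by
    by_contra hcon
    push Not at hcon
    obtain ⟨𝓑, h𝓑⟩ := treeDec_of_balanced (G := G) k fun Ω _ => hcon Ω
    exact absurd h𝓑.treewidth_le (by omega)
  obtain ⟨Ω, hΩ⟩ := hbal
  have hmeet : ∀ C D : Set V, Ω.ncard < 2 * (C ∩ Ω).ncard → Ω.ncard < 2 * (D ∩ Ω).ncard →
      (C ∩ D).Nonempty := by
    intro C D hC hD
    by_contra hcon
    rw [Set.not_nonempty_iff_eq_empty] at hcon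
    have h1 : Disjoint (C ∩ Ω) (D ∩ Ω) := by
      rw [Set.disjoint_iff_inter_eq_empty]
      ext w
      have : w ∉ C ∩ D := by simp [hcon]
      simp only [Set.mem_inter_iff, Set.mem_empty_iff_false, iff_false] at *
      tauto
    have h2 := Set.ncard_union_eq h1 (Set.toFinite _) (Set.toFinite _)
    have h3 : ((C ∩ Ω) ∪ (D ∩ Ω)).ncard ≤ Ω.ncard :=
      Set.ncard_le_ncard (by simp) (Set.toFinite _)
    omega
  refine ⟨fun Z => {v | ∃ C, ConnSet G C ∧ Disjoint C Z ∧ Ω.ncard < 2 * (C ∩ Ω).ncard ∧ v ∈ C},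
    ?_, ?_, ?_, ?_⟩
  · intro Z hZ
    obtain ⟨C, hC, hCZ, hCΩ⟩ := hΩ Z hZ
    refine hC.of_hub (fun v hv => ⟨C, hC, hCZ, hCΩ, hv⟩) ?_
    rintro v ⟨D, hD, hDZ, hDΩ, hv⟩
    exact ⟨D, hD, fun w hw => ⟨D, hD, hDZ, hDΩ, hw⟩, hv, hmeet D C hDΩ hCΩ⟩
  · intro Z hZ
    refine Set.disjoint_left.2 ?_
    rintro v ⟨D, hD, hDZ, hDΩ, hv⟩
    exact Set.disjoint_left.1 hDZ hv
  · rintro Z hZ a ⟨D, hD, hDZ, hDΩ, ha⟩ b hab hb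
    refine ⟨insert b D, hD.insert_adj ha hab.symm, by simp [hb, hDZ], hDΩ.trans_le ?_, Or.inl rfl⟩
    have := Set.ncard_le_ncard (s := D ∩ Ω) (t := insert b D ∩ Ω)
      (by gcongr; simp) (Set.toFinite _)
    omega
  · intro Z Z' hZ hZ'
    obtain ⟨C, hC, hCZ, hCΩ⟩ := hΩ Z hZ
    obtain ⟨D, hD, hDZ, hDΩ⟩ := hΩ Z' hZ'
    obtain ⟨w, hwC, hwD⟩ := hmeet C D hCΩ hDΩ
    exact ⟨w, ⟨C, hC, hCZ, hCΩ, hwC⟩, D, hD, hDZ, hDΩ, hwD⟩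

end

section

variable {V : Type*} {G : SimpleGraph V}

/-- `SetChain G good n U H L` : `U` is the union of a sequence of `n` disjoint connected sets
satisfying `good`, with first member `H` and last member `L`, consecutive members being
adjacent. -/
inductive SetChain (G : SimpleGraph V) (good : Set V → Prop) :
    ℕ → Set V → Set V → Set V → Prop
  | single (C : Set V) (hC : ConnSet G C) (hg : good C) : SetChain G good 1 C C C
  | cons {n : ℕ} {U H L : Set V} (C : Set V) (hC : ConnSet G C) (hg : good C)
      (hd : Disjoint C U) (hadj : AdjSet G C H) (h : SetChain G good n U H L) :
      SetChain G good (n + 1) (C ∪ U) C L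

variable {good : Set V → Prop} {n : ℕ} {U H L : Set V}

theorem SetChain.subset (h : SetChain G good n U H L) : H ⊆ U ∧ L ⊆ U := by
  induction h with
  | single C => exact ⟨le_rfl, le_rfl⟩
  | cons C _ _ _ _ _ ih =>
    exact ⟨Set.subset_union_left, ih.2.trans Set.subset_union_right⟩

theorem SetChain.pos (h : SetChain G good n U H L) : 1 ≤ n := by
  cases h <;> omega

theorem SetChain.conn (h : SetChain G good n U H L) : ConnSet G U := by
  induction h with
  | single C hC => exact hC
  | cons C hC _ _ hadj h ih => exact hC.union_adj ih (hadj.mono le_rfl h.subset.1)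

theorem SetChain.imp {good' : Set V → Prop} (h : SetChain G good n U H L)
    (hg : ∀ C ⊆ U, good C → good' C) : SetChain G good' n U H L := by
  induction h with
  | single C hC h => exact .single C hC (hg C le_rfl h)
  | cons C hC h hd hadj _ ih =>
    exact .cons C hC (hg C Set.subset_union_left h) hd hadj
      (ih fun D hD => hg D (hD.trans Set.subset_union_right))

theorem SetChain.prepend (h : SetChain G good n U H L)
    (hmono : ∀ A B : Set V, A ⊆ B → good A → good B) {A : Set V} (hA : ConnSet G A)
    (hAU : Disjoint A U) (hAH : AdjSet G A H) :
    ∃ L' ⊇ L, SetChain G good n (A ∪ U) (A ∪ H) L' := by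
  cases h with
  | single C hC hg =>
    exact ⟨_, Set.subset_union_right,
      .single _ (hA.union_adj hC hAH) (hmono _ _ Set.subset_union_right hg)⟩
  | @cons n U' H' L' C hC hg hd hadj h =>
    rw [Set.disjoint_union_right] at hAU
    refine ⟨L, le_rfl, ?_⟩
    rw [← Set.union_assoc]
    exact .cons (A ∪ H) (hA.union_adj hC hAH) (hmono _ _ Set.subset_union_right hg)
      (Set.disjoint_union_left.2 ⟨hAU.2, hd⟩) (hadj.mono Set.subset_union_right le_rfl) h

theorem SetChain.pigeonhole (h : SetChain G good n U H L) {P Q : Set V → Prop}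
    (hP : ∀ A B : Set V, A ⊆ B → P A → P B) (hQ : ∀ A B : Set V, A ⊆ B → Q A → Q B)
    (hg : ∀ C ⊆ U, good C → P C ∨ Q C) {p q : ℕ} (hp : 1 ≤ p) (hq : 1 ≤ q) (hpq : p + q ≤ n + 1) :
    (∃ H' ⊇ H, ∃ L' ⊇ L, SetChain G P p U H' L') ∨
      ∃ H' ⊇ H, ∃ L' ⊇ L, SetChain G Q q U H' L' := by
  induction h generalizing p q with
  | single C hC h =>
    obtain rfl : p = 1 := by omega
    obtain rfl : q = 1 := by omega
    exact (hg C le_rfl h).imp (fun h => ⟨C, le_rfl, C, le_rfl, .single C hC h⟩)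
      (fun h => ⟨C, le_rfl, C, le_rfl, .single C hC h⟩)
  | @cons n U H L C hC h hd hadj hch ih =>
    have ih := @ih fun D hD => hg D (hD.trans Set.subset_union_right)
    have hall : ConnSet G (C ∪ U) := hC.union_adj hch.conn (hadj.mono le_rfl hch.subset.1)
    have hLU : L ⊆ C ∪ U := hch.subset.2.trans Set.subset_union_right
    have pre : ∀ {R : Set V → Prop} {m : ℕ}, (∀ A B : Set V, A ⊆ B → R A → R B) →
        (∃ H' ⊇ H, ∃ L' ⊇ L, SetChain G R m U H' L') →
        ∃ H' ⊇ C, ∃ L' ⊇ L, SetChain G R m (C ∪ U) H' L' := by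
      rintro R m hR ⟨H', hH', L', hL', h'⟩
      obtain ⟨L'', hL'', h''⟩ := h'.prepend hR hC hd (hadj.mono le_rfl hH')
      exact ⟨_, Set.subset_union_left, L'', hL'.trans hL'', h''⟩
    have con : ∀ {R : Set V → Prop} {m : ℕ}, R C →
        (∃ H' ⊇ H, ∃ L' ⊇ L, SetChain G R m U H' L') →
        ∃ H' ⊇ C, ∃ L' ⊇ L, SetChain G R (m + 1) (C ∪ U) H' L' := by
      rintro R m hR ⟨H', hH', L', hL', h'⟩
      exact ⟨C, le_rfl, L', hL', .cons C hC hR hd (hadj.mono le_rfl hH') h'⟩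
    rcases hg C Set.subset_union_left h with hPC | hQC
    · obtain rfl | hp2 : p = 1 ∨ 2 ≤ p := by omega
      · exact Or.inl ⟨_, Set.subset_union_left, _, hLU,
          .single _ hall (hP _ _ Set.subset_union_left hPC)⟩
      · obtain ⟨p', rfl⟩ : ∃ p', p = p' + 1 := ⟨p - 1, by omega⟩
        exact (ih (p := p') (q := q) (by omega) hq (by omega)).imp (con hPC) (pre hQ)
    · obtain rfl | hq2 : q = 1 ∨ 2 ≤ q := by omega
      · exact Or.inr ⟨_, Set.subset_union_left, _, hLU,
          .single _ hall (hQ _ _ Set.subset_union_left hQC)⟩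
      · obtain ⟨q', rfl⟩ : ∃ q', q = q' + 1 := ⟨q - 1, by omega⟩
        exact (ih (p := p) (q := q') hp (by omega) (by omega)).imp (pre hP) (con hQC)

theorem SetChain.exists_fun (h : SetChain G good n U H L) :
    ∃ W : ℕ → Set V, (∀ i < n, ConnSet G (W i) ∧ good (W i) ∧ W i ⊆ U) ∧
      (∀ i < n, ∀ j < n, i ≠ j → Disjoint (W i) (W j)) ∧
      (∀ i, i + 1 < n → AdjSet G (W i) (W (i + 1))) ∧ W 0 = H ∧ W (n - 1) = L := by
  induction h with
  | single C hC hg =>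
    refine ⟨fun _ => C, fun i _ => ⟨hC, hg, le_rfl⟩, ?_, ?_, rfl, rfl⟩
    · intro i hi j hj hij
      omega
    · intro i hi
      omega
  | @cons n U H L C hC hg hd hadj h ih =>
    obtain ⟨W, h1, h2, h3, h4, h5⟩ := ih
    have hn := h.pos
    refine ⟨fun i => if i = 0 then C else W (i - 1), ?_, ?_, ?_, by simp, ?_⟩
    · rintro (_ | i) hi
      · exact ⟨hC, hg, Set.subset_union_left⟩
      · have := h1 i (by omega)
        exact ⟨this.1, this.2.1, this.2.2.trans Set.subset_union_right⟩
    · rintro (_ | i) hi (_ | j) hj hij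
      · omega
      · simpa using hd.mono_right (h1 j (by omega)).2.2
      · simpa using (hd.mono_right (h1 i (by omega)).2.2).symm
      · simpa using h2 i (by omega) j (by omega) (by omega)
    · rintro (_ | i) hi
      · simpa [h4] using hadj
      · simpa using h3 i (by omega)
    · obtain ⟨m, rfl⟩ : ∃ m, n = m + 1 := ⟨n - 1, by omega⟩
      simpa using h5

/-- A cyclic sequence of `r` disjoint connected sets together with two connected hubs. -/
theorem doubleWheel_minor_of_rim {r : ℕ} (hr : 0 < r) {W : ℕ → Set V} {A B : Set V}
    (hW : ∀ i < r, ConnSet G (W i)) (hd : ∀ i < r, ∀ j < r, i ≠ j → Disjoint (W i) (W j))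
    (hadj : ∀ i, i + 1 < r → AdjSet G (W i) (W (i + 1))) (hcl : AdjSet G (W (r - 1)) (W 0))
    (hA : ConnSet G A) (hB : ConnSet G B) (hAB : Disjoint A B)
    (hAW : ∀ i < r, Disjoint (W i) A ∧ AdjSet G (W i) A)
    (hBW : ∀ i < r, Disjoint (W i) B ∧ AdjSet G (W i) B) : IsMinor (doubleWheel r) G := by
  have hcyc : ∀ i j : Fin r, (j : ℕ) = (i + 1) % r → AdjSet G (W i) (W j) := by
    intro i j hij
    by_cases hi : (i : ℕ) + 1 < r
    · rw [hij, Nat.mod_eq_of_lt hi]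
      exact hadj i hi
    · have hi' : (i : ℕ) = r - 1 := by omega
      have hi'' : (i : ℕ) + 1 = r := by omega
      rw [hij, hi'', Nat.mod_self, hi']
      exact hcl
  refine ⟨Sum.elim (fun i => W i) ![A, B], ?_, ?_, ?_⟩
  · rintro (i | i)
    · exact (hW i i.2).induce_connected
    · fin_cases i
      · exact hA.induce_connected
      · exact hB.induce_connected
  · rintro (i | i) (j | j) hij
    · exact hd i i.2 j j.2 fun h => hij (by rw [Fin.ext h])
    · fin_cases j
      · exact (hAW i i.2).1
      · exact (hBW i i.2).1
    · fin_cases i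
      · exact (hAW j j.2).1.symm
      · exact (hBW j j.2).1.symm
    · fin_cases i <;> fin_cases j
      · exact (hij rfl).elim
      · exact hAB
      · exact hAB.symm
      · exact (hij rfl).elim
  · have hub : ∀ (i : Fin r) (j : Fin 2), AdjSet G (W i) (![A, B] j) := by
      intro i j
      fin_cases j
      · exact (hAW i i.2).2
      · exact (hBW i i.2).2
    rintro (i | i) (j | j) hij
    · rw [doubleWheel, SimpleGraph.fromRel_adj] at hij
      rcases hij.2 with h | h
      · exact hcyc i j h
      · exact (hcyc j i h).symm
    · exact hub i j
    · exact (hub j i).symm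
    · rw [doubleWheel, SimpleGraph.fromRel_adj] at hij
      simp at hij

/-- A chain closed up by a connected set `K`, with two hubs `A` and `B`. -/
theorem SetChain.doubleWheel_minor {r : ℕ} (hr : 2 ≤ r) {A B K : Set V}
    (h : SetChain G (fun C => AdjSet G C A ∧ AdjSet G C B) r U H L) (hA : ConnSet G A)
    (hB : ConnSet G B) (hK : ConnSet G K) (hAB : Disjoint A B) (hAK : Disjoint A K)
    (hBK : Disjoint B K) (hUA : Disjoint U A) (hUB : Disjoint U B) (hUK : Disjoint U K)
    (hHK : AdjSet G H K) (hLK : AdjSet G L K) : IsMinor (doubleWheel r) G := by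
  obtain ⟨W, h1, h2, h3, h4, h5⟩ := h.exists_fun
  have hmem : ∀ i, W i ⊆ if i = 0 then W 0 ∪ K else W i := by
    intro i
    split_ifs with hi
    · rw [hi]
      exact Set.subset_union_left
    · exact le_rfl
  refine doubleWheel_minor_of_rim (W := fun i => if i = 0 then W 0 ∪ K else W i) (by omega)
    ?_ ?_ ?_ ?_ hA hB hAB ?_ ?_
  · intro i hi
    split_ifs
    · exact (h1 0 (by omega)).1.union_adj hK (h4 ▸ hHK)
    · exact (h1 i hi).1
  · intro i hi j hj hij
    have hKW : ∀ i < r, Disjoint K (W i) := fun i hi =>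
      (hUK.mono_left (h1 i hi).2.2).symm
    split_ifs with hi0 hj0 hj0
    · omega
    · exact Set.disjoint_union_left.2 ⟨h2 0 (by omega) j hj (by omega), hKW j hj⟩
    · exact Set.disjoint_union_right.2 ⟨h2 i hi 0 (by omega) (by omega), (hKW i hi).symm⟩
    · exact h2 i hi j hj hij
  · intro i hi
    exact (h3 i hi).mono (hmem i) (hmem (i + 1))
  · refine AdjSet.mono (A := L) (B := K) hLK ?_ ?_
    · rw [← h5]
      exact hmem (r - 1)
    · simp
  · intro i hi
    refine ⟨?_, (h1 i hi).2.1.1.mono (hmem i) le_rfl⟩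
    have := hUA.mono_left (h1 i hi).2.2
    split_ifs with h0
    · exact Set.disjoint_union_left.2 ⟨h0 ▸ this, hAK.symm⟩
    · exact this
  · intro i hi
    refine ⟨?_, (h1 i hi).2.1.2.mono (hmem i) le_rfl⟩
    have := hUB.mono_left (h1 i hi).2.2
    split_ifs with h0
    · exact Set.disjoint_union_left.2 ⟨h0 ▸ this, hBK.symm⟩
    · exact this

end

section

variable {V : Type*} {G : SimpleGraph V} {β : Set V → Set V} {k : ℕ}

theorem Haven.subset_of_closed (hβ : Haven G k β) {Z D : Set V} (hZ : Z.ncard ≤ k)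
    (h : (β Z ∩ D).Nonempty) (hcl : ∀ a ∈ D, ∀ b, G.Adj a b → b ∉ Z → b ∈ D) : β Z ⊆ D := by
  refine (hβ.conn Z hZ).2 D h fun a _ haD b hb hab => hcl a haD b hab fun hbZ => ?_
  exact Set.disjoint_left.1 (hβ.disj Z hZ) hb hbZ

theorem Haven.conn_subset (hβ : Haven G k β) {Z C : Set V} (hZ : Z.ncard ≤ k) (hC : ConnSet G C)
    (hCZ : Disjoint C Z) (h : (C ∩ β Z).Nonempty) : C ⊆ β Z :=
  hC.2 _ h fun a _ haβ b hb hab => hβ.closed Z hZ a haβ b hab (Set.disjoint_left.1 hCZ hb)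

/-- A family of `q` disjoint bags with roots `x i`, arranged in a tree by `par`, lying outside the
part of the haven seen from the set of roots, and tight with respect to the haven. -/
structure RootedBags (G : SimpleGraph V) (β : Set V → Set V) (par : ℕ → ℕ) (q : ℕ)
    (M : ℕ → Set V) (x : ℕ → V) : Prop where
  conn : ∀ i < q, ConnSet G (M i)
  mem : ∀ i < q, x i ∈ M i
  disj : ∀ i < q, ∀ j < q, i ≠ j → Disjoint (M i) (M j)
  avoid : ∀ i < q, Disjoint (M i) (β (x '' Set.Iio q))
  adj : ∀ i < q, 0 < i → AdjSet G (M (par i)) (M i)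
  tight : ∀ Z : Set V, Z.ncard < q → ∃ i < q, (β Z ∩ M i).Nonempty

variable {par : ℕ → ℕ} {q : ℕ} {M : ℕ → Set V} {x : ℕ → V}

theorem RootedBags.root_eq (h : RootedBags G β par q M x) {i j : ℕ} (hi : i < q) (hj : j < q)
    (hij : x i ∈ M j) : i = j := by
  by_contra hne
  exact Set.disjoint_left.1 (h.disj i hi j hj hne) (h.mem i hi) hij

theorem RootedBags.ncard_roots (h : RootedBags G β par q M x) : (x '' Set.Iio q).ncard = q := by
  rw [Set.InjOn.ncard_image]
  · rw [← Finset.coe_Iio, Set.ncard_coe_finset, Nat.card_Iio]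
  · intro i hi j hj hij
    exact h.root_eq hi hj (hij ▸ h.mem j hj)

theorem RootedBags.closed (h : RootedBags G β par q M x) (hβ : Haven G k β) (hq : q ≤ k) {a b : V}
    (ha : a ∈ β (x '' Set.Iio q)) (hab : G.Adj a b) :
    b ∈ β (x '' Set.Iio q) ∨ b ∈ x '' Set.Iio q := by
  by_contra hcon
  push Not at hcon
  exact hcon.1 (hβ.closed _ (by rw [h.ncard_roots]; exact hq) a ha b hab hcon.2)

/-- Every root has a neighbour in the part of the haven seen from the set of roots. -/
theorem RootedBags.exists_adj [Finite V] (h : RootedBags G β par q M x) (hβ : Haven G k β)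
    (hq : q ≤ k) {p : ℕ} (hp : p < q) : ∃ u ∈ β (x '' Set.Iio q), G.Adj (x p) u := by
  by_contra hcon
  push Not at hcon
  set X := x '' Set.Iio q with hX
  have hXc : X.ncard = q := h.ncard_roots
  have hpX : x p ∈ X := ⟨p, hp, rfl⟩
  have hZ : (X \ {x p}).ncard < q := by
    have := Set.ncard_sdiff_singleton_lt_of_mem hpX (Set.toFinite X)
    omega
  have hsub : β (X \ {x p}) ⊆ β X := by
    refine hβ.subset_of_closed (by omega) (hβ.inter _ _ (by omega) (by omega)) ?_
    intro a ha b hab hb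
    rcases h.closed hβ hq ha hab with hbQ | hbX
    · exact hbQ
    · have : b = x p := by
        by_contra hne
        exact hb ⟨hbX, hne⟩
      exact (hcon a ha (this ▸ hab.symm)).elim
  obtain ⟨i, hi, v, hv, hvM⟩ := h.tight _ hZ
  exact Set.disjoint_left.1 (h.avoid i hi) hvM (hsub hv)

theorem Haven.anti (hβ : Haven G k β) {Z Z' : Set V} (hZ : Z.ncard ≤ k) (hZ' : Z'.ncard ≤ k)
    (h : Z ⊆ Z') : β Z' ⊆ β Z :=
  hβ.conn_subset hZ (hβ.conn _ hZ') ((hβ.disj _ hZ').mono_right h) (hβ.inter _ _ hZ' hZ)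

theorem RootedBags.exists_linkage [Finite V] (h : RootedBags G β par q M x) (hβ : Haven G k β)
    (hq : q ≤ k) {Z : Set V} (hZq : Z.ncard = q)
    (hZM : ∀ i < q, Disjoint (M i) (β Z)) (hZQ : Z ⊆ β (x '' Set.Iio q) ∪ x '' Set.Iio q) :
    ∃ P : Fin q → Set V, (∀ i, ConnSet G (P i)) ∧ (Pairwise fun i j => Disjoint (P i) (P j)) ∧
      (∀ i, (P i ∩ x '' Set.Iio q).Nonempty ∧ (P i ∩ Z).Nonempty) ∧
      ∀ i, P i ⊆ (β (x '' Set.Iio q) ∪ x '' Set.Iio q) \ β Z := by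
  set X := x '' Set.Iio q with hX
  have hXc : X.ncard = q := h.ncard_roots
  have hXM : ∀ v ∈ X, v ∉ β Z := by
    rintro _ ⟨i, hi, rfl⟩ hv
    exact Set.disjoint_left.1 (hZM i hi) (h.mem i hi) hv
  have hZβ : Disjoint (β Z) Z := hβ.disj Z (by omega)
  obtain ⟨P, hP, hPd, hPm⟩ := menger (restr G ((β X ∪ X) \ β Z)) X Z q fun S hS => by
    obtain ⟨i, hi, m, hmC, hmM⟩ := h.tight S hS
    have hC := hβ.conn S (by omega)
    have hCS := hβ.disj S (by omega)
    obtain ⟨c, hcC, hcZ⟩ := hβ.inter S Z (by omega) (by omega)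
    have hmZ : m ∉ β Z := Set.disjoint_left.1 (hZM i hi) hmM
    have hmX : m ∉ β X := Set.disjoint_left.1 (h.avoid i hi) hmM
    have single : ∀ v ∈ β S, v ∈ X → v ∈ Z →
        ∃ C, ConnSet (restr G ((β X ∪ X) \ β Z)) C ∧ Disjoint C S ∧ (C ∩ X).Nonempty ∧
          (C ∩ Z).Nonempty := fun v hv hvX hvZ =>
      ⟨{v}, ConnSet.singleton v, hCS.mono_left (by simpa using hv), ⟨v, rfl, hvX⟩, ⟨v, rfl, hvZ⟩⟩
    by_cases hmZ' : m ∈ Z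
    · exact single m hmC ((hZQ hmZ').resolve_left hmX) hmZ'
    have hCZ : (β S ∩ Z).Nonempty := by
      obtain ⟨a, haC, haZ, b, hbC, hbZ, hab⟩ := hC.exit ⟨c, hcC, hcZ⟩ ⟨m, hmC, hmZ⟩
      refine ⟨b, hbC, ?_⟩
      by_contra hb
      exact hbZ (hβ.closed Z (by omega) a haZ b hab hb)
    obtain ⟨D, hDC, hD, hmD, d, hd, z, ⟨hzC, hzZ⟩, hdz⟩ := hC.exists_to hmC hmZ' hCZ
    have hDZ : ∀ v ∈ D, v ∉ β Z := fun v hv hvZ => hmZ (hβ.conn_subset (by omega) hD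
      (Set.disjoint_left.2 fun w hw => (hDC hw).2) ⟨v, hv, hvZ⟩ hmD)
    by_cases hzX : z ∈ X
    · exact single z hzC hzX hzZ
    have hzQ : z ∈ β X := (hZQ hzZ).resolve_right hzX
    have hD₁ : ConnSet G (insert z D) := hD.insert_adj hd hdz.symm
    have hDX : (insert z D ∩ X).Nonempty := by
      obtain ⟨a, haC, haQ, b, hbC, hbQ, hab⟩ := hD₁.exit ⟨z, Or.inl rfl, hzQ⟩
        ⟨m, Or.inr hmD, hmX⟩
      exact ⟨b, hbC, (h.closed hβ hq haQ hab).resolve_left hbQ⟩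
    obtain ⟨E, hED, hE, hzE, e, he, y, ⟨hyD, hyX⟩, hey⟩ := hD₁.exists_to (Or.inl rfl) hzX hDX
    have hEQ : E ⊆ β X := hβ.conn_subset (by omega) hE
      (Set.disjoint_left.2 fun w hw => (hED hw).2) ⟨z, hzE, hzQ⟩
    have hnot : ∀ v ∈ insert z D, v ∉ β Z ∧ v ∈ β S := by
      rintro v (rfl | hv)
      · exact ⟨fun h => Set.disjoint_left.1 hZβ h hzZ, hzC⟩
      · exact ⟨hDZ v hv, (hDC hv).1⟩
    refine ⟨insert y E, (hE.insert_adj he hey.symm).restr ?_, hCS.mono_left ?_,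
      ⟨y, Or.inl rfl, hyX⟩, ⟨z, Or.inr hzE, hzZ⟩⟩
    · rintro v (rfl | hv)
      · exact ⟨Or.inr hyX, (hnot v hyD).1⟩
      · exact ⟨Or.inl (hEQ hv), (hnot v (hED hv).1).1⟩
    · rintro v (rfl | hv)
      · exact (hnot v hyD).2
      · exact (hnot v (hED hv).1).2
  refine ⟨P, fun i => (hP i).of_le (restr_le _), hPd, hPm, fun i => (hP i).subset_of_restr ?_⟩
  obtain ⟨v, hv, hvX⟩ := (hPm i).1
  exact ⟨v, hv, Or.inr hvX, hXM v hvX⟩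

/-- Bags can be extended so that the roots become a given set `Z` of the same size. -/
theorem RootedBags.shift [Finite V] (h : RootedBags G β par q M x) (hβ : Haven G k β)
    (hq : q ≤ k) (hq0 : 0 < q) {Z : Set V} (hZq : Z.ncard = q)
    (hZM : ∀ i < q, Disjoint (M i) (β Z)) (hZQ : Z ⊆ β (x '' Set.Iio q) ∪ x '' Set.Iio q) :
    ∃ M' x', RootedBags G β par q M' x' ∧ x' '' Set.Iio q = Z := by
  obtain ⟨P, hP, hPd, hPm, hPsub⟩ := h.exists_linkage hβ hq hZq hZM hZQ
  obtain ⟨p, hp, hpX, hpi, hps⟩ := exists_surj_choice hPd h.ncard_roots fun i => (hPm i).1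
  obtain ⟨z, hz, hzZ, -, hzs⟩ := exists_surj_choice hPd hZq fun i => (hPm i).2
  have hf : ∀ j : ℕ, ∃ i : Fin q, j < q → p i = x j := by
    intro j
    by_cases hj : j < q
    · obtain ⟨i, hi⟩ := hps (x j) ⟨j, hj, rfl⟩
      exact ⟨i, fun _ => hi⟩
    · exact ⟨⟨0, hq0⟩, fun h => (hj h).elim⟩
  choose f hf using hf
  have hxP : ∀ j < q, x j ∈ P (f j) := fun j hj => hf j hj ▸ hp (f j)
  have hfi : ∀ i < q, ∀ j < q, f i = f j → i = j := fun i hi j hj hij =>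
    h.root_eq hi hj (by rw [← hf i hi, hij, hf j hj]; exact h.mem j hj)
  have himg : (fun j => z (f j)) '' Set.Iio q = Z := by
    apply Set.Subset.antisymm
    · rintro _ ⟨j, -, rfl⟩
      exact hzZ _
    · intro s hs
      obtain ⟨i, rfl⟩ := hzs s hs
      obtain ⟨j, hj, hij⟩ := hpX i
      exact ⟨j, hj, congrArg z (hpi ((hf j hj).trans hij))⟩
  have hMP : ∀ i < q, ∀ j < q, i ≠ j → Disjoint (M i) (P (f j)) := by
    intro i hi j hj hij
    refine Set.disjoint_left.2 fun v hvM hvP => ?_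
    rcases (hPsub _ hvP).1 with hv | ⟨l, hl, rfl⟩
    · exact Set.disjoint_left.1 (h.avoid i hi) hvM hv
    · obtain rfl : l = i := h.root_eq hl hi hvM
      by_cases hff : f l = f j
      · exact hij (hfi l hi j hj hff)
      · exact Set.disjoint_left.1 (hPd hff) (hxP l hi) hvP
  refine ⟨fun j => M j ∪ P (f j), fun j => z (f j), ⟨?_, ?_, ?_, ?_, ?_, ?_⟩, himg⟩
  · exact fun i hi => (h.conn i hi).union (hP _) ⟨x i, h.mem i hi, hxP i hi⟩
  · exact fun i hi => Or.inr (hz _)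
  · intro i hi j hj hij
    refine Set.disjoint_union_left.2 ⟨Set.disjoint_union_right.2 ⟨h.disj i hi j hj hij,
      hMP i hi j hj hij⟩, Set.disjoint_union_right.2 ⟨(hMP j hj i hi hij.symm).symm,
      hPd fun hff => hij (hfi i hi j hj hff)⟩⟩
  · intro i hi
    rw [himg]
    exact Set.disjoint_union_left.2
      ⟨hZM i hi, Set.disjoint_left.2 fun v hv => (hPsub _ hv).2⟩
  · exact fun i hi h0 => (h.adj i hi h0).mono Set.subset_union_left Set.subset_union_left
  · intro S hS
    obtain ⟨i, hi, v, hv, hvM⟩ := h.tight S hS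
    exact ⟨i, hi, v, hv, Or.inl hvM⟩

/-- One more bag can be added. -/
theorem RootedBags.grow [Finite V] (hβ : Haven G k β) (hq : q + 1 ≤ k) (hq0 : 0 < q)
    (hpar : ∀ i ≤ q, 0 < i → par i < i) (h : RootedBags G β par q M x) :
    ∃ M' x', RootedBags G β par (q + 1) M' x' := by
  induction hn : (β (x '' Set.Iio q)).ncard using Nat.strong_induction_on generalizing M x with
  | _ n ih =>
  have hparq := hpar q le_rfl hq0
  obtain ⟨u, hu, hxu⟩ := h.exists_adj hβ (by omega) hparq
  have huM : ∀ i < q, u ∉ M i := fun i hi huM => Set.disjoint_left.1 (h.avoid i hi) huM hu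
  have hXc : (x '' Set.Iio q).ncard = q := h.ncard_roots
  have himg : Function.update x q u '' Set.Iio (q + 1) = insert u (x '' Set.Iio q) := by
    ext v
    constructor
    · rintro ⟨j, hj, rfl⟩
      rcases Nat.lt_succ_iff_lt_or_eq.1 hj with hj | rfl
      · exact Or.inr ⟨j, hj, by simp [hj.ne]⟩
      · simp
    · rintro (rfl | ⟨j, hj, rfl⟩)
      · exact ⟨q, by simp, by simp⟩
      · have hj' : j < q := hj
        exact ⟨j, Set.mem_Iio.2 (by omega), by simp [hj'.ne]⟩
  have hanti : β (insert u (x '' Set.Iio q)) ⊆ β (x '' Set.Iio q) :=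
    hβ.anti (by omega) ((Set.ncard_insert_le _ _).trans (by omega)) (Set.subset_insert _ _)
  by_cases htight : ∀ Z : Set V, Z.ncard = q → (∀ i < q, Disjoint (M i) (β Z)) → u ∈ β Z
  · refine ⟨Function.update M q {u}, Function.update x q u, ⟨?_, ?_, ?_, ?_, ?_, ?_⟩⟩
    · intro i hi
      rcases Nat.lt_succ_iff_lt_or_eq.1 hi with hi | rfl
      · simpa [hi.ne] using h.conn i hi
      · simpa using ConnSet.singleton u
    · intro i hi
      rcases Nat.lt_succ_iff_lt_or_eq.1 hi with hi | rfl
      · simpa [hi.ne] using h.mem i hi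
      · simp
    · intro i hi j hj hij
      rcases Nat.lt_succ_iff_lt_or_eq.1 hi with hi | rfl <;>
      rcases Nat.lt_succ_iff_lt_or_eq.1 hj with hj | rfl
      · simpa [hi.ne, hj.ne] using h.disj i hi j hj hij
      · simpa [hi.ne] using huM i hi
      · simpa [hj.ne] using huM j hj
      · exact (hij rfl).elim
    · intro i hi
      rw [himg]
      rcases Nat.lt_succ_iff_lt_or_eq.1 hi with hi | rfl
      · simpa [hi.ne] using (h.avoid i hi).mono_right hanti
      · have := hβ.disj (insert u (x '' Set.Iio i))
          ((Set.ncard_insert_le _ _).trans (by omega))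
        simpa using fun hu' => Set.disjoint_left.1 this hu' (Set.mem_insert _ _)
    · intro i hi h0
      rcases Nat.lt_succ_iff_lt_or_eq.1 hi with hi | rfl
      · have := h.adj i hi h0
        have hp : par i ≠ q := ((hpar i hi.le h0).trans hi).ne
        simpa [hi.ne, hp] using this
      · have : AdjSet G (M (par i)) {u} := ⟨_, h.mem _ hparq, u, rfl, hxu⟩
        rw [Function.update_self, Function.update_of_ne hparq.ne]
        exact this
    · intro Z hZ
      by_contra hcon
      push Not at hcon
      have hM : ∀ i < q, Disjoint (M i) (β Z) := fun i hi => by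
        have := hcon i (by omega)
        rw [Function.update_of_ne hi.ne] at this
        exact (Set.disjoint_iff_inter_eq_empty.2 this).symm
      have hu' : u ∉ β Z := by
        have := hcon q (by omega)
        rw [Function.update_self] at this
        exact fun hu => Set.notMem_empty u (this ▸ ⟨hu, rfl⟩)
      rcases Nat.lt_succ_iff_lt_or_eq.1 hZ with hZ | hZ
      · obtain ⟨i, hi, v, hv, hvM⟩ := h.tight Z hZ
        exact Set.disjoint_left.1 (hM i hi) hvM hv
      · exact hu' (htight Z hZ hM)
  · push Not at htight
    obtain ⟨Z, hZ, hZM, huZ⟩ := htight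
    have hX : ∀ v ∈ x '' Set.Iio q, v ∉ β Z := by
      rintro _ ⟨i, hi, rfl⟩ hv
      exact Set.disjoint_left.1 (hZM i hi) (h.mem i hi) hv
    have hsub : β Z ⊆ β (x '' Set.Iio q) :=
      hβ.conn_subset (by omega) (hβ.conn Z (by omega))
        (Set.disjoint_left.2 fun v hv hvX => hX v hvX hv)
        (hβ.inter _ _ (by omega) (by omega))
    have hZQ : Z ⊆ β (x '' Set.Iio q) ∪ x '' Set.Iio q := by
      intro z hz
      by_contra hzQ
      have hcl : β (Z \ {z}) ⊆ β Z := by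
        have hlt := Set.ncard_sdiff_singleton_lt_of_mem hz (Set.toFinite Z)
        refine hβ.subset_of_closed (by omega) (hβ.inter _ _ (by omega) (by omega)) ?_
        intro a ha b hab hb
        refine hβ.closed Z (by omega) a ha b hab fun hbZ => hb ⟨hbZ, ?_⟩
        rintro rfl
        exact hzQ (h.closed hβ (by omega) (hsub ha) hab)
      obtain ⟨i, hi, v, hv, hvM⟩ := h.tight (Z \ {z})
        (hZ ▸ Set.ncard_sdiff_singleton_lt_of_mem hz (Set.toFinite Z))
      exact Set.disjoint_left.1 (hZM i hi) hvM (hcl hv)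
    obtain ⟨M', x', h', hx'⟩ := h.shift hβ (by omega) hq0 hZ hZM hZQ
    refine ih _ ?_ h' rfl
    rw [hx', ← hn]
    exact Set.ncard_lt_ncard ⟨hsub, fun hs => huZ (hs hu)⟩ (Set.toFinite _)

theorem Haven.exists_rootedBags [Finite V] (hβ : Haven G k β) (hpar : ∀ i, 0 < i → par i < i)
    (hq0 : 0 < q) (hq : q ≤ k) : ∃ M x, RootedBags G β par q M x := by
  induction q, hq0 using Nat.le_induction with
  | base =>
    obtain ⟨v, hv, -⟩ := hβ.inter ∅ ∅ (by simp) (by simp)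
    refine ⟨fun _ => {v}, fun _ => v, fun _ _ => .singleton v, fun _ _ => rfl, ?_, ?_, ?_, ?_⟩
    · intro i hi j hj hij
      omega
    · intro i hi
      have : Disjoint (β {v}) {v} := hβ.disj {v} (by simpa using hq)
      have himg : (fun _ : ℕ => v) '' Set.Iio 1 = {v} := by
        ext w
        simp [eq_comm]
      rw [himg]
      exact this.symm
    · intro i hi h0
      omega
    · intro Z hZ
      rw [Nat.lt_one_iff, Set.ncard_eq_zero (Set.toFinite Z)] at hZ
      exact ⟨0, by omega, v, hZ ▸ hv, rfl⟩
  | succ q hq0 ih =>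
    obtain ⟨M, x, h⟩ := ih (by omega)
    exact h.grow hβ hq hq0 fun i _ => hpar i

end

section

variable {V : Type*} {G : SimpleGraph V} {β : Set V → Set V} {k : ℕ}

/-- Two pairs of adjacent disjoint connected sets `T, U false` and `T, U true`, a connected set `H`
and `N` disjoint connected strands in `H` from `T` to each `U t`, such that the ends of the
strands at `T` are highly linked in `H`. -/
structure StrandFrame (G : SimpleGraph V) (N m : ℕ) (T : Set V) (U : Bool → Set V) (H : Set V)
    (P : Bool × Fin N → Set V) (x y : Bool × Fin N → V) : Prop where
  connT : ConnSet G T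
  connU : ∀ t, ConnSet G (U t)
  connH : ConnSet G H
  disjTU : ∀ t, Disjoint T (U t)
  disjU : Disjoint (U false) (U true)
  disjTH : Disjoint T H
  disjUH : ∀ t, Disjoint (U t) H
  adjTU : ∀ t, AdjSet G T (U t)
  connP : ∀ a, ConnSet G (P a)
  disjP : Pairwise fun a b => Disjoint (P a) (P b)
  subP : ∀ a, P a ⊆ H
  memx : ∀ a, x a ∈ P a
  memy : ∀ a, y a ∈ P a
  adjx : ∀ a, AdjSet G {x a} T
  adjy : ∀ a, AdjSet G {y a} (U a.1)
  link : ∀ A B E : Set V, A ∪ B = H → (∀ a ∈ A, a ∉ E → ∀ b ∈ B, b ∉ E → ¬ G.Adj a b) →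
    Disjoint A B → E.ncard < m → {a | x a ∈ A}.ncard < m ∨ {a | x a ∈ B}.ncard < m

/-- The tree used to build a frame: a root with `2 * N` leaves and two further children, each of
which has `N` leaves. -/
def framePar (N i : ℕ) : ℕ := if i < 2 * N + 3 then 0 else if i < 3 * N + 3 then 1 else 2

variable {q N m : ℕ} {M : ℕ → Set V} {x : ℕ → V} {par : ℕ → ℕ}

theorem RootedBags.exists_strands [Finite V] (h : RootedBags G β par q M x) (hβ : Haven G k β)
    {I J : Set ℕ} (hI : I ⊆ Set.Iio q) (hJ : J ⊆ Set.Iio q) {n : ℕ} (hIn : I.ncard = n)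
    (hJn : J.ncard = n) (hk : q + n ≤ k) :
    ∃ (C : Fin n → Set V) (i j : Fin n → ℕ), (∀ a, ConnSet G (C a)) ∧
      (Pairwise fun a b => Disjoint (C a) (C b)) ∧
      (∀ a, C a ⊆ β (x '' Set.Iio q) ∪ x '' (I ∪ J)) ∧ (∀ a, x (i a) ∈ C a ∧ x (j a) ∈ C a) ∧
      (∀ a, i a ∈ I ∧ j a ∈ J) ∧ Function.Injective i ∧ Function.Injective j ∧
      ∀ l ∈ J, ∃ a, j a = l := by
  set X := x '' Set.Iio q with hX
  have hXc : X.ncard = q := h.ncard_roots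
  have hinj : Set.InjOn x (Set.Iio q) := fun i hi j hj hij => h.root_eq hi hj (hij ▸ h.mem j hj)
  have hIX : x '' I ⊆ X := Set.image_mono hI
  have hJX : x '' J ⊆ X := Set.image_mono hJ
  have hIc : (x '' I).ncard = n := (hinj.mono hI).ncard_image.trans hIn
  have hJc : (x '' J).ncard = n := (hinj.mono hJ).ncard_image.trans hJn
  have key : ∀ S : Set V, S.ncard < n → ∀ Y ⊆ X, Y.ncard = n →
      ∃ y ∈ Y, y ∉ S ∧ ∃ c ∈ β (X ∪ S), G.Adj c y := by
    intro S hS Y hY hYn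
    by_contra hcon
    push Not at hcon
    have hXS : (X ∪ S).ncard ≤ k := (Set.ncard_union_le _ _).trans (by omega)
    have hZ : (X \ Y ∪ S).ncard < q := by
      have h1 := Set.ncard_union_le (X \ Y) S
      have h2 := Set.ncard_sdiff_add_ncard_of_subset hY (Set.toFinite X)
      omega
    have hsub : β (X \ Y ∪ S) ⊆ β (X ∪ S) := by
      refine hβ.subset_of_closed (by omega) (hβ.inter _ _ (by omega) hXS) ?_
      intro a ha b hab hb
      by_contra hbβ
      have hbXS : b ∈ X ∪ S := by
        by_contra hb'
        exact hbβ (hβ.closed _ hXS a ha b hab hb')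
      have hbS : b ∉ S := fun hbS => hb (Or.inr hbS)
      have hbX := hbXS.resolve_right hbS
      by_cases hbY : b ∈ Y
      · exact hcon b hbY hbS a ha hab
      · exact hb (Or.inl ⟨hbX, hbY⟩)
    obtain ⟨i, hi, v, hv, hvM⟩ := h.tight _ hZ
    exact Set.disjoint_left.1 (h.avoid i hi) hvM
      (hβ.anti (by omega) hXS Set.subset_union_left (hsub hv))
  obtain ⟨C, hC, hCd, hCm⟩ := menger (restr G (β X ∪ x '' (I ∪ J))) (x '' I) (x '' J) n
    fun S hS => by
      obtain ⟨a, haI, haS, c, hc, hca⟩ := key S hS _ hIX hIc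
      obtain ⟨b, hbJ, hbS, d, hd, hdb⟩ := key S hS _ hJX hJc
      have hXS : (X ∪ S).ncard ≤ k := (Set.ncard_union_le _ _).trans (by omega)
      have hD := hβ.conn _ hXS
      have hDS := hβ.disj _ hXS
      have hDX : β (X ∪ S) ⊆ β X := hβ.anti (by omega) hXS Set.subset_union_left
      refine ⟨insert b (insert a (β (X ∪ S))), ((hD.insert_adj hc hca.symm).insert_adj
        (Or.inr hd) hdb.symm).restr ?_, Set.disjoint_left.2 ?_, ⟨a, by simp, haI⟩,
        ⟨b, by simp, hbJ⟩⟩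
      · rintro v (rfl | rfl | hv)
        · exact Or.inr (Set.image_mono Set.subset_union_right hbJ)
        · exact Or.inr (Set.image_mono Set.subset_union_left haI)
        · exact Or.inl (hDX hv)
      · rintro v (rfl | rfl | hv) hvS
        · exact hbS hvS
        · exact haS hvS
        · exact Set.disjoint_left.1 hDS hv (Or.inr hvS)
  obtain ⟨p, hp, hpI, hpi, -⟩ := exists_surj_choice hCd hIc fun i => (hCm i).1
  obtain ⟨z, hz, hzJ, hzi, hzs⟩ := exists_surj_choice hCd hJc fun i => (hCm i).2
  choose i hi hip using hpI
  choose j hj hjz using hzJ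
  refine ⟨C, i, j, fun a => (hC a).of_le (restr_le _), hCd, fun a => (hC a).subset_of_restr ?_,
    fun a => ⟨hip a ▸ hp a, hjz a ▸ hz a⟩, fun a => ⟨hi a, hj a⟩, ?_, ?_, ?_⟩
  · exact ⟨p a, hp a, Or.inr (hip a ▸ ⟨i a, Or.inl (hi a), rfl⟩)⟩
  · intro a b hab
    exact hpi (by rw [← hip, ← hip, hab])
  · intro a b hab
    exact hzi (by rw [← hjz, ← hjz, hab])
  · intro l hl
    obtain ⟨a, ha⟩ := hzs (x l) ⟨l, hl, rfl⟩
    exact ⟨a, hinj (hJ (hj a)) (hJ hl) ((hjz a).trans ha)⟩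

/-- Few vertices cannot separate many bags from the part of the haven seen from the roots. -/
theorem RootedBags.not_separated [Finite V] (h : RootedBags G β par q M x) (hβ : Haven G k β)
    {J : Set ℕ} (hJ : J ⊆ Set.Iio q) {A B E : Set V}
    (hAB : ∀ a ∈ A, a ∉ E → ∀ b ∈ B, b ∉ E → ¬ G.Adj a b) (hE : E.ncard < J.ncard)
    (hJB : ∀ j ∈ J, M j ⊆ A ∪ B ∧ (M j ∩ B).Nonempty) (hk : q + J.ncard ≤ k)
    (hQ : β (x '' Set.Iio q) ⊆ A ∪ B)
    (hQA : (β (x '' Set.Iio q ∪ E ∩ β (x '' Set.Iio q)) ∩ A).Nonempty) : False := by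
  set X := x '' Set.Iio q with hX
  have hXc : X.ncard = q := h.ncard_roots
  have hinj : Set.InjOn x (Set.Iio q) := fun i hi j hj hij => h.root_eq hi hj (hij ▸ h.mem j hj)
  set Q := β X with hQdef
  have hk' : (X ∪ E ∩ Q).ncard ≤ k := by
    have h1 := Set.ncard_union_le X (E ∩ Q)
    have h2 := Set.ncard_le_ncard (Set.inter_subset_left (s := E) (t := Q)) (Set.toFinite _)
    omega
  set D := β (X ∪ E ∩ Q) with hD
  have hDQ : D ⊆ Q := hβ.anti (by omega) hk' Set.subset_union_left
  have hDE : ∀ v ∈ D, v ∉ E := fun v hv hvE =>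
    Set.disjoint_left.1 (hβ.disj _ hk') hv (Or.inr ⟨hvE, hDQ hv⟩)
  have hDA : D ⊆ A := (hβ.conn _ hk').2 A hQA fun a haD haA b hbD hab => by
    by_contra hbA
    exact hAB a haA (hDE a haD) b ((hQ (hDQ hbD)).resolve_left hbA) (hDE b hbD) hab
  have hg : ∀ v : V, ∃ w, (v ∈ Q → w = v) ∧ ∀ j < q, v ∈ M j → w = x j := by
    intro v
    by_cases hv : ∃ j < q, v ∈ M j
    · obtain ⟨j, hj, hvj⟩ := hv
      refine ⟨x j, fun hvQ => (Set.disjoint_left.1 (h.avoid j hj) hvj hvQ).elim, ?_⟩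
      intro i hi hvi
      by_contra hne
      exact Set.disjoint_left.1 (h.disj j hj i hi fun hji => hne (hji ▸ rfl)) hvj hvi
    · exact ⟨v, fun _ => rfl, fun j hj hvj => (hv ⟨j, hj, hvj⟩).elim⟩
  choose g hgQ hgM using hg
  have hxJ : (x '' J).ncard = J.ncard := (hinj.mono hJ).ncard_image
  have hZ : (X \ x '' J ∪ g '' E).ncard < q := by
    have h1 := Set.ncard_union_le (X \ x '' J) (g '' E)
    have h2 := Set.ncard_sdiff_add_ncard_of_subset (s := x '' J) (t := X) (Set.image_mono hJ)
      (Set.toFinite X)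
    have h3 := Set.ncard_image_le (f := g) (Set.toFinite E)
    omega
  have hsub : β (X \ x '' J ∪ g '' E) ⊆ D := by
    refine hβ.subset_of_closed (by omega) (hβ.inter _ _ (by omega) hk') ?_
    intro a ha b hab hb
    by_contra hbD
    have hbX : b ∈ X ∪ E ∩ Q := by
      by_contra hb'
      exact hbD (hβ.closed _ hk' a ha b hab hb')
    rcases hbX with hbX | ⟨hbE, hbQ⟩
    · by_cases hbJ : b ∈ x '' J
      · obtain ⟨j, hj, rfl⟩ := hbJ
        have hjE : ∀ v ∈ M j, v ∉ E := fun v hv hvE =>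
          hb (Or.inr ⟨v, hvE, hgM v j (hJ hj) hv⟩)
        obtain ⟨hjH, v, hvM, hvB⟩ := hJB j hj
        have hjB : M j ⊆ B := (h.conn j (hJ hj)).2 B ⟨v, hvM, hvB⟩ fun c hc hcB d hd hcd => by
          by_contra hdB
          exact hAB d ((hjH hd).resolve_right hdB) (hjE d hd) c hcB (hjE c hc) hcd.symm
        have hxj := h.mem j (hJ hj)
        exact hAB a (hDA ha) (hDE a ha) (x j) (hjB hxj) (hjE _ hxj) hab
      · exact hb (Or.inl ⟨hbX, hbJ⟩)
    · exact hb (Or.inr ⟨b, hbE, hgQ b hbQ⟩)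
  obtain ⟨i, hi, v, hv, hvM⟩ := h.tight _ hZ
  exact Set.disjoint_left.1 (h.avoid i hi) hvM (hDQ (hsub hv))

theorem Haven.exists_strandFrame [Finite V] (hβ : Haven G k β) (hk : 6 * N + 3 ≤ k)
    (hm : m ≤ 2 * N) : ∃ T U H P x y, StrandFrame G N m T U H P x y := by
  have hpar : ∀ i, 0 < i → framePar N i < i := by
    intro i hi
    unfold framePar
    split_ifs <;> omega
  obtain ⟨M, x, h⟩ := hβ.exists_rootedBags (q := 4 * N + 3) hpar (by omega) (by omega)
  set X := x '' Set.Iio (4 * N + 3) with hX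
  have hXc : X.ncard = 4 * N + 3 := h.ncard_roots
  obtain ⟨C, i, j, hC, hCd, hCsub, hCx, hij, hi, hj, hjs⟩ :=
    h.exists_strands hβ (I := Set.Ico 3 (2 * N + 3)) (J := Set.Ico (2 * N + 3) (4 * N + 3))
      (n := 2 * N) (fun a ha => by simp only [Set.mem_Ico, Set.mem_Iio] at *; omega)
      (fun a ha => by simp only [Set.mem_Ico, Set.mem_Iio] at *; omega)
      (by rw [← Finset.coe_Ico, Set.ncard_coe_finset, Nat.card_Ico]; omega)
      (by rw [← Finset.coe_Ico, Set.ncard_coe_finset, Nat.card_Ico]; omega) (by omega)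
  have hs : ∀ b : Bool × Fin N, ∃ a, j a = 2 * N + 3 + (if b.1 then N else 0) + b.2 := by
    rintro ⟨t, n⟩
    apply hjs
    cases t <;> simp <;> omega
  choose s hs using hs
  have hsi : Function.Injective s := by
    rintro ⟨t, n⟩ ⟨t', n'⟩ hst
    have h1 := hs (t, n)
    rw [hst, hs] at h1
    cases t <;> cases t' <;> simp at h1 ⊢ <;> omega
  have hiI : ∀ a, 3 ≤ i a ∧ i a < 2 * N + 3 := fun a => (hij a).1
  have hjJ : ∀ a, 2 * N + 3 ≤ j a ∧ j a < 4 * N + 3 := fun a => (hij a).2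
  set H : Set V := {v | v ∈ β X ∨ ∃ l, 3 ≤ l ∧ l < 4 * N + 3 ∧ v ∈ M l} with hH
  have hQH : β X ⊆ H := fun v hv => Or.inl hv
  have hMH : ∀ l, 3 ≤ l → l < 4 * N + 3 → M l ⊆ H := fun l h3 hl v hv => Or.inr ⟨l, h3, hl, hv⟩
  have hMdH : ∀ l < 3, Disjoint (M l) H := by
    intro l hl
    refine Set.disjoint_left.2 fun v hv hvH => ?_
    rcases hvH with hvQ | ⟨l', h3, hl', hv'⟩
    · exact Set.disjoint_left.1 (h.avoid l (by omega)) hv hvQ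
    · exact Set.disjoint_left.1 (h.disj l (by omega) l' hl' (by omega)) hv hv'
  have hCM : ∀ a b, a ≠ b → ∀ l < 4 * N + 3, x l ∈ C b → Disjoint (C a) (M l) := by
    intro a b hab l hl hlb
    refine Set.disjoint_left.2 fun v hvC hvM => ?_
    rcases hCsub a hvC with hvQ | ⟨l', hl', rfl⟩
    · exact Set.disjoint_left.1 (h.avoid l hl) hvM hvQ
    · have hl'' : l' < 4 * N + 3 := by
        rcases hl' with hl' | hl' <;> simp only [Set.mem_Ico] at hl' <;> omega
      obtain rfl := h.root_eq hl'' hl hvM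
      exact Set.disjoint_left.1 (hCd hab) hvC hlb
  have hadjH : AdjSet G (M 0) (M 1) ∧ AdjSet G (M 0) (M 2) := by
    have h1 := h.adj 1 (by omega) (by omega)
    have h2 := h.adj 2 (by omega) (by omega)
    rw [framePar, if_pos (by omega)] at h1 h2
    exact ⟨h1, h2⟩
  have hxx : ∀ a, ∃ v ∈ M (i a), AdjSet G {v} (M 0) := by
    intro a
    have h1 := hiI a
    obtain ⟨u, hu, v, hv, huv⟩ := h.adj (i a) (by omega) (by omega)
    rw [framePar, if_pos (by omega)] at hu
    exact ⟨v, hv, v, rfl, u, hu, huv.symm⟩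
  choose x' hx'M hx'T using hxx
  have hyy : ∀ b, ∃ v ∈ M (j (s b)), AdjSet G {v} (if b.1 then M 2 else M 1) := by
    rintro ⟨t, n⟩
    have h1 := hjJ (s (t, n))
    have h2 := hs (t, n)
    obtain ⟨u, hu, v, hv, huv⟩ := h.adj (j (s (t, n))) (by omega) (by omega)
    refine ⟨v, hv, v, rfl, u, ?_, huv.symm⟩
    rw [framePar, if_neg (by omega)] at hu
    cases t
    · rw [if_pos (by simp at h2; omega)] at hu
      simpa using hu
    · rw [if_neg (by simp at h2; omega)] at hu
      simpa using hu
  choose y' hy'M hy'U using hyy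
  refine ⟨M 0, fun t => if t then M 2 else M 1, H, fun b => M (i (s b)) ∪ C (s b) ∪ M (j (s b)),
    fun b => x' (s b), y', ?_⟩
  constructor
  · exact h.conn 0 (by omega)
  · rintro (_ | _)
    · exact h.conn 1 (by omega)
    · exact h.conn 2 (by omega)
  · refine ConnSet.of_hub (hβ.conn X (by omega)) hQH ?_
    rintro v (hv | ⟨l, h3, hl, hv⟩)
    · exact ⟨β X, hβ.conn X (by omega), hQH, hv, by
        obtain ⟨w, hw⟩ := (hβ.conn X (by omega)).1
        exact ⟨w, hw, hw⟩⟩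
    · obtain ⟨u, hu, hxu⟩ := h.exists_adj hβ (by omega) hl
      exact ⟨M l ∪ β X, (h.conn l hl).union_adj (hβ.conn X (by omega))
        ⟨x l, h.mem l hl, u, hu, hxu⟩,
        Set.union_subset (hMH l h3 hl) hQH, Or.inl hv, u, Or.inr hu, hu⟩
  · rintro (_ | _)
    · exact h.disj 0 (by omega) 1 (by omega) (by omega)
    · exact h.disj 0 (by omega) 2 (by omega) (by omega)
  · exact h.disj 1 (by omega) 2 (by omega) (by omega)
  · exact hMdH 0 (by omega)
  · rintro (_ | _)
    · exact hMdH 1 (by omega)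
    · exact hMdH 2 (by omega)
  · rintro (_ | _)
    · exact hadjH.1
    · exact hadjH.2
  · intro b
    have h1 := hiI (s b)
    have h2 := hjJ (s b)
    exact ((h.conn _ (by omega)).union (hC _) ⟨_, h.mem _ (by omega), (hCx _).1⟩).union
      (h.conn _ (by omega)) ⟨_, Or.inr (hCx _).2, h.mem _ (by omega)⟩
  · intro a b hab
    have ha1 := hiI (s a)
    have ha2 := hjJ (s a)
    have hb1 := hiI (s b)
    have hb2 := hjJ (s b)
    have hsab : s a ≠ s b := fun h => hab (hsi h)
    refine Set.disjoint_union_left.2 ⟨Set.disjoint_union_left.2 ⟨?_, ?_⟩, ?_⟩ <;>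
    refine Set.disjoint_union_right.2 ⟨Set.disjoint_union_right.2 ⟨?_, ?_⟩, ?_⟩
    · exact h.disj _ (by omega) _ (by omega) fun h => hsab (hi h)
    · exact (hCM _ _ hsab.symm _ (by omega) (hCx _).1).symm
    · exact h.disj _ (by omega) _ (by omega) (by omega)
    · exact hCM _ _ hsab _ (by omega) (hCx _).1
    · exact hCd hsab
    · exact hCM _ _ hsab _ (by omega) (hCx _).2
    · exact h.disj _ (by omega) _ (by omega) (by omega)
    · exact (hCM _ _ hsab.symm _ (by omega) (hCx _).2).symm
    · exact h.disj _ (by omega) _ (by omega) fun h => hsab (hj h)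
  · intro b
    have h1 := hiI (s b)
    have h2 := hjJ (s b)
    refine Set.union_subset (Set.union_subset (hMH _ (by omega) (by omega)) ?_)
      (hMH _ (by omega) (by omega))
    intro v hv
    rcases hCsub _ hv with hvQ | ⟨l, hl, rfl⟩
    · exact hQH hvQ
    · have hl' : 3 ≤ l ∧ l < 4 * N + 3 := by
        rcases hl with hl | hl <;> simp only [Set.mem_Ico] at hl <;> omega
      exact hMH l hl'.1 hl'.2 (h.mem l hl'.2)
  · exact fun b => Or.inl (Or.inl (hx'M _))
  · exact fun b => Or.inr (hy'M _)
  · exact fun b => hx'T _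
  · rintro ⟨t, n⟩
    have := hy'U (t, n)
    cases t <;> exact this
  · intro A B E hABH hAB hdAB hE
    by_contra hcon
    push Not at hcon
    have hQ : β X ⊆ A ∪ B := hABH ▸ hQH
    have count : ∀ B' : Set V, m ≤ {a | x' (s a) ∈ B'}.ncard → ∃ J : Set ℕ,
        J ⊆ Set.Iio (4 * N + 3) ∧ J.ncard = m ∧
          ∀ l ∈ J, M l ⊆ H ∧ (M l ∩ B').Nonempty := by
      intro B' hB'
      have hinj : Set.InjOn (fun b => i (s b)) {a | x' (s a) ∈ B'} :=
        fun a _ b _ hab => hsi (hi hab)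
      rw [← hinj.ncard_image] at hB'
      obtain ⟨J, hJ, hJm⟩ := Set.exists_subset_card_eq hB'
      refine ⟨J, ?_, hJm, ?_⟩
      · intro l hl
        obtain ⟨a, -, rfl⟩ := hJ hl
        have := hiI (s a)
        simp only [Set.mem_Iio]
        omega
      · intro l hl
        obtain ⟨a, ha, rfl⟩ := hJ hl
        have := hiI (s a)
        exact ⟨hMH (i (s a)) (by omega) (by omega), x' (s a), hx'M _, ha⟩
    obtain ⟨JA, hJA, hJAm, hJAM⟩ := count A hcon.1
    obtain ⟨JB, hJB, hJBm, hJBM⟩ := count B hcon.2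
    have hXE : (X ∪ E ∩ β X).ncard ≤ k := by
      have h1 := Set.ncard_union_le X (E ∩ β X)
      have h2 := Set.ncard_le_ncard (Set.inter_subset_left (s := E) (t := β X)) (Set.toFinite _)
      omega
    obtain ⟨v, hv⟩ := (hβ.conn _ hXE).1
    rcases hQ (hβ.anti (by omega) hXE Set.subset_union_left hv) with hvA | hvB
    · exact h.not_separated hβ hJB hAB (by omega)
        (fun l hl => by rw [hABH]; exact hJBM l hl) (by omega) hQ ⟨v, hv, hvA⟩
    · rw [Set.union_comm] at hABH hQ
      exact h.not_separated hβ hJA (fun a ha haE b hb hbE hab => hAB b hb hbE a ha haE hab.symm)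
        (by omega) (fun l hl => by rw [hABH]; exact hJAM l hl) (by omega) hQ ⟨v, hv, hvB⟩

end

section

variable {V : Type*} {G : SimpleGraph V}

/-- No connected subset of `Γ` avoiding a vertex of `c` other than `x` and `y` contains both `x`
and `y`. -/
def TightFor (G : SimpleGraph V) (Γ c : Set V) (x y : V) : Prop :=
  ∀ v ∈ Γ, v ∈ c → v ≠ x → v ≠ y → ∀ C ⊆ Γ \ {v}, ConnSet G C → x ∈ C → y ∉ C

/-- A connected set joining `x` to `y` can be chosen tight with respect to the rest of `H`, in such
a way that every component of the rest meets `F`. -/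
theorem exists_tightFor [Finite V] {H F W : Set V} {x y : V} (hFH : F ⊆ H) (hW : ConnSet G W)
    (hWH : W ⊆ H \ F) (hx : x ∈ W) (hy : y ∈ W)
    (hreach : ∀ v ∈ H, ∃ C, ConnSet G C ∧ C ⊆ H ∧ v ∈ C ∧ (C ∩ (F ∪ W)).Nonempty) :
    ∃ Γ ⊆ H \ F, ConnSet G Γ ∧ x ∈ Γ ∧ y ∈ Γ ∧
      TightFor G Γ {v | AdjSet G {v} (H \ Γ)} x y ∧
      ∀ v ∈ H \ Γ, ∃ C, ConnSet G C ∧ C ⊆ H \ Γ ∧ v ∈ C ∧ (C ∩ F).Nonempty := by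
  let live : Set V → Set V := fun W =>
    {v | ∃ C, ConnSet G C ∧ C ⊆ H \ W ∧ v ∈ C ∧ (C ∩ F).Nonempty}
  let cand : Set (Set V) := {W | ConnSet G W ∧ W ⊆ H \ F ∧ x ∈ W ∧ y ∈ W}
  have hreach' : ∀ v ∈ H, ∃ C, ConnSet G C ∧ C ⊆ H ∧ v ∈ C ∧ (C ∩ (F ∪ {x})).Nonempty := by
    intro v hv
    obtain ⟨C, hC, hCH, hvC, w, hwC, hw | hw⟩ := hreach v hv
    · exact ⟨C, hC, hCH, hvC, w, hwC, Or.inl hw⟩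
    · exact ⟨C ∪ W, hC.union hW ⟨w, hwC, hw⟩, Set.union_subset hCH fun u hu => (hWH hu).1,
        Or.inl hvC, x, Or.inr hx, Or.inr rfl⟩
  obtain ⟨Z, hZ, hmax⟩ := Set.exists_max_image cand (fun W => (live W).ncard) (Set.toFinite _)
    ⟨W, hW, hWH, hx, hy⟩
  obtain ⟨hZc, hZH, hxZ, hyZ⟩ := hZ
  have hliveZ : ∀ v ∈ live Z, v ∈ H ∧ v ∉ Z := by
    rintro v ⟨C, -, hCH, hvC, -⟩
    exact hCH hvC
  have hFlive : F ⊆ live Z := fun f hf => ⟨{f}, .singleton f,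
    by simpa using ⟨hFH hf, fun h => (hZH h).2 hf⟩, rfl, f, rfl, hf⟩
  have hcl : ∀ C, ConnSet G C → C ⊆ H \ Z → (C ∩ live Z).Nonempty → C ⊆ live Z := by
    rintro C hC hCH ⟨u, huC, D, hD, hDH, huD, f, hfD, hfF⟩ v hv
    exact ⟨C ∪ D, hC.union hD ⟨u, huC, huD⟩, Set.union_subset hCH hDH, Or.inl hv, f,
      Or.inr hfD, hfF⟩
  have hback : H \ (H \ live Z) = live Z := by
    rw [Set.sdiff_sdiff_right_self]
    exact Set.inter_eq_right.2 fun v hv => (hliveZ v hv).1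
  have hZΓ : Z ⊆ H \ live Z := fun v hv => ⟨(hZH hv).1, fun h => (hliveZ v h).2 hv⟩
  refine ⟨H \ live Z, fun v hv => ⟨hv.1, fun h => hv.2 (hFlive h)⟩, ?_, hZΓ hxZ, hZΓ hyZ, ?_, ?_⟩
  · refine ConnSet.of_hub hZc hZΓ fun v hv => ?_
    by_cases hvZ : v ∈ Z
    · exact ⟨Z, hZc, hZΓ, hvZ, v, hvZ, hvZ⟩
    obtain ⟨C, hC, hCH, hvC, w, hwC, hw⟩ := hreach' v hv.1
    have hCZ : (C ∩ Z).Nonempty := by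
      by_contra hCZ
      have hCZ' : C ⊆ H \ Z := fun u hu => ⟨hCH hu, fun huZ => hCZ ⟨u, hu, huZ⟩⟩
      rcases hw with hw | rfl
      · exact hv.2 ⟨C, hC, hCZ', hvC, w, hwC, hw⟩
      · exact hCZ ⟨w, hwC, hxZ⟩
    obtain ⟨D, hDC, hD, hvD, d, hd, a, ⟨haC, haZ⟩, hda⟩ := hC.exists_to hvC hvZ hCZ
    have hDH : D ⊆ H \ Z := fun u hu => ⟨hCH (hDC hu).1, (hDC hu).2⟩
    have hDΓ : D ⊆ H \ live Z := fun u hu => ⟨(hDH hu).1, fun hul =>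
      hv.2 (hcl D hD hDH ⟨u, hu, hul⟩ hvD)⟩
    exact ⟨D ∪ Z, hD.union_adj hZc ⟨d, hd, a, haZ, hda⟩, Set.union_subset hDΓ hZΓ, Or.inl hvD,
      a, Or.inr haZ, haZ⟩
  · intro c hc hadj hcx hcy C hC hCc hxC hyC
    rw [hback] at hadj
    obtain ⟨c', hc', u, hu, hcu⟩ := hadj
    obtain rfl : c' = c := hc'
    have hCcand : C ∈ cand := ⟨hCc, fun v hv => ⟨(hC hv).1.1, fun h => (hC hv).1.2 (hFlive h)⟩,
      hxC, hyC⟩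
    refine absurd (hmax C hCcand) (not_le.2 (Set.ncard_lt_ncard ⟨?_, ?_⟩ (Set.toFinite _)))
    · rintro v hv
      obtain ⟨D, hD, hDH, hvD, hDF⟩ := hv
      have hDl := hcl D hD hDH ⟨v, hvD, D, hD, hDH, hvD, hDF⟩
      exact ⟨D, hD, fun w hw => ⟨(hDH hw).1, fun hwC => (hC hwC).1.2 (hDl hw)⟩, hvD, hDF⟩
    · intro hsub
      obtain ⟨D, hD, hDH, huD, hDF⟩ := hu
      have hDl := hcl D hD hDH ⟨u, huD, D, hD, hDH, huD, hDF⟩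
      refine hc.2 (hsub ⟨insert c' D, hD.insert_adj huD hcu, ?_, Or.inl rfl,
        hDF.mono (Set.inter_subset_inter_left _ (Set.subset_insert _ _))⟩)
      rintro w (rfl | hw)
      · exact ⟨hc.1, fun h => (hC h).2 rfl⟩
      · exact ⟨(hDH hw).1, fun hwC => (hC hwC).1.2 (hDl hw)⟩
  · rw [hback]
    rintro v ⟨D, hD, hDH, hvD, hDF⟩
    exact ⟨D, hD, hcl D hD hDH ⟨v, hvD, D, hD, hDH, hvD, hDF⟩, hvD, hDF⟩

/-- A partition of `Γ` into `A` and `B` such that the deletion of `E` separates `A` from `B`, all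
elements of `r` in `A` and of `b` in `B` lie in `E`, every component of `A` meets `b` and every
component of `B` meets `r`. -/
structure ColorSplit (G : SimpleGraph V) (b r Γ A B E : Set V) : Prop where
  union : A ∪ B = Γ
  disj : Disjoint A B
  cross : ∀ u ∈ A, u ∉ E → ∀ v ∈ B, v ∉ E → ¬ G.Adj u v
  left : r ∩ A ⊆ E
  right : b ∩ B ⊆ E
  conn_left : ∀ v ∈ A, ∃ C, ConnSet G C ∧ C ⊆ A ∧ v ∈ C ∧ (C ∩ b).Nonempty
  conn_right : ∀ v ∈ B, ∃ C, ConnSet G C ∧ C ⊆ B ∧ v ∈ C ∧ (C ∩ r).Nonempty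

variable {b r Γ A B E : Set V}

theorem ColorSplit.symm (h : ColorSplit G b r Γ A B E) : ColorSplit G r b Γ B A E :=
  ⟨by rw [Set.union_comm, h.union], h.disj.symm,
    fun u hu huE v hv hvE huv => h.cross v hv hvE u hu huE huv.symm, h.right, h.left,
    h.conn_right, h.conn_left⟩

theorem ColorSplit.of_left (hΓ : ConnSet G Γ) (hb : (Γ ∩ b).Nonempty)
    (hr : r ∩ Γ ⊆ E) : ColorSplit G b r Γ Γ ∅ E :=
  ⟨by simp, by simp, by simp, hr, by simp, fun v hv => ⟨Γ, hΓ, le_rfl, hv, hb⟩, by simp⟩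

theorem ColorSplit.attach {S Y : Set V} {c : V} (h : ColorSplit G b r Y A B E)
    (hS : ConnSet G S) (hSY : Disjoint S Y) (hSb : (S ∩ b).Nonempty) (hSr : r ∩ S ⊆ {c})
    (hc : ∀ u ∈ S, ∀ v ∈ Y, G.Adj u v → u = c) :
    ColorSplit G b r (S ∪ Y) (S ∪ A) B (insert c E) := by
  have hAY : A ⊆ Y := h.union ▸ Set.subset_union_left
  have hBY : B ⊆ Y := h.union ▸ Set.subset_union_right
  refine ⟨by rw [Set.union_assoc, h.union],
    Set.disjoint_union_left.2 ⟨hSY.mono_right hBY, h.disj⟩, ?_, ?_, ?_, ?_, h.conn_right⟩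
  · rintro u (hu | hu) huE v hv hvE huv
    · exact huE (Or.inl (hc u hu v (hBY hv) huv))
    · exact h.cross u hu (fun h => huE (Or.inr h)) v hv (fun h => hvE (Or.inr h)) huv
  · rintro u ⟨hur, hu | hu⟩
    · exact Or.inl (hSr ⟨hur, hu⟩)
    · exact Or.inr (h.left ⟨hur, hu⟩)
  · exact h.right.trans (Set.subset_insert _ _)
  · rintro v (hv | hv)
    · exact ⟨S, hS, Set.subset_union_left, hv, hSb⟩
    · obtain ⟨C, hC, hCA, hvC, hCb⟩ := h.conn_left v hv
      exact ⟨C, hC, hCA.trans Set.subset_union_right, hvC, hCb⟩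

/-- The part of `Γ` cut off from `y` by `c`, together with `c`. -/
def seg (G : SimpleGraph V) (Γ : Set V) (y c : V) : Set V := Γ \ comp G (Γ \ {c}) y

theorem mem_of_mem_comp {S : Set V} {v w : V} (h : w ∈ comp G S v) : v ∈ S :=
  comp_subset (comp_symm h)

variable {x y c c' : V}

theorem mem_seg (hc : c ∈ Γ) : c ∈ seg G Γ y c := ⟨hc, fun h => (comp_subset h).2 rfl⟩

theorem seg_conn (hΓ : ConnSet G Γ) (hc : c ∈ Γ) : ConnSet G (seg G Γ y c) :=
  hΓ.diff_comp (by simpa using hc) (.singleton c)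

theorem left_mem_seg {col : Set V} (ht : TightFor G Γ col x y) (hx : x ∈ Γ) (hc : c ∈ Γ)
    (hcol : c ∈ col) : x ∈ seg G Γ y c := by
  refine ⟨hx, fun h => ?_⟩
  have hy := mem_of_mem_comp h
  exact ht c hc hcol (fun hcx => (comp_subset h).2 hcx.symm) (fun hcy => hy.2 hcy.symm) _
    comp_subset (comp_conn hy) h (mem_comp_self hy)

theorem seg_ssubset_of_notMem {col : Set V} (hΓ : ConnSet G Γ) (ht : TightFor G Γ col x y)
    (hx : x ∈ Γ) (hc : c ∈ Γ) (hcol : c ∈ col) (hc' : c' ∈ Γ) (hcol' : c' ∈ col)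
    (h : c' ∉ seg G Γ y c) : seg G Γ y c ⊂ seg G Γ y c' := by
  refine ⟨fun v hv => ⟨hv.1, fun hvc => ?_⟩, fun hsub => h (hsub (mem_seg hc'))⟩
  have hsub : seg G Γ y c ⊆ Γ \ {c'} := fun u hu => ⟨hu.1, fun huc => h (huc ▸ hu)⟩
  have := comp_max (seg_conn hΓ hc) hsub ⟨v, hv, hvc⟩ (left_mem_seg ht hx hc hcol)
  exact (left_mem_seg ht hx hc' hcol').2 this

theorem seg_ssubset_of_mem (hΓ : ConnSet G Γ) (hy : y ∈ Γ) (hc : c ∈ Γ)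
    (hc' : c' ∈ seg G Γ y c) (hne : c' ≠ c) : seg G Γ y c' ⊂ seg G Γ y c := by
  have key : ConnSet G (insert c (comp G (Γ \ {c}) y)) ∧ y ∈ insert c (comp G (Γ \ {c}) y) := by
    by_cases hcy : y = c
    · have : comp G (Γ \ {c}) y = ∅ := by
        by_contra hne
        obtain ⟨w, hw⟩ := Set.nonempty_iff_ne_empty.2 hne
        exact (mem_of_mem_comp hw).2 hcy
      rw [this]
      exact ⟨by simpa using ConnSet.singleton c, Or.inl hcy⟩
    · have hy' : y ∈ Γ \ {c} := ⟨hy, hcy⟩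
      obtain ⟨a, ha, c₁, hc₁, hac⟩ := hΓ.comp_adj (by simpa using hc)
        (Set.singleton_nonempty c) hy'
      obtain rfl : c₁ = c := hc₁
      exact ⟨(comp_conn hy').insert_adj ha hac.symm, Or.inr (mem_comp_self hy')⟩
  have hsub : insert c (comp G (Γ \ {c}) y) ⊆ comp G (Γ \ {c'}) y := by
    refine subset_comp key.1 ?_ key.2
    rintro v (rfl | hv)
    · exact ⟨hc, fun h => hne h.symm⟩
    · exact ⟨(comp_subset hv).1, fun h => hc'.2 (h ▸ hv)⟩
  refine ⟨fun v hv => ⟨hv.1, fun h => hv.2 (hsub (Or.inr h))⟩, fun h => ?_⟩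
  exact (h (mem_seg hc)).2 (hsub (Or.inl rfl))

theorem exists_seg [Finite V] (hΓ : ConnSet G Γ) (hx : x ∈ Γ) (hy : y ∈ Γ)
    (ht : TightFor G Γ (b ∪ r) x y) (hb : (Γ ∩ b).Nonempty) (hr : (Γ ∩ r).Nonempty) :
    ∃ c ∈ Γ, x ∈ seg G Γ y c ∧ (seg G Γ y c ∩ b).Nonempty ∧ (seg G Γ y c ∩ r).Nonempty ∧
      (r ∩ seg G Γ y c ⊆ {c} ∨ b ∩ seg G Γ y c ⊆ {c}) := by
  let bi : Set V := {c | c ∈ Γ ∧ c ∈ b ∪ r ∧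
    (seg G Γ y c ∩ b).Nonempty ∧ (seg G Γ y c ∩ r).Nonempty}
  have hbi : bi.Nonempty := by
    obtain ⟨p, hp⟩ := hb
    obtain ⟨c, ⟨hc, hcc⟩, hmax⟩ := Set.exists_max_image (Γ ∩ (b ∪ r))
      (fun c => (seg G Γ y c).ncard) (Set.toFinite _) ⟨p, hp.1, Or.inl hp.2⟩
    have hall : ∀ v ∈ Γ, v ∈ b ∪ r → v ∈ seg G Γ y c := by
      intro v hv hvc
      by_contra h
      exact absurd (hmax v ⟨hv, hvc⟩) (not_le.2 (Set.ncard_lt_ncard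
        (seg_ssubset_of_notMem hΓ ht hx hc hcc hv hvc h) (Set.toFinite _)))
    obtain ⟨q, hq⟩ := hr
    exact ⟨c, hc, hcc, ⟨p, hall p hp.1 (Or.inl hp.2), hp.2⟩, ⟨q, hall q hq.1 (Or.inr hq.2), hq.2⟩⟩
  obtain ⟨c, ⟨hc, hcc, hcb, hcr⟩, hmin⟩ := Set.exists_min_image bi
    (fun c => (seg G Γ y c).ncard) (Set.toFinite _) hbi
  refine ⟨c, hc, left_mem_seg ht hx hc hcc, hcb, hcr, ?_⟩
  by_contra hcon
  push Not at hcon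
  simp only [Set.subset_singleton_iff, not_forall] at hcon
  obtain ⟨⟨q, ⟨hqr, hq⟩, hqc⟩, p, ⟨hpb, hp⟩, hpc⟩ := hcon
  have hpn : p ∉ bi := fun h => absurd (hmin p h) (not_le.2 (Set.ncard_lt_ncard
    (seg_ssubset_of_mem hΓ hy hc hp hpc) (Set.toFinite _)))
  have hqn : q ∉ bi := fun h => absurd (hmin q h) (not_le.2 (Set.ncard_lt_ncard
    (seg_ssubset_of_mem hΓ hy hc hq hqc) (Set.toFinite _)))
  have hpq : q ∉ seg G Γ y p := fun h =>
    hpn ⟨hp.1, Or.inl hpb, ⟨p, mem_seg hp.1, hpb⟩, q, h, hqr⟩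
  have := seg_ssubset_of_notMem hΓ ht hx hp.1 (Or.inl hpb) hq.1 (Or.inr hqr) hpq
  exact hqn ⟨hq.1, Or.inr hqr, ⟨p, this.1 (mem_seg hp.1), hpb⟩, q, mem_seg hq.1, hqr⟩

/-- A tight connected set is either cut into many pieces meeting both `b` and `r`, or it can be
split into a part for `b` and a part for `r`. -/
theorem setChain_or_colorSplit [Finite V] {R : ℕ} (hR : 1 ≤ R) (hΓ : ConnSet G Γ) (hx : x ∈ Γ)
    (hy : y ∈ Γ) (ht : TightFor G Γ (b ∪ r) x y) (hcol : (Γ ∩ (b ∪ r)).Nonempty) :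
    (∃ U H L, SetChain G (fun C => (C ∩ b).Nonempty ∧ (C ∩ r).Nonempty) R U H L ∧ U ⊆ Γ ∧
      x ∈ H ∧ y ∈ L) ∨ ∃ A B E, ColorSplit G b r Γ A B E ∧ E.ncard < R := by
  induction R, hR using Nat.le_induction generalizing Γ x with
  | base =>
    by_cases hb : (Γ ∩ b).Nonempty
    · by_cases hr : (Γ ∩ r).Nonempty
      · exact Or.inl ⟨Γ, Γ, Γ, .single Γ hΓ ⟨hb, hr⟩, le_rfl, hx, hy⟩
      · refine Or.inr ⟨Γ, ∅, ∅, .of_left hΓ hb fun v hv => hr ⟨v, hv.2, hv.1⟩, by simp⟩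
    · have hr : (Γ ∩ r).Nonempty := by
        obtain ⟨v, hv, hvb | hvr⟩ := hcol
        · exact (hb ⟨v, hv, hvb⟩).elim
        · exact ⟨v, hv, hvr⟩
      exact Or.inr ⟨∅, Γ, ∅, (ColorSplit.of_left hΓ hr fun v hv => hb ⟨v, hv.2, hv.1⟩).symm,
        by simp⟩
  | succ R hR ih =>
    by_cases hb : (Γ ∩ b).Nonempty
    swap
    · have hr : (Γ ∩ r).Nonempty := by
        obtain ⟨v, hv, hvb | hvr⟩ := hcol
        · exact (hb ⟨v, hv, hvb⟩).elim
        · exact ⟨v, hv, hvr⟩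
      exact Or.inr ⟨∅, Γ, ∅, (ColorSplit.of_left hΓ hr fun v hv => hb ⟨v, hv.2, hv.1⟩).symm,
        by simp⟩
    by_cases hr : (Γ ∩ r).Nonempty
    swap
    · exact Or.inr ⟨Γ, ∅, ∅, .of_left hΓ hb fun v hv => hr ⟨v, hv.2, hv.1⟩, by simp⟩
    obtain ⟨c, hc, hxS, hSb, hSr, hmono⟩ := exists_seg hΓ hx hy ht hb hr
    set S := seg G Γ y c with hS
    set Y := comp G (Γ \ {c}) y with hYdef
    have hSY : S ∪ Y = Γ := Set.sdiff_union_of_subset fun v hv => (comp_subset hv).1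
    have hSYd : Disjoint S Y := Set.disjoint_sdiff_left
    have hSc : ConnSet G S := seg_conn hΓ hc
    have hcut : ∀ u ∈ S, ∀ v ∈ Y, G.Adj u v → u = c := by
      intro u hu v hv huv
      by_contra hne
      exact hu.2 (comp_closed hv ⟨hu.1, hne⟩ huv.symm)
    by_cases hYcol : (Y ∩ (b ∪ r)).Nonempty
    · have hyΓ : y ∈ Γ \ {c} := by
        obtain ⟨v, hv, -⟩ := hYcol
        exact mem_of_mem_comp hv
      obtain ⟨x', hx', c₁, hc₁, hxc⟩ := hΓ.comp_adj (by simpa using hc)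
        (Set.singleton_nonempty c) hyΓ
      obtain rfl : c₁ = c := hc₁
      have htY : TightFor G Y (b ∪ r) x' y := by
        intro v hv hvc hvx hvy C hC hCc hxC hyC
        refine ht v (comp_subset hv).1 hvc ?_ hvy (S ∪ C) ?_
          (hSc.union_adj hCc ⟨c₁, mem_seg hc, x', hxC, hxc.symm⟩) (Or.inl hxS) (Or.inr hyC)
        · rintro rfl
          exact hxS.2 hv
        · rintro u (hu | hu)
          · exact ⟨hu.1, fun huv => hu.2 (huv ▸ hv)⟩
          · exact ⟨(comp_subset (hC hu).1).1, (hC hu).2⟩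
      rcases ih (comp_conn hyΓ) hx' (mem_comp_self hyΓ) htY hYcol with
        ⟨U, H, L, hch, hUY, hxH, hyL⟩ | ⟨A, B, E, hsp, hE⟩
      · exact Or.inl ⟨S ∪ U, S, L, .cons S hSc ⟨hSb, hSr⟩ (hSYd.mono_right hUY)
          ⟨c₁, mem_seg hc, x', hxH, hxc.symm⟩ hch,
          Set.union_subset Set.sdiff_subset (hUY.trans fun v hv => (comp_subset hv).1), hxS, hyL⟩
      · have hcard : (insert c₁ E).ncard < R + 1 := (Set.ncard_insert_le _ _).trans_lt (by omega)
        rcases hmono with hmono | hmono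
        · exact Or.inr ⟨_, _, _, hSY ▸ hsp.attach hSc hSYd hSb hmono hcut, hcard⟩
        · exact Or.inr ⟨_, _, _, (hSY ▸ hsp.symm.attach hSc hSYd hSr hmono hcut :
            ColorSplit G r b Γ _ _ _).symm, hcard⟩
    · have hnot : ∀ v ∈ Γ, v ∈ b ∪ r → v ∈ S := fun v hv hvc =>
        ⟨hv, fun hvY => hYcol ⟨v, hvY, hvc⟩⟩
      rcases hmono with hmono | hmono
      · exact Or.inr ⟨Γ, ∅, {c}, .of_left hΓ hb fun v hv =>
          hmono ⟨hv.1, hnot v hv.2 (Or.inr hv.1)⟩, by simp; omega⟩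
      · exact Or.inr ⟨∅, Γ, {c}, (ColorSplit.of_left hΓ hr fun v hv =>
          hmono ⟨hv.1, hnot v hv.2 (Or.inl hv.1)⟩).symm, by simp; omega⟩

end

section

variable {V : Type*} {G : SimpleGraph V}

theorem ConnSet.union_of_attached {K S : Set V} (hK : ConnSet G K)
    (h : ∀ v ∈ S, ∃ C, ConnSet G C ∧ C ⊆ S ∧ v ∈ C ∧ AdjSet G C K) : ConnSet G (K ∪ S) := by
  refine ConnSet.of_hub hK Set.subset_union_left fun v hv => ?_
  obtain ⟨k, hk⟩ := hK.1
  rcases hv with hv | hv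
  · exact ⟨K, hK, Set.subset_union_left, hv, k, hk, hk⟩
  · obtain ⟨C, hC, hCS, hvC, hCK⟩ := h v hv
    exact ⟨C ∪ K, hC.union_adj hK hCK, Set.union_subset (hCS.trans Set.subset_union_right)
      Set.subset_union_left, Or.inl hvC, k, Or.inr hk, hk⟩

theorem sdiff_comp_attached {K A : Set V} {d : V}
    (h : ∀ v ∈ A, ∃ C, ConnSet G C ∧ C ⊆ A ∧ v ∈ C ∧ AdjSet G C K) :
    ∀ v ∈ A \ comp G A d, ∃ C, ConnSet G C ∧ C ⊆ A \ comp G A d ∧ v ∈ C ∧ AdjSet G C K := by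
  intro v hv
  obtain ⟨C, hC, hCA, hvC, hCK⟩ := h v hv.1
  exact ⟨C, hC, fun u hu => ⟨hCA hu, fun hud => hv.2 (comp_max hC hCA ⟨u, hu, hud⟩ hvC)⟩, hvC,
    hCK⟩

theorem comp_adjSet {K A : Set V} {d : V} (hd : d ∈ A)
    (h : ∀ v ∈ A, ∃ C, ConnSet G C ∧ C ⊆ A ∧ v ∈ C ∧ AdjSet G C K) : AdjSet G (comp G A d) K := by
  obtain ⟨C, hC, hCA, hvC, hCK⟩ := h d hd
  exact hCK.mono (subset_comp hC hCA hvC) le_rfl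

theorem AdjSet.union_or {A B C : Set V} (h : AdjSet G C (A ∪ B)) : AdjSet G C A ∨ AdjSet G C B := by
  obtain ⟨a, ha, b, hb | hb, hab⟩ := h
  · exact Or.inl ⟨a, ha, b, hb, hab⟩
  · exact Or.inr ⟨a, ha, b, hb, hab⟩

/-- A chain of sets, all adjacent to both `A` and `B`, where every component of `A` is adjacent to
`K` and `U false`, and every component of `B` is adjacent to `K` and `U true`. -/
theorem doubleWheel_minor_of_chain {r : ℕ} (hr : 2 ≤ r) {K A B W H L : Set V} {U : Bool → Set V}
    (hK : ConnSet G K) (hU : ∀ t, ConnSet G (U t)) (hKU : ∀ t, AdjSet G K (U t))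
    (hUd : Disjoint (U false) (U true)) (hKUd : ∀ t, Disjoint K (U t)) (hABd : Disjoint A B)
    (hKAB : Disjoint K (A ∪ B)) (hUAB : ∀ t, Disjoint (U t) (A ∪ B)) (hWAB : Disjoint W (A ∪ B))
    (hWK : Disjoint W K) (hWU : ∀ t, Disjoint W (U t))
    (hA : ∀ v ∈ A, ∃ C, ConnSet G C ∧ C ⊆ A ∧ v ∈ C ∧ AdjSet G C K ∧ AdjSet G C (U false))
    (hB : ∀ v ∈ B, ∃ C, ConnSet G C ∧ C ⊆ B ∧ v ∈ C ∧ AdjSet G C K ∧ AdjSet G C (U true))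
    (hch : SetChain G (fun C => AdjSet G C A ∧ AdjSet G C B) (3 * r) W H L)
    (hH : AdjSet G H K) (hL : AdjSet G L (K ∪ U false ∪ U true)) :
    IsMinor (doubleWheel r) G := by
  have hAK : ∀ v ∈ A, ∃ C, ConnSet G C ∧ C ⊆ A ∧ v ∈ C ∧ AdjSet G C K := fun v hv =>
    (hA v hv).imp fun C h => ⟨h.1, h.2.1, h.2.2.1, h.2.2.2.1⟩
  have hAU : ∀ v ∈ A, ∃ C, ConnSet G C ∧ C ⊆ A ∧ v ∈ C ∧ AdjSet G C (U false) := fun v hv =>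
    (hA v hv).imp fun C h => ⟨h.1, h.2.1, h.2.2.1, h.2.2.2.2⟩
  have hBK : ∀ v ∈ B, ∃ C, ConnSet G C ∧ C ⊆ B ∧ v ∈ C ∧ AdjSet G C K := fun v hv =>
    (hB v hv).imp fun C h => ⟨h.1, h.2.1, h.2.2.1, h.2.2.2.1⟩
  have hBU : ∀ v ∈ B, ∃ C, ConnSet G C ∧ C ⊆ B ∧ v ∈ C ∧ AdjSet G C (U true) := fun v hv =>
    (hB v hv).imp fun C h => ⟨h.1, h.2.1, h.2.2.1, h.2.2.2.2⟩
  rw [Set.disjoint_union_right] at hKAB hWAB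
  have hU0 := Set.disjoint_union_right.1 (hUAB false)
  have hU1 := Set.disjoint_union_right.1 (hUAB true)
  have hLAB : AdjSet G L A ∧ AdjSet G L B := by
    obtain ⟨W', h1, -, -, -, h5⟩ := hch.exists_fun
    exact h5 ▸ (h1 (3 * r - 1) (by omega)).2.1
  obtain ⟨⟨l, hl, d, hd, hld⟩, ⟨l', hl', d', hd', hld'⟩⟩ := hLAB
  set D := comp G A d with hD
  set D' := comp G B d' with hD'
  have hDA : D ⊆ A := comp_subset
  have hDB : D' ⊆ B := comp_subset
  have hLD : AdjSet G L D := ⟨l, hl, d, mem_comp_self hd, hld⟩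
  have hLD' : AdjSet G L D' := ⟨l', hl', d', mem_comp_self hd', hld'⟩
  have hKD : ConnSet G (K ∪ D) := hK.union_adj (comp_conn hd) (comp_adjSet hd hAK).symm
  have hKD' : ConnSet G (K ∪ D') := hK.union_adj (comp_conn hd') (comp_adjSet hd' hBK).symm
  have hsplit : ∀ {C A D : Set V}, AdjSet G C A → AdjSet G C D ∨ AdjSet G C (A \ D) := by
    rintro C A D ⟨c, hc, a, ha, hca⟩
    by_cases haD : a ∈ D
    · exact Or.inl ⟨c, hc, a, haD, hca⟩
    · exact Or.inr ⟨c, hc, a, ⟨ha, haD⟩, hca⟩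
  have hmono : ∀ X Y : Set V, ∀ A B : Set V, A ⊆ B → AdjSet G A X ∧ AdjSet G A Y →
      AdjSet G B X ∧ AdjSet G B Y := fun X Y A B hAB h =>
    ⟨h.1.mono hAB le_rfl, h.2.mono hAB le_rfl⟩
  rcases hch.pigeonhole (p := r) (q := 2 * r) (hmono (A \ D) B) (hmono D B)
    (fun C _ h => (hsplit h.1).symm.imp (fun h' => ⟨h', h.2⟩) (fun h' => ⟨h', h.2⟩))
    (by omega) (by omega) (by omega) with ⟨H₁, hH₁, L₁, hL₁, h₁⟩ | ⟨H₁, hH₁, L₁, hL₁, h₁⟩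
  · refine (h₁.imp fun C _ h => ⟨h.1.mono le_rfl Set.subset_union_right,
      h.2.mono le_rfl Set.subset_union_right⟩ :
      SetChain G (fun C => AdjSet G C (U false ∪ A \ D) ∧ AdjSet G C (U true ∪ B)) r W H₁ L₁
      ).doubleWheel_minor (K := K ∪ D) hr
      ((hU false).union_of_attached (sdiff_comp_attached hAU)) ((hU true).union_of_attached hBU)
      hKD ?_ ?_ ?_ ?_ ?_ ?_ (hH.mono hH₁ Set.subset_union_left)
      (hLD.mono hL₁ Set.subset_union_right)
    · simp only [Set.disjoint_union_left, Set.disjoint_union_right]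
      exact ⟨⟨hUd, hU1.1.symm.mono_left Set.sdiff_subset⟩, hU0.2, hABd.mono_left Set.sdiff_subset⟩
    · simp only [Set.disjoint_union_left, Set.disjoint_union_right]
      exact ⟨⟨(hKUd false).symm, hKAB.1.symm.mono_left Set.sdiff_subset⟩,
        hU0.1.mono_right hDA, Set.disjoint_sdiff_left⟩
    · simp only [Set.disjoint_union_left, Set.disjoint_union_right]
      exact ⟨⟨(hKUd true).symm, hKAB.2.symm⟩, hU1.1.mono_right hDA, hABd.symm.mono_right hDA⟩
    · exact Set.disjoint_union_right.2 ⟨hWU false, hWAB.1.mono_right Set.sdiff_subset⟩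
    · exact Set.disjoint_union_right.2 ⟨hWU true, hWAB.2⟩
    · exact Set.disjoint_union_right.2 ⟨hWK, hWAB.1.mono_right hDA⟩
  rcases h₁.pigeonhole (p := r) (q := r) (hmono D (B \ D')) (hmono D D')
    (fun C _ h => (hsplit h.2).symm.imp (fun h' => ⟨h.1, h'⟩) (fun h' => ⟨h.1, h'⟩))
    (by omega) (by omega) (by omega) with ⟨H₂, hH₂, L₂, hL₂, h₂⟩ | ⟨H₂, hH₂, L₂, hL₂, h₂⟩
  · refine (h₂.imp fun C _ h => ⟨h.1, h.2.mono le_rfl Set.subset_union_right⟩ :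
      SetChain G (fun C => AdjSet G C D ∧ AdjSet G C (U true ∪ B \ D')) r W H₂ L₂
      ).doubleWheel_minor (K := K ∪ D') hr (comp_conn hd)
      ((hU true).union_of_attached (sdiff_comp_attached hBU)) hKD' ?_ ?_ ?_ ?_ ?_ ?_
      (hH.mono (hH₁.trans hH₂) Set.subset_union_left)
      (hLD'.mono (hL₁.trans hL₂) Set.subset_union_right)
    · exact Set.disjoint_union_right.2 ⟨hU1.1.symm.mono_left hDA,
        (hABd.mono_left hDA).mono_right Set.sdiff_subset⟩
    · exact Set.disjoint_union_right.2 ⟨hKAB.1.symm.mono_left hDA,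
        (hABd.mono_left hDA).mono_right hDB⟩
    · simp only [Set.disjoint_union_left, Set.disjoint_union_right]
      exact ⟨⟨(hKUd true).symm, hKAB.2.symm.mono_left Set.sdiff_subset⟩,
        hU1.2.mono_right hDB, Set.disjoint_sdiff_left⟩
    · exact hWAB.1.mono_right hDA
    · exact Set.disjoint_union_right.2 ⟨hWU true, hWAB.2.mono_right Set.sdiff_subset⟩
    · exact Set.disjoint_union_right.2 ⟨hWK, hWAB.2.mono_right hDB⟩
  · refine h₂.doubleWheel_minor (K := K ∪ U false ∪ U true) hr (comp_conn hd) (comp_conn hd')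
      ((hK.union_adj (hU false) (hKU false)).union_adj (hU true)
        ((hKU true).mono Set.subset_union_left le_rfl))
      ((hABd.mono_left hDA).mono_right hDB) ?_ ?_ (hWAB.1.mono_right hDA)
      (hWAB.2.mono_right hDB) ?_
      (hH.mono (hH₁.trans hH₂) (Set.subset_union_left.trans Set.subset_union_left))
      (hL.mono (hL₁.trans hL₂) le_rfl)
    · simp only [Set.disjoint_union_right]
      exact ⟨⟨hKAB.1.symm.mono_left hDA, hU0.1.symm.mono_left hDA⟩, hU1.1.symm.mono_left hDA⟩
    · simp only [Set.disjoint_union_right]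
      exact ⟨⟨hKAB.2.symm.mono_left hDB, hU0.2.symm.mono_left hDB⟩, hU1.2.symm.mono_left hDB⟩
    · simp only [Set.disjoint_union_right]
      exact ⟨⟨hWK, hWU false⟩, hWU true⟩

/-- A partition of `H` into `A` and `B` separated by the deletion of `E`, such that every component
of `A` is adjacent to `T` and `U false` and every component of `B` to `T` and `U true`. -/
structure GoodPart (G : SimpleGraph V) (T : Set V) (U : Bool → Set V) (H A B E : Set V) :
    Prop where
  union : A ∪ B = H
  disj : Disjoint A B
  cross : ∀ u ∈ A, u ∉ E → ∀ v ∈ B, v ∉ E → ¬ G.Adj u v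
  conn_left : ∀ v ∈ A, ∃ C, ConnSet G C ∧ C ⊆ A ∧ v ∈ C ∧ AdjSet G C T ∧ AdjSet G C (U false)
  conn_right : ∀ v ∈ B, ∃ C, ConnSet G C ∧ C ⊆ B ∧ v ∈ C ∧ AdjSet G C T ∧ AdjSet G C (U true)

variable {T H A B E Γ : Set V} {U : Bool → Set V} {r : ℕ} {x y : V}

theorem GoodPart.extend_of_colorSplit [Finite V] {A' B' E' : Set V}
    (h : GoodPart G T U (H \ Γ) A B E) (hΓH : Γ ⊆ H)
    (hs : ColorSplit G {v | AdjSet G {v} A} {v | AdjSet G {v} B} Γ A' B' E') :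
    GoodPart G T U H (A ∪ A') (B ∪ B') (E ∪ E') := by
  have hA : ∀ v ∈ A, v ∉ Γ := fun v hv => (h.union ▸ Or.inl hv : v ∈ H \ Γ).2
  have hB : ∀ v ∈ B, v ∉ Γ := fun v hv => (h.union ▸ Or.inr hv : v ∈ H \ Γ).2
  have hA' : A' ⊆ Γ := hs.union ▸ Set.subset_union_left
  have hB' : B' ⊆ Γ := hs.union ▸ Set.subset_union_right
  refine ⟨?_, ?_, ?_, ?_, ?_⟩
  · rw [Set.union_union_union_comm, h.union, hs.union, Set.sdiff_union_of_subset hΓH]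
  · simp only [Set.disjoint_union_left, Set.disjoint_union_right]
    exact ⟨⟨h.disj, Set.disjoint_left.2 fun v hv hvB => hB v hvB (hA' hv)⟩,
      Set.disjoint_left.2 fun v hv hvB => hA v hv (hB' hvB), hs.disj⟩
  · rintro u (hu | hu) huE v (hv | hv) hvE huv <;> simp only [Set.mem_union, not_or] at huE hvE
    · exact h.cross u hu huE.1 v hv hvE.1 huv
    · exact hvE.2 (hs.right ⟨⟨v, rfl, u, hu, huv.symm⟩, hv⟩)
    · exact huE.2 (hs.left ⟨⟨u, rfl, v, hv, huv⟩, hu⟩)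
    · exact hs.cross u hu huE.2 v hv hvE.2 huv
  · rintro v (hv | hv)
    · obtain ⟨C, hC, hCA, hvC, h'⟩ := h.conn_left v hv
      exact ⟨C, hC, hCA.trans Set.subset_union_left, hvC, h'⟩
    · obtain ⟨C, hC, hCA, hvC, w, hwC, w', rfl, a, ha, hwa⟩ := hs.conn_left v hv
      obtain ⟨D, hD, hDA, haD, h1, h2⟩ := h.conn_left a ha
      exact ⟨C ∪ D, hC.union_adj hD ⟨w', hwC, a, haD, hwa⟩, Set.union_subset
        (hCA.trans Set.subset_union_right) (hDA.trans Set.subset_union_left), Or.inl hvC,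
        h1.mono Set.subset_union_right le_rfl, h2.mono Set.subset_union_right le_rfl⟩
  · rintro v (hv | hv)
    · obtain ⟨C, hC, hCA, hvC, h'⟩ := h.conn_right v hv
      exact ⟨C, hC, hCA.trans Set.subset_union_left, hvC, h'⟩
    · obtain ⟨C, hC, hCA, hvC, w, hwC, w', rfl, a, ha, hwa⟩ := hs.conn_right v hv
      obtain ⟨D, hD, hDA, haD, h1, h2⟩ := h.conn_right a ha
      exact ⟨C ∪ D, hC.union_adj hD ⟨w', hwC, a, haD, hwa⟩, Set.union_subset
        (hCA.trans Set.subset_union_right) (hDA.trans Set.subset_union_left), Or.inl hvC,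
        h1.mono Set.subset_union_right le_rfl, h2.mono Set.subset_union_right le_rfl⟩

theorem GoodPart.extend_of_not_adj (h : GoodPart G T U (H \ Γ) A B E) (hΓH : Γ ⊆ H)
    (hΓ : ConnSet G Γ) (hno : ¬ AdjSet G Γ (H \ Γ)) (hT : AdjSet G Γ T)
    (hU : ∃ t, AdjSet G Γ (U t)) :
    ∃ A' ⊇ A, ∃ B' ⊇ B, GoodPart G T U H A' B' E := by
  have hA : A ⊆ H \ Γ := h.union ▸ Set.subset_union_left
  have hB : B ⊆ H \ Γ := h.union ▸ Set.subset_union_right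
  have hu : A ∪ B ∪ Γ = H := by rw [h.union, Set.sdiff_union_of_subset hΓH]
  obtain ⟨_ | _, ht⟩ := hU
  · refine ⟨A ∪ Γ, Set.subset_union_left, B, le_rfl, ?_, ?_, ?_, ?_, h.conn_right⟩
    · rw [← hu, Set.union_right_comm]
    · exact Set.disjoint_union_left.2 ⟨h.disj, Set.disjoint_left.2 fun v hv hvB => (hB hvB).2 hv⟩
    · rintro u (hu | hu) huE v hv hvE huv
      · exact h.cross u hu huE v hv hvE huv
      · exact hno ⟨u, hu, v, hB hv, huv⟩
    · rintro v (hv | hv)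
      · obtain ⟨C, hC, hCA, hvC, h'⟩ := h.conn_left v hv
        exact ⟨C, hC, hCA.trans Set.subset_union_left, hvC, h'⟩
      · exact ⟨Γ, hΓ, Set.subset_union_right, hv, hT, ht⟩
  · refine ⟨A, le_rfl, B ∪ Γ, Set.subset_union_left, ?_, ?_, ?_, h.conn_left, ?_⟩
    · rw [← hu, Set.union_assoc]
    · exact Set.disjoint_union_right.2 ⟨h.disj, Set.disjoint_left.2 fun v hv hvB => (hA hv).2 hvB⟩
    · rintro u hu huE v (hv | hv) hvE huv
      · exact h.cross u hu huE v hv hvE huv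
      · exact hno ⟨v, hv, u, hA hu, huv.symm⟩
    · rintro v (hv | hv)
      · obtain ⟨C, hC, hCA, hvC, h'⟩ := h.conn_right v hv
        exact ⟨C, hC, hCA.trans Set.subset_union_left, hvC, h'⟩
      · exact ⟨Γ, hΓ, Set.subset_union_right, hv, hT, ht⟩

/-- `Layered G T U S H t`: the set `H` arises from `S` by removing `t` tight connected sets, one
after the other, each attached to `T` or to the sets removed before it. -/
inductive Layered (G : SimpleGraph V) (T : Set V) (U : Bool → Set V) (S : Set V) :
    Set V → ℕ → Prop
  | base : Layered G T U S S 0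
  | step {H Γ : Set V} {t : ℕ} {x y : V} (h : Layered G T U S H t) (hΓH : Γ ⊆ H)
      (hΓ : ConnSet G Γ) (hx : x ∈ Γ) (hy : y ∈ Γ)
      (ht : TightFor G Γ {v | AdjSet G {v} (H \ Γ)} x y) (hxK : AdjSet G {x} (T ∪ S \ H))
      (hyK : AdjSet G {y} (T ∪ S \ H ∪ U false ∪ U true))
      (hadj : AdjSet G Γ (H \ Γ) ∨ AdjSet G Γ T ∧ ∃ i, AdjSet G Γ (U i)) :
      Layered G T U S (H \ Γ) (t + 1)

variable {S : Set V} {t : ℕ}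

theorem Layered.subset (h : Layered G T U S H t) : H ⊆ S := by
  induction h with
  | base => exact le_rfl
  | step _ _ _ _ _ _ _ _ _ ih => exact Set.sdiff_subset.trans ih

theorem sdiff_sdiff_eq_union (hΓH : Γ ⊆ H) (hHS : H ⊆ S) : S \ (H \ Γ) = S \ H ∪ Γ := by
  rw [Set.sdiff_sdiff_right, Set.inter_eq_right.2 (hΓH.trans hHS)]

theorem Layered.conn (h : Layered G T U S H t) (hT : ConnSet G T) : ConnSet G (T ∪ S \ H) := by
  induction h with
  | base => simpa using hT
  | step h hΓH hΓ hx _ _ hxK _ _ ih =>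
    rw [sdiff_sdiff_eq_union hΓH h.subset, ← Set.union_assoc]
    exact ih.union_adj hΓ (hxK.symm.mono le_rfl (by simpa using hx))

variable {N m : ℕ} {P : Bool × Fin N → Set V} {xs ys : Bool × Fin N → V}

theorem Layered.extend [Finite V] (hF : StrandFrame G N m T U S P xs ys) (hr : 2 ≤ r)
    (h : Layered G T U S H t) (hg : GoodPart G T U H A B E) :
    IsMinor (doubleWheel r) G ∨ ∃ A' ⊇ A, ∃ B' ⊇ B, ∃ E', GoodPart G T U S A' B' E' ∧
      E'.ncard ≤ E.ncard + t * (3 * r - 1) := by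
  induction h generalizing A B E with
  | base => exact Or.inr ⟨A, le_rfl, B, le_rfl, E, hg, by omega⟩
  | @step H Γ t x y h hΓH hΓ hx hy ht hxK hyK hadj ih =>
    suffices hstep : IsMinor (doubleWheel r) G ∨ ∃ A' ⊇ A, ∃ B' ⊇ B, ∃ E',
        GoodPart G T U H A' B' E' ∧ E'.ncard ≤ E.ncard + (3 * r - 1) by
      rcases hstep with hm | ⟨A', hA', B', hB', E', hg', hE'⟩
      · exact Or.inl hm
      rcases ih hg' with hm | ⟨A'', hA'', B'', hB'', E'', hg'', hE''⟩
      · exact Or.inl hm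
      · exact Or.inr ⟨A'', hA'.trans hA'', B'', hB'.trans hB'', E'', hg'', by
          rw [Nat.add_mul]
          omega⟩
    have hsets : {v | AdjSet G {v} (H \ Γ)} = {v | AdjSet G {v} A} ∪ {v | AdjSet G {v} B} := by
      ext v
      rw [← hg.union]
      exact ⟨fun h => h.union_or, fun h => h.elim
        (fun h => h.mono le_rfl Set.subset_union_left)
        (fun h => h.mono le_rfl Set.subset_union_right)⟩
    by_cases hcol : AdjSet G Γ (H \ Γ)
    swap
    · obtain ⟨hT, hU⟩ := hadj.resolve_left hcol
      obtain ⟨A', hA', B', hB', hg'⟩ := hg.extend_of_not_adj hΓH hΓ hcol hT hU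
      exact Or.inr ⟨A', hA', B', hB', E, hg', by omega⟩
    rw [hsets] at ht
    have hcol' : (Γ ∩ ({v | AdjSet G {v} A} ∪ {v | AdjSet G {v} B})).Nonempty := by
      obtain ⟨v, hv, w, hw, hvw⟩ := hcol
      exact ⟨v, hv, hsets ▸ ⟨v, rfl, w, hw, hvw⟩⟩
    rcases setChain_or_colorSplit (R := 3 * r) (by omega) hΓ hx hy ht hcol' with
      ⟨W, Hd, L, hch, hWΓ, hxH, hyL⟩ | ⟨A', B', E', hs, hE'⟩
    · left
      have hHS := h.subset
      have hKH : Disjoint (T ∪ S \ H) H :=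
        Set.disjoint_union_left.2 ⟨hF.disjTH.mono_right hHS, Set.disjoint_sdiff_left⟩
      have hWH : W ⊆ H := hWΓ.trans hΓH
      have hABH : A ∪ B ⊆ H := hg.union ▸ Set.sdiff_subset
      refine doubleWheel_minor_of_chain (K := T ∪ S \ H) (U := U) (A := A) (B := B) hr
        (h.conn hF.connT) hF.connU (fun t => (hF.adjTU t).mono Set.subset_union_left le_rfl)
        hF.disjU ?_ hg.disj (hKH.mono_right hABH) (fun t => (hF.disjUH t).mono_right
        (hABH.trans hHS)) ?_ (hKH.mono_right hWH).symm
        (fun t => ((hF.disjUH t).mono_right (hWH.trans hHS)).symm) ?_ ?_ (hch.imp ?_)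
        (hxK.mono (by simpa using hxH) le_rfl) (hyK.mono (by simpa using hyL) le_rfl)
      · exact fun t => Set.disjoint_union_left.2 ⟨hF.disjTU t,
          (hF.disjUH t).symm.mono_left Set.sdiff_subset⟩
      · rw [hg.union]
        exact Set.disjoint_sdiff_right.mono_left hWΓ
      · intro v hv
        obtain ⟨C, h1, h2, h3, h4, h5⟩ := hg.conn_left v hv
        exact ⟨C, h1, h2, h3, h4.mono le_rfl Set.subset_union_left, h5⟩
      · intro v hv
        obtain ⟨C, h1, h2, h3, h4, h5⟩ := hg.conn_right v hv
        exact ⟨C, h1, h2, h3, h4.mono le_rfl Set.subset_union_left, h5⟩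
      · rintro C - ⟨⟨u, hu, hua⟩, v, hv, hvb⟩
        exact ⟨AdjSet.mono hua (by simpa using hu) le_rfl,
          AdjSet.mono hvb (by simpa using hv) le_rfl⟩
    · right
      exact ⟨_, Set.subset_union_left, _, Set.subset_union_left, _,
        hg.extend_of_colorSplit hΓH hs, (Set.ncard_union_le _ _).trans (by omega)⟩

end

section

variable {V : Type*} {G : SimpleGraph V} {N m : ℕ} {T S H : Set V} {U : Bool → Set V}
  {P : Bool × Fin N → Set V} {xs ys : Bool × Fin N → V} {t n r : ℕ}

/-- Every component of `H` contains a strand. -/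
def StrandReach (G : SimpleGraph V) (P : Bool × Fin N → Set V) (H : Set V) : Prop :=
  ∀ v ∈ H, ∃ C, ConnSet G C ∧ C ⊆ H ∧ v ∈ C ∧ ∃ a, P a ⊆ H ∧ (C ∩ P a).Nonempty

theorem Layered.remove_bag [Finite V] (hF : StrandFrame G N m T U S P xs ys)
    (h : Layered G T U S H t) (hreach : StrandReach G P H) {b : Bool × Fin N} (hb : P b ⊆ H)
    {C : Set V} {z : V} (hC : ConnSet G C) (hCH : C ⊆ H) (hz : z ∈ C) (hbC : P b ⊆ C)
    (hCd : ∀ a, P a ⊆ H → a ≠ b → Disjoint C (P a)) (hzK : AdjSet G {z} (T ∪ S \ H)) :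
    ∃ X ⊆ H, ∃ t' ≤ t + 2, ConnSet G X ∧ z ∈ X ∧ xs b ∈ X ∧ AdjSet G X T ∧ AdjSet G X (U b.1) ∧
      Layered G T U S (H \ X) t' ∧ StrandReach G P (H \ X) ∧
      ∀ a, P a ⊆ H → a ≠ b → P a ⊆ H \ X := by
  set F : Set V := {v | ∃ a, P a ⊆ H ∧ a ≠ b ∧ v ∈ P a} with hFdef
  have hFH : F ⊆ H := fun v ⟨a, ha, _, hv⟩ => ha hv
  have hCF : ∀ v ∈ C, v ∉ F := fun v hv ⟨a, ha, hab, hva⟩ =>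
    Set.disjoint_left.1 (hCd a ha hab) hv hva
  have hreachF : ∀ X ⊆ H, (∀ v ∈ X, v ∉ F) →
      (∀ v ∈ H \ X, ∃ C, ConnSet G C ∧ C ⊆ H \ X ∧ v ∈ C ∧ (C ∩ F).Nonempty) →
      StrandReach G P (H \ X) ∧ ∀ a, P a ⊆ H → a ≠ b → P a ⊆ H \ X := by
    intro X hX hXF hXr
    have hP : ∀ a, P a ⊆ H → a ≠ b → P a ⊆ H \ X := fun a ha hab v hv =>
      ⟨ha hv, fun hvX => hXF v hvX ⟨a, ha, hab, hv⟩⟩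
    refine ⟨fun v hv => ?_, hP⟩
    obtain ⟨C, hC, hCX, hvC, w, hwC, a, ha, hab, hwa⟩ := hXr v hv
    exact ⟨C, hC, hCX, hvC, a, hP a ha hab, w, hwC, hwa⟩
  obtain ⟨Γ, hΓH, hΓ, hxΓ, hyΓ, htΓ, hrΓ⟩ := exists_tightFor hFH (hF.connP b)
    (fun v hv => ⟨hb hv, hCF v (hbC hv)⟩) (hF.memx b) (hF.memy b) (by
      intro v hv
      obtain ⟨C, hC, hCH, hvC, a, ha, w, hwC, hwa⟩ := hreach v hv
      refine ⟨C, hC, hCH, hvC, w, hwC, ?_⟩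
      by_cases hab : a = b
      · exact Or.inr (hab ▸ hwa)
      · exact Or.inl ⟨a, ha, hab, hwa⟩)
  have hΓH' : Γ ⊆ H := fun v hv => (hΓH hv).1
  have hΓT : AdjSet G Γ T := (hF.adjx b).mono (by simpa using hxΓ) le_rfl
  have hΓU : AdjSet G Γ (U b.1) := (hF.adjy b).mono (by simpa using hyΓ) le_rfl
  have hL := h.step hΓH' hΓ hxΓ hyΓ htΓ ((hF.adjx b).mono le_rfl Set.subset_union_left)
    ((hF.adjy b).mono le_rfl (by
      rcases b.1 with _ | _
      · exact Set.subset_union_right.trans Set.subset_union_left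
      · exact Set.subset_union_right)) (Or.inr ⟨hΓT, b.1, hΓU⟩)
  have hrF := hreachF Γ hΓH' (fun v hv => (hΓH hv).2) hrΓ
  by_cases hzΓ : z ∈ Γ
  · exact ⟨Γ, hΓH', t + 1, by omega, hΓ, hzΓ, hxΓ, hΓT, hΓU, hL, hrF.1, hrF.2⟩
  obtain ⟨D, hDC, hD, hzD, d, hd, a, ⟨haC, haΓ⟩, hda⟩ :=
    hC.exists_to hz hzΓ ⟨xs b, hbC (hF.memx b), hxΓ⟩
  obtain ⟨Δ, hΔH, hΔ, hzΔ, hdΔ, htΔ, hrΔ⟩ := exists_tightFor (H := H \ Γ) (F := F)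
    (fun v hv => ⟨hFH hv, fun hvΓ => (hΓH hvΓ).2 hv⟩) hD
    (fun v hv => ⟨⟨hCH (hDC hv).1, (hDC hv).2⟩, hCF v (hDC hv).1⟩) hzD hd (by
      intro v hv
      obtain ⟨C, hC, hCH, hvC, hCF⟩ := hrΓ v hv
      exact ⟨C, hC, hCH, hvC, hCF.mono (Set.inter_subset_inter_right _ Set.subset_union_left)⟩)
  have hΔH' : Δ ⊆ H \ Γ := fun v hv => (hΔH hv).1
  have hSH : S \ (H \ Γ) = S \ H ∪ Γ := sdiff_sdiff_eq_union hΓH' h.subset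
  have hL' := hL.step hΔH' hΔ hzΔ hdΔ htΔ
    (hzK.mono le_rfl (by rw [hSH, ← Set.union_assoc]; exact Set.subset_union_left))
    ⟨d, rfl, a, by rw [hSH]; exact Or.inl (Or.inl (Or.inr (Or.inr haΓ))), hda⟩ (Or.inl (by
      obtain ⟨C, hC, hCH, hzC, f, hfC, hfF⟩ := hrΓ z (hΔH' hzΔ)
      obtain ⟨u, huC, hu, w, hwC, hw, huw⟩ := hC.exit ⟨z, hzC, hzΔ⟩
        ⟨f, hfC, fun hf => (hΔH hf).2 hfF⟩
      exact ⟨u, hu, w, ⟨hCH hwC, hw⟩, huw⟩))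
  rw [Set.sdiff_sdiff] at hL' hrΔ
  have hX : Γ ∪ Δ ⊆ H := Set.union_subset hΓH' (hΔH'.trans Set.sdiff_subset)
  have hrF' := hreachF (Γ ∪ Δ) hX (by
    rintro v (hv | hv)
    · exact (hΓH hv).2
    · exact (hΔH hv).2) hrΔ
  exact ⟨Γ ∪ Δ, hX, t + 2, le_rfl, hΓ.union_adj hΔ ⟨a, haΓ, d, hdΔ, hda.symm⟩, Or.inr hzΔ,
    Or.inl hxΓ, hΓT.mono Set.subset_union_left le_rfl, hΓU.mono Set.subset_union_left le_rfl, hL',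
    hrF'.1, hrF'.2⟩

/-- The state after the removal of `n` bags, which form a chain. -/
structure BagState (G : SimpleGraph V) (T : Set V) (U : Bool → Set V) (S : Set V)
    (P : Bool × Fin N → Set V) (n : ℕ) (H W F L : Set V) (t : ℕ) : Prop where
  layered : Layered G T U S H t
  reach : StrandReach G P H
  count : 2 * N ≤ {a | P a ⊆ H}.ncard + (n + 1)
  bound : t ≤ 2 * n + 2
  chain : SetChain G (fun C => AdjSet G C T ∧ ∃ i, AdjSet G C (U i)) n W F L
  sub : W ⊆ S \ H
  last : ∀ i, AdjSet G L (U i)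
  big : ∀ v ∈ H, N < {a | P a ⊆ comp G H v}.ncard → AdjSet G (comp G H v) F

theorem count_le_succ [Finite V] {H X : Set V} {b : Bool × Fin N}
    (h : ∀ a, P a ⊆ H → a ≠ b → P a ⊆ H \ X) :
    {a | P a ⊆ H}.ncard ≤ {a | P a ⊆ H \ X}.ncard + 1 :=
  (Set.ncard_le_ncard (t := insert b {a | P a ⊆ H \ X}) (fun a ha => by
    by_cases hab : a = b
    · exact Or.inl hab
    · exact Or.inr (h a ha hab)) (Set.toFinite _)).trans (Set.ncard_insert_le _ _)

/-- Two disjoint sets cannot both contain more than half of the strands. -/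
theorem StrandFrame.big_inter [Finite V] (hF : StrandFrame G N m T U S P xs ys) {Q Q' : Set V}
    (hQ : N < {a | P a ⊆ Q}.ncard) (hQ' : N < {a | P a ⊆ Q'}.ncard) : (Q ∩ Q').Nonempty := by
  by_contra hcon
  have hd : Disjoint {a | P a ⊆ Q} {a | P a ⊆ Q'} := Set.disjoint_left.2 fun a ha ha' =>
    hcon ⟨xs a, ha (hF.memx a), ha' (hF.memx a)⟩
  have h1 := Set.ncard_union_eq hd
  have h2 := Set.ncard_le_card ({a | P a ⊆ Q} ∪ {a | P a ⊆ Q'})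
  simp at h2
  omega

theorem exists_strand_of_type {Q : Set V} (hQ : N < {a | P a ⊆ Q}.ncard) (i : Bool) :
    ∃ j, P (i, j) ⊆ Q := by
  by_contra hcon
  push Not at hcon
  have hsub : {a | P a ⊆ Q} ⊆ (fun j => (!i, j)) '' (Set.univ : Set (Fin N)) := by
    rintro ⟨i', j⟩ ha
    have : i' ≠ i := by
      rintro rfl
      exact hcon j ha
    exact ⟨j, trivial, by cases i <;> cases i' <;> simp_all⟩
  have h1 := Set.ncard_le_ncard hsub (Set.toFinite _)
  have h2 := Set.ncard_image_le (f := fun j => (!i, j)) (Set.toFinite (Set.univ : Set (Fin N)))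
  rw [Set.ncard_univ, Nat.card_eq_fintype_card, Fintype.card_fin] at h2
  omega

/-- A connected set that meets some of a family of disjoint connected sets can be changed into one
that contains exactly one of them and misses the others. -/
theorem ConnSet.exists_only {ι : Type*} {P : ι → Set V} {I : Set ι} {C : Set V} {u : V}
    (hC : ConnSet G C) (hP : ∀ a, ConnSet G (P a)) (hd : Pairwise fun a b => Disjoint (P a) (P b))
    (hu : u ∈ C) (hm : ∃ a ∈ I, (C ∩ P a).Nonempty) :
    ∃ b ∈ I, ∃ D, ConnSet G D ∧ u ∈ D ∧ D ⊆ C ∪ P b ∧ P b ⊆ D ∧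
      ∀ a ∈ I, a ≠ b → Disjoint D (P a) := by
  by_cases huF : u ∈ ⋃ a ∈ I, P a
  · simp only [Set.mem_iUnion] at huF
    obtain ⟨b, hb, hub⟩ := huF
    exact ⟨b, hb, P b, hP b, hub, Set.subset_union_right, le_rfl, fun a _ hab => hd hab.symm⟩
  · obtain ⟨a, ha, w, hwC, hwa⟩ := hm
    obtain ⟨D, hDC, hD, huD, d, hdD, e, ⟨heC, heF⟩, hde⟩ := hC.exists_to hu huF
      ⟨w, hwC, Set.mem_biUnion ha hwa⟩
    simp only [Set.mem_iUnion] at heF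
    obtain ⟨b, hb, heb⟩ := heF
    refine ⟨b, hb, D ∪ P b, hD.union_adj (hP b) ⟨d, hdD, e, heb, hde⟩, Or.inl huD,
      Set.union_subset_union_left _ (hDC.trans Set.sdiff_subset), Set.subset_union_right,
      fun a ha hab => Set.disjoint_union_left.2 ⟨?_, hd hab.symm⟩⟩
    exact Set.disjoint_left.2 fun v hv hva => (hDC hv).2 (Set.mem_biUnion ha hva)

theorem StrandFrame.exists_connSet_pair (hF : StrandFrame G N m T U S P xs ys) (hN : 0 < N) :
    ∃ i j, ∃ C, ConnSet G C ∧ C ⊆ S ∧ P (false, i) ⊆ C ∧ P (true, j) ⊆ C ∧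
      ∀ a, a ≠ (false, i) → a ≠ (true, j) → Disjoint C (P a) := by
  set R : Set V := {v | ∃ C, ConnSet G C ∧ C ⊆ S ∧ (∀ j, Disjoint C (P (true, j))) ∧ v ∈ C ∧
    ∃ i, (C ∩ P (false, i)).Nonempty} with hR
  have hne : ∀ i j, (false, i) ≠ ((true, j) : Bool × Fin N) := by simp
  obtain ⟨u, huS, ⟨C, hC, hCS, hCd, huC, i₀, hi₀⟩, w, hwS, hwR, huw⟩ := hF.connH.exit (T := R)
    ⟨xs (false, ⟨0, hN⟩), hF.subP _ (hF.memx _), P (false, ⟨0, hN⟩), hF.connP _, hF.subP _,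
      fun j => hF.disjP (hne _ _), hF.memx _, _, _, hF.memx _, hF.memx _⟩
    ⟨xs (true, ⟨0, hN⟩), hF.subP _ (hF.memx _), fun ⟨C, _, _, hCd, hv, _⟩ =>
      Set.disjoint_left.1 (hCd _) hv (hF.memx _)⟩
  obtain ⟨j, hwj⟩ : ∃ j, w ∈ P (true, j) := by
    by_contra hcon
    push Not at hcon
    refine hwR ⟨insert w C, hC.insert_adj huC huw.symm, Set.insert_subset hwS hCS, fun j => ?_,
      Or.inl rfl, i₀, hi₀.mono (Set.inter_subset_inter_left _ (Set.subset_insert _ _))⟩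
    exact Set.disjoint_insert_left.2 ⟨hcon j, hCd j⟩
  obtain ⟨⟨_, i⟩, ⟨i', hi'⟩, D, hD, huD, hDC, hiD, hDd⟩ := hC.exists_only (I := {a | a.1 = false})
    hF.connP hF.disjP huC ⟨_, rfl, hi₀⟩
  refine ⟨i, j, D ∪ P (true, j), hD.union_adj (hF.connP _) ⟨u, huD, w, hwj, huw⟩,
    Set.union_subset (hDC.trans (Set.union_subset hCS (hF.subP _))) (hF.subP _),
    hiD.trans Set.subset_union_left, Set.subset_union_right, ?_⟩
  rintro ⟨_ | _, l⟩ h1 h2 <;> refine Set.disjoint_union_left.2 ⟨?_, hF.disjP h2.symm⟩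
  · exact hDd _ rfl h1
  · exact (Set.disjoint_union_left.2 ⟨hCd l, hF.disjP h1.symm⟩).mono_left hDC

theorem StrandFrame.exists_bagState_one [Finite V] (hF : StrandFrame G N m T U S P xs ys)
    (hN : 0 < N) : ∃ H W F L t, BagState G T U S P 1 H W F L t := by
  obtain ⟨i, j, C, hC, hCS, hiC, hjC, hCd⟩ := hF.exists_connSet_pair hN
  have hne : ((true, j) : Bool × Fin N) ≠ (false, i) := by simp
  obtain ⟨X, hXS, t, ht, hX, hiX, -, hXT, hXU, hL, hr, hP⟩ := Layered.base.remove_bag hF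
    (fun v hv => ⟨S, hF.connH, le_rfl, hv, (false, i), hF.subP _, _, hF.subP _ (hF.memx _),
      hF.memx _⟩) (b := (false, i)) (z := xs (false, i)) (hF.subP _) (hF.connP _) (hF.subP _)
    (hF.memx _) le_rfl (fun a _ ha => hF.disjP ha.symm)
    ((hF.adjx _).mono le_rfl Set.subset_union_left)
  have hjX := hP (true, j) (hF.subP _) hne
  obtain ⟨D, hDC, hD, hjD, d, hd, e, ⟨heC, heX⟩, hde⟩ := hC.exists_to (A := X)
    (hjC (hF.memx _)) (hjX (hF.memx _)).2 ⟨_, hiC (hF.memx _), hiX⟩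
  have hSX : S \ (S \ X) = X := by rw [Set.sdiff_sdiff_right]; simpa using hXS
  have hDX : D ∪ P (true, j) ⊆ C \ X :=
    Set.union_subset hDC fun v hv => ⟨hjC hv, (hjX hv).2⟩
  obtain ⟨Y, hYS, t', ht', hY, hdY, -, hYT, hYU, hL', hr', hP'⟩ := hL.remove_bag hF hr
    (b := (true, j)) (C := D ∪ P (true, j)) (z := d) hjX
    (hD.union (hF.connP _) ⟨_, hjD, hF.memx _⟩) (hDX.trans (Set.sdiff_subset_sdiff_left hCS))
    (Or.inl hd) Set.subset_union_right (fun a ha haj => (hCd a (by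
      rintro rfl
      exact (ha (hF.memx _)).2 hiX) haj).mono_left (hDX.trans Set.sdiff_subset))
    ⟨d, rfl, e, Or.inr (by rwa [hSX]), hde⟩
  have hXY : ConnSet G (X ∪ Y) := hX.union_adj hY ⟨e, heX, d, hdY, hde.symm⟩
  have hXYU : ∀ i, AdjSet G (X ∪ Y) (U i) := by
    rintro (_ | _)
    · exact hXU.mono Set.subset_union_left le_rfl
    · exact hYU.mono Set.subset_union_right le_rfl
  have hXYS : X ∪ Y ⊆ S := Set.union_subset hXS (hYS.trans Set.sdiff_subset)
  refine ⟨(S \ X) \ Y, X ∪ Y, X ∪ Y, X ∪ Y, t', hL', hr', ?_, by omega,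
    SetChain.single _ hXY ⟨hXT.mono Set.subset_union_left le_rfl, false, hXYU _⟩, ?_, hXYU, ?_⟩
  · have h1 := count_le_succ hP
    have h2 := count_le_succ hP'
    have h3 : {a | P a ⊆ S} = Set.univ := Set.eq_univ_of_forall hF.subP
    rw [h3, Set.ncard_univ] at h1
    simp at h1
    omega
  · rw [Set.sdiff_sdiff, Set.sdiff_sdiff_right]
    simpa using hXYS
  · intro v hv _
    rw [Set.sdiff_sdiff] at hv ⊢
    exact hF.connH.comp_adj hXYS hXY.1 hv

theorem BagState.succ [Finite V] {W F L : Set V} {v : V} (hF : StrandFrame G N m T U S P xs ys)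
    (h : BagState G T U S P n H W F L t) (hv : v ∈ H) (hbig : N < {a | P a ⊆ comp G H v}.ncard) :
    ∃ H' W' F' L' t', BagState G T U S P (n + 1) H' W' F' L' t' := by
  obtain ⟨z, hz, f, hf, hzf⟩ := h.big v hv hbig
  obtain ⟨j, hj⟩ := exists_strand_of_type hbig false
  have hQH : comp G H v ⊆ H := comp_subset
  obtain ⟨b, hb, C, hC, hzC, hCQ, hbC, hCd⟩ := (comp_conn hv).exists_only (I := {a | P a ⊆ H})
    hF.connP hF.disjP hz ⟨(false, j), hj.trans hQH, _, hj (hF.memx _), hF.memx _⟩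
  have hfW := h.chain.subset.1 hf
  obtain ⟨X, hXH, t', ht', hX, hzX, -, hXT, hXU, hL, hr, hP⟩ := h.layered.remove_bag hF h.reach hb
    hC (hCQ.trans (Set.union_subset hQH hb)) hzC hbC hCd ⟨z, rfl, f, Or.inr (h.sub hfW), hzf⟩
  have hXQ : X ⊆ comp G H v := comp_max hX hXH ⟨z, hzX, hz⟩
  have hHS := h.layered.subset
  refine ⟨H \ X, X ∪ W, X, L, t', hL, hr, ?_, ?_, ?_, ?_, h.last, ?_⟩
  · have h1 := count_le_succ hP
    have h2 := h.count
    omega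
  · have := h.bound
    omega
  · exact SetChain.cons X hX ⟨hXT, _, hXU⟩
      (Set.disjoint_left.2 fun v hv hvW => (h.sub hvW).2 (hXH hv)) ⟨z, hzX, f, hf, hzf⟩ h.chain
  · rw [sdiff_sdiff_eq_union hXH hHS, Set.union_comm]
    exact Set.union_subset_union_left _ h.sub
  · intro u hu hubig
    have hsub : comp G (H \ X) u ⊆ comp G H u := comp_mono Set.sdiff_subset u
    have hubig' : N < {a | P a ⊆ comp G H u}.ncard :=
      hubig.trans_le (Set.ncard_le_ncard (fun a ha => Set.Subset.trans ha hsub) (Set.toFinite _))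
    obtain ⟨w, hw, hw'⟩ := hF.big_inter hbig hubig'
    have huv : comp G H u = comp G H v := by rw [← comp_eq hw, comp_eq hw']
    have huQ : u ∈ comp G H v := huv ▸ mem_comp_self hu.1
    have hcomp : comp G (H \ X) u = comp G (comp G H v \ X) u := by
      refine subset_antisymm ?_ (comp_mono (Set.sdiff_subset_sdiff_left hQH) u)
      refine subset_comp (comp_conn hu) (fun w hw => ⟨huv ▸ hsub hw, (comp_subset hw).2⟩)
        (mem_comp_self hu)
    rw [hcomp]
    exact (comp_conn hv).comp_adj hXQ hX.1 ⟨huQ, hu.2⟩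

end

section

variable {V : Type*} {G : SimpleGraph V} {N m : ℕ} {T S H W F L : Set V} {U : Bool → Set V}
  {P : Bool × Fin N → Set V} {xs ys : Bool × Fin N → V} {t n r k : ℕ} {β : Set V → Set V}

theorem StrandFrame.exists_bagState [Finite V] (hF : StrandFrame G N m T U S P xs ys)
    (hN : 0 < N) (n : ℕ) :
    (∃ l ≤ n + 1, ∃ H W F L t, BagState G T U S P l H W F L t ∧
      ∀ v ∈ H, {a | P a ⊆ comp G H v}.ncard ≤ N) ∨
    ∃ H W F L t, BagState G T U S P (n + 1) H W F L t ∧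
      ∃ v ∈ H, N < {a | P a ⊆ comp G H v}.ncard := by
  have hdich : ∀ {l H W F L t}, l ≤ n + 1 → BagState G T U S P l H W F L t →
      (∃ l ≤ n + 1, ∃ H W F L t, BagState G T U S P l H W F L t ∧
        ∀ v ∈ H, {a | P a ⊆ comp G H v}.ncard ≤ N) ∨
      ∃ H W F L t, BagState G T U S P l H W F L t ∧
        ∃ v ∈ H, N < {a | P a ⊆ comp G H v}.ncard := by
    intro l H W F L t hl h
    by_cases hbig : ∃ v ∈ H, N < {a | P a ⊆ comp G H v}.ncard
    · exact Or.inr ⟨H, W, F, L, t, h, hbig⟩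
    · push Not at hbig
      exact Or.inl ⟨l, hl, H, W, F, L, t, h, hbig⟩
  have key : ∀ l ≤ n, (∃ l ≤ n + 1, ∃ H W F L t, BagState G T U S P l H W F L t ∧
      ∀ v ∈ H, {a | P a ⊆ comp G H v}.ncard ≤ N) ∨
      ∃ H W F L t, BagState G T U S P (l + 1) H W F L t ∧
        ∃ v ∈ H, N < {a | P a ⊆ comp G H v}.ncard := by
    intro l
    induction l with
    | zero =>
      intro _
      obtain ⟨H, W, F, L, t, h⟩ := hF.exists_bagState_one hN
      exact hdich (by omega) h
    | succ l ih =>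
      intro hl
      rcases ih (by omega) with h | ⟨H, W, F, L, t, h, v, hv, hbig⟩
      · exact Or.inl h
      · obtain ⟨H', W', F', L', t', h'⟩ := h.succ hF hv hbig
        exact hdich (by omega) h'
  exact key n le_rfl

theorem BagState.doubleWheel_minor {v : V} (hF : StrandFrame G N m T U S P xs ys) (hr : 2 ≤ r)
    (h : BagState G T U S P (2 * r - 1) H W F L t) (hv : v ∈ H)
    (hbig : N < {a | P a ⊆ comp G H v}.ncard) : IsMinor (doubleWheel r) G := by
  have hHS := h.layered.subset
  have hQH : comp G H v ⊆ H := comp_subset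
  have hWS : W ⊆ S := h.sub.trans Set.sdiff_subset
  have hFQ : AdjSet G F (comp G H v) := (h.big v hv hbig).symm
  have hmono : ∀ X Y : Set V, ∀ A B : Set V, A ⊆ B → AdjSet G A X ∧ AdjSet G A Y →
      AdjSet G B X ∧ AdjSet G B Y := fun X Y A B hAB h =>
    ⟨h.1.mono hAB le_rfl, h.2.mono hAB le_rfl⟩
  have hUd : ∀ i, Disjoint (U i) (U (!i)) := by
    rintro (_ | _)
    · exact hF.disjU
    · exact hF.disjU.symm
  obtain ⟨i, H', hH', L', hL', hch⟩ : ∃ i, ∃ H' ⊇ F, ∃ L' ⊇ L,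
      SetChain G (fun C => AdjSet G C T ∧ AdjSet G C (U i)) r W H' L' := by
    rcases h.chain.pigeonhole (p := r) (q := r) (hmono T (U false)) (hmono T (U true))
      (fun C _ hC => by
        obtain ⟨hT, _ | _, hU⟩ := hC
        · exact Or.inl ⟨hT, hU⟩
        · exact Or.inr ⟨hT, hU⟩) (by omega) (by omega) (by omega) with h' | h'
    · exact ⟨false, h'⟩
    · exact ⟨true, h'⟩
  obtain ⟨j, hj⟩ := exists_strand_of_type hbig (!i)
  have hQU : AdjSet G (comp G H v) (U (!i)) :=
    (hF.adjy (!i, j)).mono (by simpa using hj (hF.memy _)) le_rfl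
  refine hch.doubleWheel_minor (K := comp G H v ∪ U (!i)) hr hF.connT (hF.connU i)
    ((comp_conn hv).union_adj (hF.connU _) hQU) (hF.disjTU i) ?_ ?_ (hF.disjTH.symm.mono_left hWS)
    ((hF.disjUH i).symm.mono_left hWS) ?_ (hFQ.mono hH' Set.subset_union_left)
    ((h.last _).mono hL' Set.subset_union_right)
  · exact Set.disjoint_union_right.2 ⟨hF.disjTH.mono_right (hQH.trans hHS), hF.disjTU _⟩
  · exact Set.disjoint_union_right.2 ⟨(hF.disjUH i).mono_right (hQH.trans hHS), hUd i⟩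
  · exact Set.disjoint_union_right.2 ⟨Set.disjoint_left.2 fun w hw hwQ => (h.sub hw).2 (hQH hwQ),
      (hF.disjUH _).symm.mono_left hWS⟩

/-- If no component contains more than half of the strands, then the components can be divided into
two groups that contain many strands each. -/
theorem StrandFrame.exists_goodPart [Finite V] (hF : StrandFrame G N m T U S P xs ys) {k s : ℕ}
    (hreach : StrandReach G P H) (hcount : 2 * N ≤ {a | P a ⊆ H}.ncard + s)
    (hN : 2 * k + s ≤ N) (hsmall : ∀ v ∈ H, {a | P a ⊆ comp G H v}.ncard ≤ N) :
    ∃ A B, GoodPart G T U H A B ∅ ∧ k ≤ {a | P a ⊆ A}.ncard ∧ k ≤ {a | P a ⊆ B}.ncard := by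
  set cand : Set V → Prop := fun A => A ⊆ H ∧ (∀ v ∈ A, comp G H v ⊆ A) ∧
    (∀ v ∈ A, ∃ j, P (false, j) ⊆ comp G H v) ∧ (∀ v ∈ H \ A, ∃ j, P (true, j) ⊆ comp G H v) ∧
    k ≤ {a | P a ⊆ A}.ncard with hcand
  have hstrand : ∀ {a : Bool × Fin N} {v}, P a ⊆ H → (comp G H v ∩ P a).Nonempty →
      P a ⊆ comp G H v := fun haH hav => comp_max (hF.connP _) haH (by rwa [Set.inter_comm])
  have hclosed : ∀ {A : Set V}, (∀ v ∈ A, comp G H v ⊆ A) → ∀ v ∈ H \ A, comp G H v ⊆ H \ A := by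
    intro A hA v hv w hw
    exact ⟨comp_subset hw, fun hwA => hv.2 (hA w hwA (comp_symm hw))⟩
  have hmem : ∀ a : Bool × Fin N, P a ⊆ H → P a ⊆ comp G H (xs a) := fun a ha =>
    hstrand ha ⟨xs a, mem_comp_self (ha (hF.memx a)), hF.memx a⟩
  have hsplit : ∀ {A B C : Set V}, C ⊆ H → C ⊆ A ∪ B → (∀ v ∈ A, comp G H v ⊆ A) →
      (∀ v ∈ B, comp G H v ⊆ B) →
      {a | P a ⊆ C}.ncard ≤ {a | P a ⊆ A}.ncard + {a | P a ⊆ B}.ncard := by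
    intro A B C hCH hC hA hB
    refine (Set.ncard_le_ncard (fun a ha => ?_) (Set.toFinite _)).trans (Set.ncard_union_le _ _)
    rcases hC (ha (hF.memx a)) with h | h
    · exact Or.inl ((hmem a (Set.Subset.trans ha hCH)).trans (hA _ h))
    · exact Or.inr ((hmem a (Set.Subset.trans ha hCH)).trans (hB _ h))
  have hhalf : ∀ i, {a : Bool × Fin N | a.1 = i}.ncard ≤ N := by
    intro i
    have h1 : {a : Bool × Fin N | a.1 = i} = (fun j => (i, j)) '' (Set.univ : Set (Fin N)) := by
      ext ⟨i', j⟩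
      simp [eq_comm]
    rw [h1]
    exact (Set.ncard_image_le (Set.toFinite _)).trans (by simp [Set.ncard_univ])
  have hex : ∃ A, cand A := by
    refine ⟨{v ∈ H | ∃ j, P (false, j) ⊆ comp G H v}, fun v hv => hv.1, ?_, fun v hv => hv.2, ?_,
      ?_⟩
    · rintro v ⟨_, j, hj⟩ w hw
      exact ⟨comp_subset hw, j, by rwa [comp_eq hw]⟩
    · rintro v ⟨hv, hvA⟩
      obtain ⟨C, hC, hCH, hvC, ⟨_ | _, j⟩, haH, w, hwC, hw⟩ := hreach v hv
      · exact absurd ⟨hv, j, hstrand haH ⟨w, subset_comp hC hCH hvC hwC, hw⟩⟩ hvA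
      · exact ⟨j, hstrand haH ⟨w, subset_comp hC hCH hvC hwC, hw⟩⟩
    · have h1 : {a | P a ⊆ H}.ncard ≤ ({a : Bool × Fin N | a.1 = true} ∪
          {a | P a ⊆ {v ∈ H | ∃ j, P (false, j) ⊆ comp G H v}}).ncard := by
        refine Set.ncard_le_ncard (fun a ha => ?_) (Set.toFinite _)
        rcases a with ⟨_ | _, j⟩
        · refine Or.inr fun v hv => ⟨ha hv, j, ?_⟩
          exact hstrand ha ⟨v, mem_comp_self (ha hv), hv⟩
        · exact Or.inl rfl
      have h2 := Set.ncard_union_le {a : Bool × Fin N | a.1 = true}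
          {a | P a ⊆ {v ∈ H | ∃ j, P (false, j) ⊆ comp G H v}}
      have h3 := hhalf true
      omega
  obtain ⟨A, hA, hmin⟩ := exists_minimalFor_of_wellFoundedLT cand Set.ncard hex
  obtain ⟨hAH, hAc, hAf, hAt, hAk⟩ := hA
  have hBc := hclosed hAc
  refine ⟨A, H \ A, ⟨by simpa using hAH, Set.disjoint_sdiff_right, ?_, ?_, ?_⟩, hAk, ?_⟩
  · intro u hu _ v hv _ huv
    exact hv.2 (hAc u hu (comp_closed (mem_comp_self (hAH hu)) hv.1 huv))
  · intro v hv
    obtain ⟨j, hj⟩ := hAf v hv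
    exact ⟨_, comp_conn (hAH hv), hAc v hv, mem_comp_self (hAH hv),
      (hF.adjx _).mono (by simpa using hj (hF.memx _)) le_rfl,
      (hF.adjy _).mono (by simpa using hj (hF.memy _)) le_rfl⟩
  · intro v hv
    obtain ⟨j, hj⟩ := hAt v hv
    exact ⟨_, comp_conn hv.1, hBc v hv, mem_comp_self hv.1,
      (hF.adjx _).mono (by simpa using hj (hF.memx _)) le_rfl,
      (hF.adjy _).mono (by simpa using hj (hF.memy _)) le_rfl⟩
  · have h1 := hsplit (A := A) (B := H \ A) le_rfl (by simp) hAc hBc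
    by_cases hv : ∃ v ∈ A, ∃ j, P (true, j) ⊆ comp G H v
    · obtain ⟨v, hv, j, hj⟩ := hv
      have hvH := hAH hv
      have hA'c : ∀ w ∈ A \ comp G H v, comp G H w ⊆ A \ comp G H v := fun w hw u hu =>
        ⟨hAc w hw.1 hu, fun huv => hw.2 (by
          rw [← comp_eq huv]; exact comp_symm hu)⟩
      have h2 : {a | P a ⊆ A \ comp G H v}.ncard < k := by
        by_contra hcon
        have hc : cand (A \ comp G H v) := by
          refine ⟨Set.sdiff_subset.trans hAH, hA'c, fun w hw => hAf w hw.1, fun w hw => ?_,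
            not_lt.1 hcon⟩
          by_cases hwA : w ∈ A
          · have hwv : w ∈ comp G H v := by
              by_contra hwv
              exact hw.2 ⟨hwA, hwv⟩
            exact ⟨j, by rwa [comp_eq hwv]⟩
          · exact hAt w ⟨hw.1, hwA⟩
        have h3 := hmin hc (Set.ncard_le_ncard Set.sdiff_subset (Set.toFinite _))
        have h4 : (A \ comp G H v).ncard < A.ncard := Set.ncard_lt_ncard
          ⟨Set.sdiff_subset, fun h => (h hv).2 (mem_comp_self hvH)⟩ (Set.toFinite _)
        omega
      have h3 := hsplit (A := A \ comp G H v) (B := comp G H v) hAH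
        (by rw [Set.sdiff_union_self]; exact Set.subset_union_left) hA'c
        (fun w hw => (comp_eq hw).le)
      have h4 := hsmall v hvH
      omega
    · push Not at hv
      have h2 : {a | P a ⊆ A}.ncard ≤ {a : Bool × Fin N | a.1 = false}.ncard := by
        refine Set.ncard_le_ncard (fun a ha => ?_) (Set.toFinite _)
        rcases a with ⟨_ | _, j⟩
        · rfl
        · exact absurd (hmem _ (Set.Subset.trans ha hAH)) (hv _ (ha (hF.memx _)) j)
      have h3 := hhalf false
      omega

/-- A haven of large order yields a large double wheel. -/
theorem Haven.doubleWheel_minor [Finite V] (hβ : Haven G k β) (hr : 2 ≤ r)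
    (hk : 144 * r ^ 2 + 12 * r + 9 ≤ k) : IsMinor (doubleWheel r) G := by
  obtain ⟨T, U, S, P, xs, ys, hF⟩ := hβ.exists_strandFrame (N := 24 * r ^ 2 + 2 * r + 1)
    (m := 12 * r ^ 2) (by omega) (by omega)
  rcases hF.exists_bagState (by omega) (2 * r - 2) with
    ⟨l, hl, H, W, F, L, t, h, hsmall⟩ | ⟨H, W, F, L, t, h, v, hv, hbig⟩
  · obtain ⟨A, B, hg, hA, hB⟩ := hF.exists_goodPart (k := 12 * r ^ 2) (s := 2 * r)
      h.reach (by have := h.count; omega) (by omega) hsmall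
    rcases h.layered.extend hF hr hg with hm | ⟨A', hA', B', hB', E, hg', hE⟩
    · exact hm
    · have ht : t ≤ 4 * r := by
        have := h.bound
        omega
      have hEc : E.ncard < 12 * r ^ 2 := by
        obtain ⟨q, rfl⟩ : ∃ q, r = q + 1 := ⟨r - 1, by omega⟩
        have h1 : t * (3 * (q + 1) - 1) ≤ 4 * (q + 1) * (3 * (q + 1) - 1) :=
          Nat.mul_le_mul_right _ ht
        have h2 : 3 * (q + 1) - 1 = 3 * q + 2 := by omega
        rw [h2] at h1 hE
        simp only [Set.ncard_empty] at hE
        nlinarith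
      have hle : ∀ {C C' : Set V}, C ⊆ C' → {a | P a ⊆ C}.ncard ≤ {a | xs a ∈ C'}.ncard :=
        fun hC => Set.ncard_le_ncard (fun a ha => hC (ha (hF.memx a))) (Set.toFinite _)
      have h1 := hle hA'
      have h2 := hle hB'
      rcases hF.link A' B' E hg'.union hg'.cross hg'.disj hEc with h' | h' <;> omega
  · exact BagState.doubleWheel_minor hF hr (by convert h using 1; omega) hv hbig

end

section

variable {V : Type*} {G : SimpleGraph V}

/-- There is a minor model of `H` in `G` inside the set `U`. -/
def MinorIn {α : Type*} (H : SimpleGraph α) (G : SimpleGraph V) (U : Set V) : Prop :=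
  ∃ M : α → Set V, (∀ v, ConnSet G (M v) ∧ M v ⊆ U) ∧ (Pairwise fun u v => Disjoint (M u) (M v)) ∧
    ∀ u v, H.Adj u v → AdjSet G (M u) (M v)

theorem MinorIn.isMinor {α : Type*} {H : SimpleGraph α} {U : Set V} (h : MinorIn H G U) :
    IsMinor H G := by
  obtain ⟨M, hM, hd, ha⟩ := h
  exact ⟨M, fun v => (hM v).1.induce_connected, hd, ha⟩

theorem minorIn_doubleWheel {r : ℕ} {U : Set V} {R : Fin r → Set V} {A : Fin 2 → Set V}
    (hR : ∀ i, ConnSet G (R i) ∧ R i ⊆ U) (hA : ∀ i, ConnSet G (A i) ∧ A i ⊆ U)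
    (hRd : Pairwise fun i j => Disjoint (R i) (R j)) (hAd : Disjoint (A 0) (A 1))
    (hRAd : ∀ i j, Disjoint (R i) (A j)) (hRR : ∀ i j, i ≠ j → AdjSet G (R i) (R j))
    (hRA : ∀ i j, AdjSet G (R i) (A j)) : MinorIn (doubleWheel r) G U := by
  refine ⟨Sum.elim R A, ?_, ?_, ?_⟩
  · rintro (i | i)
    · exact hR i
    · exact hA i
  · rintro (i | i) (j | j) hij
    · exact hRd fun h => hij (h ▸ rfl)
    · exact hRAd i j
    · exact (hRAd j i).symm
    · fin_cases i <;> fin_cases j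
      · exact absurd rfl hij
      · exact hAd
      · exact hAd.symm
      · exact absurd rfl hij
  · rintro (i | i) (j | j) hij
    · exact hRR i j fun h => (doubleWheel r).ne_of_adj hij (h ▸ rfl)
    · exact hRA i j
    · exact (hRA j i).symm
    · simp [doubleWheel] at hij

/-- The complete graph on the vertex set `X`. -/
def cliqueOn (X : Set V) : SimpleGraph V where
  Adj a b := a ≠ b ∧ a ∈ X ∧ b ∈ X
  symm := ⟨fun _ _ h => ⟨h.1.symm, h.2.2, h.2.1⟩⟩
  loopless := ⟨fun _ h => h.1 rfl⟩

/-- A model of the complete graph in `X ∪ R` rooted at the vertices of `X`. -/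
def RootedClique (G : SimpleGraph V) (X R : Set V) : Prop :=
  ∃ B : V → Set V, (∀ x ∈ X, ConnSet G (B x) ∧ x ∈ B x ∧ B x ⊆ insert x R) ∧
    ∀ x ∈ X, ∀ y ∈ X, x ≠ y → Disjoint (B x) (B y) ∧ AdjSet G (B x) (B y)

theorem RootedClique.mono {X R R' : Set V} (h : RootedClique G X R) (hR : R ⊆ R') :
    RootedClique G X R' := by
  obtain ⟨B, h1, h2⟩ := h
  exact ⟨B, fun x hx => ⟨(h1 x hx).1, (h1 x hx).2.1, (h1 x hx).2.2.trans
    (Set.insert_subset_insert hR)⟩, h2⟩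

/-- A rooted clique model on one side of a separation allows to replace that side by a clique. -/
theorem RootedClique.minorIn {α : Type*} {H : SimpleGraph α} {X A R : Set V}
    (h : RootedClique G X R) (hAR : Disjoint A R) (hm : MinorIn H (G ⊔ cliqueOn X) A) :
    MinorIn H G (A ∪ R) := by
  obtain ⟨B, hB, hBB⟩ := h
  obtain ⟨M, hM, hMd, hMa⟩ := hm
  have hadj : ∀ {C D : Set V}, AdjSet (G ⊔ cliqueOn X) C D →
      AdjSet G (C ∪ ⋃ x ∈ C ∩ X, B x) (D ∪ ⋃ x ∈ D ∩ X, B x) := by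
    rintro C D ⟨c, hc, d, hd, hcd | ⟨hne, hcX, hdX⟩⟩
    · exact ⟨c, Or.inl hc, d, Or.inl hd, hcd⟩
    · exact (hBB c hcX d hdX hne).2.mono
        ((Set.subset_biUnion_of_mem (u := B) (show c ∈ C ∩ X from ⟨hc, hcX⟩)).trans
          Set.subset_union_right)
        ((Set.subset_biUnion_of_mem (u := B) (show d ∈ D ∩ X from ⟨hd, hdX⟩)).trans
          Set.subset_union_right)
  have hmem : ∀ {C : Set V} {v}, v ∈ C ∪ ⋃ x ∈ C ∩ X, B x →
      v ∈ C ∨ v ∈ R ∧ ∃ x ∈ C ∩ X, v ∈ B x := by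
    rintro C v (hv | hv)
    · exact Or.inl hv
    · simp only [Set.mem_iUnion] at hv
      obtain ⟨x, hx, hv⟩ := hv
      rcases (hB x hx.2).2.2 hv with rfl | hvR
      · exact Or.inl hx.1
      · exact Or.inr ⟨hvR, x, hx, hv⟩
  refine ⟨fun v => M v ∪ ⋃ x ∈ M v ∩ X, B x, fun v => ⟨⟨(hM v).1.1.mono Set.subset_union_left, ?_⟩,
    ?_⟩, ?_, fun u v huv => hadj (hMa u v huv)⟩
  · rintro T ⟨w, hw, hwT⟩ hT
    have hBT : ∀ x ∈ M v ∩ X, (∃ u ∈ B x, u ∈ T) → B x ⊆ T := fun x hx hu => by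
      have hsub := Set.subset_biUnion_of_mem (u := B) hx
      exact (hB x hx.2).1.2 T hu fun a ha haT b hb hab =>
        hT a (Or.inr (hsub ha)) haT b (Or.inr (hsub hb)) hab
    have hMT : M v ⊆ T := by
      refine (hM v).1.2 T ?_ ?_
      · rcases hmem hw with hw | ⟨-, x, hx, hwx⟩
        · exact ⟨w, hw, hwT⟩
        · exact ⟨x, hx.1, hBT x hx ⟨w, hwx, hwT⟩ (hB x hx.2).2.1⟩
      · rintro a ha haT b hb (hab | ⟨hne, haX, hbX⟩)
        · exact hT a (Or.inl ha) haT b (Or.inl hb) hab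
        · have haB := hBT a ⟨ha, haX⟩ ⟨a, (hB a haX).2.1, haT⟩
          obtain ⟨c, hc, d, hd, hcd⟩ := (hBB a haX b hbX hne).2
          have hsuba := Set.subset_biUnion_of_mem (u := B) (show a ∈ M v ∩ X from ⟨ha, haX⟩)
          have hsubb := Set.subset_biUnion_of_mem (u := B) (show b ∈ M v ∩ X from ⟨hb, hbX⟩)
          exact hBT b ⟨hb, hbX⟩ ⟨d, hd, hT c (Or.inr (hsuba hc)) (haB hc) d (Or.inr (hsubb hd))
            hcd⟩ (hB b hbX).2.1
    refine Set.union_subset hMT (Set.iUnion₂_subset fun x hx => ?_)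
    exact hBT x hx ⟨x, (hB x hx.2).2.1, hMT hx.1⟩
  · intro w hw
    exact (hmem hw).imp (fun h => (hM v).2 h) fun h => h.1
  · intro u v huv
    refine Set.disjoint_left.2 fun w hwu hwv => ?_
    rcases hmem hwu with h1 | ⟨hR, x, hx, hwx⟩ <;> rcases hmem hwv with h2 | ⟨hR', y, hy, hwy⟩
    · exact Set.disjoint_left.1 (hMd huv) h1 h2
    · exact Set.disjoint_left.1 hAR ((hM u).2 h1) hR'
    · exact Set.disjoint_left.1 hAR ((hM v).2 h2) hR
    · by_cases hxy : x = y
      · subst hxy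
        exact Set.disjoint_left.1 (hMd huv) hx.1 hy.1
      · exact Set.disjoint_left.1 (hBB x hx.2 y hy.2 hxy).1 hwx hwy

theorem rootedClique_of_ncard_le_two [Finite V] {X C : Set V} (hX : X.ncard ≤ 2)
    (hC : ConnSet G C) (hXC : Disjoint X C) (h : ∀ x ∈ X, AdjSet G {x} C) :
    RootedClique G X C := by
  classical
  rcases X.eq_empty_or_nonempty with rfl | ⟨a, ha⟩
  · exact ⟨fun _ => ∅, by simp⟩
  have hor : ∀ x ∈ X, ∀ y ∈ X, x ≠ y → x = a ∨ y = a := by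
    intro x hx y hy hxy
    by_contra! hcon
    have h3 : ({x, y, a} : Set V).ncard = 3 := Set.ncard_eq_three.2 ⟨x, y, a, hxy, hcon.1,
      hcon.2, rfl⟩
    have := Set.ncard_le_ncard (by
      rintro z (rfl | rfl | rfl) <;> assumption : ({x, y, a} : Set V) ⊆ X) (Set.toFinite _)
    omega
  have key : ∀ y ∈ X, y ≠ a → Disjoint ({a} ∪ C) {y} ∧ AdjSet G ({a} ∪ C) {y} := by
    intro y hy hya
    refine ⟨?_, (h y hy).symm.mono Set.subset_union_right le_rfl⟩
    rw [Set.disjoint_singleton_right]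
    rintro (hh | hh)
    · exact hya hh
    · exact Set.disjoint_left.1 hXC hy hh
  refine ⟨fun x => if x = a then {a} ∪ C else {x}, fun x hx => ?_, fun x hx y hy hxy => ?_⟩
  · dsimp only
    split_ifs with hxa
    · subst hxa
      exact ⟨(ConnSet.singleton _).union_adj hC (h _ hx), Or.inl rfl, le_rfl⟩
    · exact ⟨ConnSet.singleton _, rfl, by simp⟩
  · dsimp only
    rcases hor x hx y hy hxy with rfl | rfl
    · rw [if_pos rfl, if_neg hxy.symm]
      exact key y hy hxy.symm
    · rw [if_pos rfl, if_neg hxy]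
      exact ⟨(key x hx hxy).1.symm, (key x hx hxy).2.symm⟩

theorem rootedClique_of_two [Finite V] {X C D : Set V} (hX : X.ncard ≤ 3)
    (hC : ConnSet G C) (hD : ConnSet G D) (hCD : Disjoint C D) (hXC : Disjoint X C)
    (hXD : Disjoint X D) (h : ∀ x ∈ X, AdjSet G {x} C ∧ AdjSet G {x} D) :
    RootedClique G X (C ∪ D) := by
  rcases X.eq_empty_or_nonempty with rfl | ⟨a, ha⟩
  · exact ⟨fun _ => ∅, by simp⟩
  classical
  obtain ⟨B, hB, hBB⟩ := rootedClique_of_ncard_le_two (X := X \ {a}) (by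
    have := Set.ncard_sdiff_singleton_of_mem ha
    omega) hD (hXD.mono_left Set.sdiff_subset) fun x hx => (h x hx.1).2
  have key : ∀ y ∈ X, y ≠ a → Disjoint ({a} ∪ C) (B y) ∧ AdjSet G ({a} ∪ C) (B y) := by
    intro y hy hya
    obtain ⟨h1, h2, h3⟩ := hB y ⟨hy, hya⟩
    refine ⟨Set.disjoint_left.2 fun v hv hvB => ?_,
      (h y hy).1.symm.mono Set.subset_union_right (by simpa using h2)⟩
    rcases hv with rfl | hv <;> rcases h3 hvB with rfl | hvD
    · exact hya rfl
    · exact Set.disjoint_left.1 hXD ha hvD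
    · exact Set.disjoint_left.1 hXC hy hv
    · exact Set.disjoint_left.1 hCD hv hvD
  refine ⟨fun x => if x = a then {a} ∪ C else B x, fun x hx => ?_, fun x hx y hy hxy => ?_⟩
  · dsimp only
    split_ifs with hxa
    · subst hxa
      exact ⟨(ConnSet.singleton _).union_adj hC (h _ hx).1, Or.inl rfl,
        Set.insert_subset_insert Set.subset_union_left⟩
    · obtain ⟨h1, h2, h3⟩ := hB x ⟨hx, hxa⟩
      exact ⟨h1, h2, h3.trans (Set.insert_subset_insert Set.subset_union_right)⟩
  · dsimp only
    split_ifs with hxa hya hya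
    · exact absurd (hxa.trans hya.symm) hxy
    · exact key y hy hya
    · exact ⟨(key x hx hxa).1.symm, (key x hx hxa).2.symm⟩
    · exact hBB x ⟨hx, hxa⟩ y ⟨hy, hya⟩ hxy

theorem treeDec_of_separation {b : ℕ} {X A B : Set V} (hX : A ∩ B = X)
    (hA : ∃ 𝓑, TreeDec (G ⊔ cliqueOn X) b A 𝓑) (hB : ∃ 𝓑, TreeDec (G ⊔ cliqueOn X) b B 𝓑)
    (he : ∀ a ∈ A, a ∉ B → ∀ c ∈ B, c ∉ A → ¬ G.Adj a c) : ∃ 𝓑, TreeDec G b (A ∪ B) 𝓑 := by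
  obtain ⟨𝓐, hA⟩ := hA
  obtain ⟨𝓑, hB⟩ := hB
  have hcl : ∀ a ∈ X, ∀ c ∈ X, a ≠ c → (G ⊔ cliqueOn X).Adj a c := fun a ha c hc hac =>
    Or.inr ⟨hac, ha, hc⟩
  obtain ⟨B₁, hB₁, hX₁⟩ := hA.exists_clique_subset (hX ▸ Set.inter_subset_left) hcl
  obtain ⟨B₂, hB₂, hX₂⟩ := hB.exists_clique_subset (hX ▸ Set.inter_subset_right) hcl
  exact ⟨_, .glue (hA.anti le_sup_left) (hB.anti le_sup_left) hB₁ hB₂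
    (hX ▸ Set.subset_inter hX₁ hX₂) he⟩

/-- Disjoint connected subsets of a connected set extend to a partition into connected sets. -/
theorem ConnSet.exists_partition [Finite V] {ι : Type*} [Nonempty ι] {C : Set V}
    (hC : ConnSet G C) {P : ι → Set V} (hP : ∀ i, ConnSet G (P i) ∧ P i ⊆ C)
    (hd : Pairwise fun i j => Disjoint (P i) (P j)) :
    ∃ Q : ι → Set V, (∀ i, ConnSet G (Q i) ∧ P i ⊆ Q i) ∧
      (Pairwise fun i j => Disjoint (Q i) (Q j)) ∧ ⋃ i, Q i = C := by
  classical
  induction hn : (C \ ⋃ i, P i).ncard using Nat.strong_induction_on generalizing P with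
  | _ n ih =>
  have hPC : ⋃ i, P i ⊆ C := Set.iUnion_subset fun i => (hP i).2
  by_cases hfull : C ⊆ ⋃ i, P i
  · exact ⟨P, fun i => ⟨(hP i).1, le_rfl⟩, hd, hPC.antisymm hfull⟩
  obtain ⟨v, hvC, hv⟩ := Set.not_subset.1 hfull
  obtain ⟨i₀⟩ := ‹Nonempty ι›
  obtain ⟨u, hu⟩ := (hP i₀).1.1
  obtain ⟨a, haC, ha, b, hbC, hb, hab⟩ := hC.exit (T := ⋃ i, P i)
    ⟨u, (hP i₀).2 hu, Set.mem_iUnion_of_mem i₀ hu⟩ ⟨v, hvC, hv⟩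
  obtain ⟨i, hai⟩ := Set.mem_iUnion.1 ha
  have hbP : ∀ j, b ∉ P j := fun j hj => hb (Set.mem_iUnion_of_mem j hj)
  have hsub : ∀ j, P j ⊆ Function.update P i (insert b (P i)) j := by
    intro j
    by_cases hj : j = i
    · subst hj
      simp
    · simp [hj]
  obtain ⟨Q, hQ, hQd, hQC⟩ := ih (C \ ⋃ j, Function.update P i (insert b (P i)) j).ncard (by
      rw [← hn]
      refine Set.ncard_lt_ncard ⟨Set.sdiff_subset_sdiff_right (Set.iUnion_mono hsub), fun h => ?_⟩
        (Set.toFinite _)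
      exact (h ⟨hbC, hb⟩).2 (Set.mem_iUnion_of_mem i (by simp)))
    (P := Function.update P i (insert b (P i))) (fun j => by
      by_cases hj : j = i
      · subst hj
        simpa using ⟨(hP j).1.insert_adj hai hab.symm, Set.insert_subset hbC (hP j).2⟩
      · simpa [hj] using hP j) (fun j k hjk => by
      by_cases hj : j = i
      · subst hj
        simpa [hjk.symm] using ⟨hbP k, hd hjk⟩
      · by_cases hk : k = i
        · subst hk
          simpa [hjk] using ⟨hbP j, hd hjk⟩
        · simpa [hj, hk] using hd hjk) rfl
  exact ⟨Q, fun j => ⟨(hQ j).1, (hsub j).trans (hQ j).2⟩, hQd, hQC⟩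

/-- Two nonadjacent connected subsets of a connected set are linked by a third one. -/
theorem ConnSet.exists_bridge {W X Y : Set V} (hW : ConnSet G W) (hX : ConnSet G X)
    (hY : Y.Nonempty) (hXW : X ⊆ W) (hYW : Y ⊆ W) (hd : Disjoint X Y) (hXY : ¬ AdjSet G X Y) :
    ∃ E, ConnSet G E ∧ E ⊆ W ∧ Disjoint E X ∧ Disjoint E Y ∧ AdjSet G E X ∧ AdjSet G E Y := by
  obtain ⟨x, hx⟩ := hX.1
  have hxY : x ∈ W \ Y := ⟨hXW hx, Set.disjoint_left.1 hd hx⟩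
  obtain ⟨f, hf, y, hy, hfy⟩ := hW.comp_adj hYW hY hxY
  have hXF : X ⊆ comp G (W \ Y) x :=
    subset_comp hX (fun v hv => ⟨hXW hv, Set.disjoint_left.1 hd hv⟩) hx
  have hfX : f ∈ comp G (W \ Y) x \ X := ⟨hf, fun h => hXY ⟨f, h, y, hy, hfy⟩⟩
  refine ⟨comp G (comp G (W \ Y) x \ X) f, comp_conn hfX, fun v hv =>
    (comp_subset (comp_subset hv).1).1, Set.disjoint_left.2 fun v hv => (comp_subset hv).2,
    Set.disjoint_left.2 fun v hv => (comp_subset (comp_subset hv).1).2,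
    (comp_conn hxY).comp_adj hXF hX.1 hfX, f, mem_comp_self hfX, y, hy, hfy⟩

end

section

variable {V : Type*} {G : SimpleGraph V} {U S C D : Set V} {u v w x : V}

/-- The set `S ⊆ U` separates two vertices of `U \ S` in the subgraph induced by `U`. -/
def Sep (G : SimpleGraph V) (U S : Set V) : Prop :=
  S ⊆ U ∧ ∃ u ∈ U \ S, ∃ v ∈ U \ S, v ∉ comp G (U \ S) u

theorem comp_subset_of_closed (hu : u ∈ D) (hDS : D ⊆ S)
    (hD : ∀ a ∈ D, ∀ b ∈ S, G.Adj a b → b ∈ D) : comp G S u ⊆ D :=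
  (comp_conn (hDS hu)).2 D ⟨u, mem_comp_self (hDS hu), hu⟩ fun a _ haD b hb hab =>
    hD a haD b (comp_subset hb) hab

theorem comp_disjoint (h : v ∉ comp G S u) : Disjoint (comp G S u) (comp G S v) :=
  Set.disjoint_left.2 fun w hw hw' => h (by
    rw [← comp_eq hw]
    exact comp_symm hw')

/-- Every vertex of a minimum separator has a neighbour in each component. -/
theorem Sep.attached [Finite V] (h : Sep G U S) (hmin : ∀ S', Sep G U S' → S.ncard ≤ S'.ncard)
    (hw : w ∈ U \ S) (hx : x ∈ S) : AdjSet G {x} (comp G (U \ S) w) := by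
  by_contra hcon
  have hxU := h.1 hx
  have hsub : comp G (U \ S) w ⊆ U \ (S \ {x}) := comp_subset.trans
    (Set.sdiff_subset_sdiff_right Set.sdiff_subset)
  have hx' : x ∉ comp G (U \ (S \ {x})) w := fun hx' => by
    refine (comp_subset (comp_subset_of_closed (mem_comp_self hw) hsub ?_ hx')).2 hx
    intro a ha b hb hab
    by_cases hbx : b = x
    · subst hbx
      exact absurd ⟨b, rfl, a, ha, hab.symm⟩ hcon
    · exact comp_closed ha ⟨hb.1, fun hbS => hb.2 ⟨hbS, hbx⟩⟩ hab
  have hle := hmin (S \ {x}) ⟨Set.sdiff_subset.trans h.1, w, hsub (mem_comp_self hw), x,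
    ⟨hxU, fun hh => hh.2 rfl⟩, hx'⟩
  have := Set.ncard_sdiff_singleton_lt_of_mem hx
  omega

theorem pairwise_fin_three {r : Fin 3 → Fin 3 → Prop} (hs : ∀ i j, r i j → r j i) (h01 : r 0 1)
    (h02 : r 0 2) (h12 : r 1 2) (i j : Fin 3) (hij : i ≠ j) : r i j := by
  fin_cases i <;> fin_cases j <;> first | exact absurd rfl hij | assumption | (apply hs; assumption)

theorem rootedClique_of_family {ι : Type*} {y : ι → V} {R : ι → Set V} (hy : ∀ x ∈ S, ∃ i, y i = x)
    (hR : ∀ i, ConnSet G (R i) ∧ y i ∈ R i ∧ R i ⊆ S ∪ D)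
    (hd : ∀ i j, i ≠ j → Disjoint (R i) (R j) ∧ AdjSet G (R i) (R j)) : RootedClique G S D := by
  have hinj : Function.Injective y := fun i j hij => by
    by_contra hne
    exact Set.disjoint_left.1 (hd i j hne).1 (hR i).2.1 (hij ▸ (hR j).2.1)
  refine ⟨Function.extend y R fun _ => ∅, fun x hx => ?_, fun x hx x' hx' hne => ?_⟩
  · obtain ⟨i, rfl⟩ := hy x hx
    rw [hinj.extend_apply]
    refine ⟨(hR i).1, (hR i).2.1, fun v hv => ?_⟩
    rcases (hR i).2.2 hv with hvS | hvD
    · obtain ⟨j, rfl⟩ := hy v hvS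
      by_cases hij : i = j
      · exact Or.inl (hij ▸ rfl)
      · exact absurd (hR j).2.1 (Set.disjoint_left.1 (hd i j hij).1 hv)
    · exact Or.inr hvD
  · obtain ⟨i, rfl⟩ := hy x hx
    obtain ⟨j, rfl⟩ := hy x' hx'
    rw [hinj.extend_apply, hinj.extend_apply]
    exact hd i j fun h => hne (h ▸ rfl)

/-- A vertex `d` of a side `D` of a `3`-separation is linked to the separator. -/
theorem exists_three_links [Finite V] (h3 : ∀ S, Sep G U S → 3 ≤ S.ncard) (hSU : S ⊆ U)
    (hS : S.ncard = 3) {d : V} (hd : d ∈ U \ S) :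
    ∃ P : Fin 3 → Set V, (∀ i, ConnSet G (P i) ∧ P i ⊆ (comp G (U \ S) d ∪ S) \ {d} ∧
      AdjSet G {d} (P i) ∧ (P i ∩ S).Nonempty) ∧ Pairwise fun i j => Disjoint (P i) (P j) := by
  have hSR : S ⊆ (comp G (U \ S) d ∪ S) \ {d} := fun s hs => ⟨Or.inr hs, by
    rintro rfl
    exact hd.2 hs⟩
  obtain ⟨P, hP, hPd, hPm⟩ := menger (restr G ((comp G (U \ S) d ∪ S) \ {d})) {a | G.Adj d a} S 3
    fun T hT => by
      have hT' : ((T ∩ U) \ {d}).ncard < 3 := (Set.ncard_le_ncard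
        (Set.sdiff_subset.trans Set.inter_subset_left) (Set.toFinite _)).trans_lt hT
      obtain ⟨s, hs, hsT⟩ : ∃ s ∈ S, s ∉ (T ∩ U) \ {d} := by
        by_contra! hcon
        have := Set.ncard_le_ncard hcon (Set.toFinite _)
        omega
      have hdT : d ∈ U \ ((T ∩ U) \ {d}) := ⟨hd.1, fun h => h.2 rfl⟩
      have hsd : s ∈ comp G (U \ ((T ∩ U) \ {d})) d := by
        by_contra hcon
        have := h3 _ ⟨Set.sdiff_subset.trans Set.inter_subset_right, d, hdT, s, ⟨hSU hs, hsT⟩, hcon⟩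
        omega
      obtain ⟨E, hEW, hE, hdE, e, he, a, ⟨haW, haS⟩, hea⟩ :=
        (comp_conn hdT).exists_to (mem_comp_self hdT) hd.2 ⟨s, hsd, hs⟩
      have hED : E ⊆ comp G (U \ S) d :=
        subset_comp hE (fun z hz => ⟨(comp_subset (hEW hz).1).1, (hEW hz).2⟩) hdE
      have hE' := hE.insert_adj he hea.symm
      have hda : d ≠ a := by
        rintro rfl
        exact hd.2 haS
      have haE : a ∈ insert a E \ {d} := ⟨Or.inl rfl, hda.symm⟩
      refine ⟨comp G (insert a E \ {d}) a, (comp_conn haE).restr fun z hz => ?_,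
        Set.disjoint_left.2 fun z hz hzT => ?_, ?_, a, mem_comp_self haE, haS⟩
      · obtain ⟨hz1, hz2⟩ := comp_subset hz
        exact ⟨hz1.elim (fun h => Or.inr (h ▸ haS)) fun h => Or.inl (hED h), hz2⟩
      · obtain ⟨hz1, hz2⟩ := comp_subset hz
        have hzW : z ∈ U \ ((T ∩ U) \ {d}) :=
          comp_subset (hz1.elim (fun h => h ▸ haW) fun h => (hEW h).1)
        exact hzW.2 ⟨⟨hzT, hzW.1⟩, hz2⟩
      · obtain ⟨f, hf, d', rfl, hfd⟩ := hE'.comp_adj (K := {d})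
          (Set.singleton_subset_iff.2 (Or.inr hdE)) ⟨d, rfl⟩ haE
        exact ⟨f, hf, hfd.symm⟩
  refine ⟨P, fun i => ⟨(hP i).of_le (restr_le _), ?_, ?_, (hPm i).2⟩, hPd⟩
  · exact (hP i).subset_of_restr ((hPm i).2.mono (Set.inter_subset_inter_right _ hSR))
  · obtain ⟨f, hf, hdf⟩ := (hPm i).1
    exact ⟨d, rfl, f, hf, hdf⟩

/-- In a `3`-connected graph, a side of a `3`-separation with at least two vertices has a
triangle model rooted at the separator. -/
theorem rootedClique_of_sep_three [Finite V] (h3 : ∀ S, Sep G U S → 3 ≤ S.ncard) (hsep : Sep G U S)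
    (hS : S.ncard = 3) (hD : D ⊆ U \ S) (hDc : ∀ a ∈ D, ∀ b ∈ U \ S, G.Adj a b → b ∈ D) {d e z : V}
    (hd : d ∈ D) (he : e ∈ D) (hde : d ≠ e) (hz : z ∈ U \ S) (hzD : z ∉ D) :
    RootedClique G S D := by
  have hmin : ∀ S', Sep G U S' → S.ncard ≤ S'.ncard := fun S' h => hS.trans_le (h3 S' h)
  have hatt : ∀ {w x}, w ∈ U \ S → x ∈ S → AdjSet G {x} (comp G (U \ S) w) := fun hw hx =>
    hsep.attached hmin hw hx
  have hdS : ∀ {w}, Disjoint S (comp G (U \ S) w) := fun {w} => Set.disjoint_left.2 fun x hx hx' =>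
    (comp_subset hx').2 hx
  have hDc' : ∀ {w}, w ∈ D → comp G (U \ S) w ⊆ D := fun hw => comp_subset_of_closed hw hD hDc
  by_cases hconn : e ∈ comp G (U \ S) d
  swap
  · exact (rootedClique_of_two hS.le (comp_conn (hD hd)) (comp_conn (hD he))
      (comp_disjoint hconn) hdS hdS fun x hx => ⟨hatt (hD hd) hx, hatt (hD he) hx⟩).mono
      (Set.union_subset (hDc' hd) (hDc' he))
  obtain ⟨P, hP, hPd⟩ := exists_three_links h3 hsep.1 hS (hD hd)
  set R := (comp G (U \ S) d ∪ S) \ {d} with hR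
  choose y hy using fun i => (hP i).2.2.2
  have hyinj : Function.Injective y := fun i j hij => by
    by_contra hne
    exact Set.disjoint_left.1 (hPd hne) (hy i).1 (hij ▸ (hy j).1)
  have hysurj : ∀ x ∈ S, ∃ i, y i = x := by
    have h1 : (Set.range y).ncard = 3 := by
      rw [← Set.image_univ, Set.ncard_image_of_injective _ hyinj]
      simp [Set.ncard_univ]
    have h2 : Set.range y = S := Set.eq_of_subset_of_ncard_le
      (Set.range_subset_iff.2 fun i => (hy i).2) (by omega) (Set.toFinite _)
    exact fun x hx => by rwa [← h2] at hx
  have heR : e ∈ R := ⟨Or.inl hconn, hde.symm⟩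
  have hRS : R ⊆ S ∪ D := fun v hv => hv.1.symm.imp_right fun h => hDc' hd h
  have hcomp : ∀ i, (P i ∩ comp G R e).Nonempty → P i ⊆ comp G R e := fun i h =>
    comp_max (hP i).1 (hP i).2.1 h
  obtain ⟨i₁, i₂, hi, h₁, h₂⟩ : ∃ i₁ i₂, i₁ ≠ i₂ ∧ (P i₁ ∩ comp G R e).Nonempty ∧
      (P i₂ ∩ comp G R e).Nonempty := by
    by_contra! hcon
    set Z := insert d (S ∩ comp G R e) with hZ
    have hZc : Z.ncard ≤ 2 := by
      refine (Set.ncard_insert_le _ _).trans ?_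
      have : (S ∩ comp G R e).ncard ≤ 1 := (Set.ncard_le_one (Set.toFinite _)).2 fun a ha b hb => by
        obtain ⟨i, rfl⟩ := hysurj a ha.1
        obtain ⟨j, rfl⟩ := hysurj b hb.1
        by_contra hne
        have hji : (P j ∩ comp G R e).Nonempty := ⟨y j, (hy j).1, hb.2⟩
        exact hji.ne_empty (hcon i j (fun h => hne (h ▸ rfl)) ⟨y i, (hy i).1, ha.2⟩)
      omega
    have hZU : Z ⊆ U := Set.insert_subset (hD hd).1 (Set.inter_subset_left.trans hsep.1)
    have heZ : e ∈ comp G R e \ S := ⟨mem_comp_self heR, (hD he).2⟩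
    have hsub : comp G R e \ S ⊆ U \ Z := fun v hv => ⟨(hRS (comp_subset hv.1)).elim
      (fun h => hsep.1 h) fun h => (hD h).1, by
        rintro (rfl | h)
        · exact (comp_subset hv.1).2 rfl
        · exact hv.2 h.1⟩
    have := h3 Z ⟨hZU, e, hsub heZ, z, ⟨hz.1, by
      rintro (rfl | h)
      · exact hzD hd
      · exact hz.2 h.1⟩, fun hze => ?_⟩
    · omega
    · have hzR := comp_subset_of_closed heZ hsub (fun a ha b hb hab => by
        have haD : a ∈ comp G (U \ S) d := ((comp_subset ha.1).1).resolve_right ha.2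
        have hbd : b ≠ d := fun h => hb.2 (Or.inl h)
        by_cases hbS : b ∈ S
        · exact absurd (Or.inr ⟨hbS, comp_closed ha.1 ⟨Or.inr hbS, hbd⟩ hab⟩) hb.2
        · exact ⟨comp_closed ha.1 ⟨Or.inl (comp_closed haD ⟨hb.1, hbS⟩ hab), hbd⟩ hab, hbS⟩) hze
      exact (hRS (comp_subset hzR.1)).elim hz.2 hzD
  have : Nonempty {i // (P i ∩ comp G R e).Nonempty} := ⟨⟨i₁, h₁⟩⟩
  obtain ⟨Q, hQ, hQd, hQu⟩ := (comp_conn heR).exists_partition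
    (P := fun i : {i // (P i ∩ comp G R e).Nonempty} => P i)
    (fun i => ⟨(hP i).1, hcomp i i.2⟩) (fun i j hij => hPd fun h => hij (Subtype.ext h))
  have hQK : ∀ i, Q i ⊆ comp G R e := fun i => hQu ▸ Set.subset_iUnion Q i
  have hyQ : ∀ i, y i ∈ Q i := fun i => (hQ i).2 (hy i).1
  obtain ⟨a, ha, haQ, b, hb, hbQ, hab⟩ := (comp_conn heR).exit (T := Q ⟨i₁, h₁⟩)
    ⟨y i₁, hQK ⟨i₁, h₁⟩ (hyQ _), hyQ ⟨i₁, h₁⟩⟩ ⟨y i₂, hQK ⟨i₂, h₂⟩ (hyQ _),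
      Set.disjoint_left.1 (hQd (fun h => hi (congrArg Subtype.val h).symm)) (hyQ ⟨i₂, h₂⟩)⟩
  rw [← hQu] at hb
  obtain ⟨⟨j, hj⟩, hbj⟩ := Set.mem_iUnion.1 hb
  have hji : i₁ ≠ j := by
    rintro rfl
    exact hbQ hbj
  obtain ⟨l, hl₁, hlj⟩ : ∃ l : Fin 3, i₁ ≠ l ∧ j ≠ l := by
    clear * -
    revert i₁ j
    decide
  have hPQ : ∀ k (hk : (P k ∩ comp G R e).Nonempty), k ≠ l → Disjoint (Q ⟨k, hk⟩) (P l) := by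
    intro k hk hkl
    by_cases hlK : (P l ∩ comp G R e).Nonempty
    · exact (hQd (fun h => hkl (congrArg Subtype.val h)) :
        Disjoint (Q ⟨k, hk⟩) (Q ⟨l, hlK⟩)).mono_right (hQ ⟨l, hlK⟩).2
    · exact Set.disjoint_left.2 fun v hv hvl => hlK ⟨v, hvl, hQK _ hv⟩
  have hdQ : ∀ k, d ∉ Q k := fun k hk => (comp_subset (hQK k hk)).2 rfl
  have hlast : ∀ k (hk : (P k ∩ comp G R e).Nonempty), k ≠ l →
      Disjoint (Q ⟨k, hk⟩) ({d} ∪ P l) ∧ AdjSet G (Q ⟨k, hk⟩) ({d} ∪ P l) := fun k hk hkl =>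
    ⟨Set.disjoint_union_right.2 ⟨Set.disjoint_singleton_right.2 (hdQ _), hPQ k hk hkl⟩,
      (hP k).2.2.1.symm.mono (hQ ⟨k, hk⟩).2 Set.subset_union_left⟩
  refine rootedClique_of_family (y := ![y i₁, y j, y l])
    (R := ![Q ⟨i₁, h₁⟩, Q ⟨j, hj⟩, {d} ∪ P l]) ?_ ?_ (pairwise_fin_three
      (fun i j h => ⟨h.1.symm, h.2.symm⟩) ⟨hQd fun h => hji (congrArg Subtype.val h), a, haQ, b,
        hbj, hab⟩ (hlast i₁ h₁ hl₁) (hlast j hj hlj))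
  · intro x hx
    obtain ⟨k, rfl⟩ := hysurj x hx
    have hk : k = i₁ ∨ k = j ∨ k = l := by
      clear * - hji hl₁ hlj
      revert k i₁ j l
      decide
    rcases hk with rfl | rfl | rfl
    · exact ⟨0, rfl⟩
    · exact ⟨1, rfl⟩
    · exact ⟨2, rfl⟩
  · intro k
    fin_cases k
    · exact ⟨(hQ _).1, hyQ ⟨i₁, h₁⟩, ((hQK _).trans comp_subset).trans hRS⟩
    · exact ⟨(hQ _).1, hyQ ⟨j, hj⟩, ((hQK _).trans comp_subset).trans hRS⟩
    · exact ⟨(ConnSet.singleton d).union_adj (hP l).1 (hP l).2.2.1, Or.inr (hy l).1,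
        Set.union_subset (Set.singleton_subset_iff.2 (Or.inr hd)) ((hP l).2.1.trans hRS)⟩

end

section

variable {V : Type*} {G : SimpleGraph V} {U S C D : Set V} {u v w x v₁ v₂ : V}

theorem minorIn_doubleWheel_of_family {R : Fin 3 → Set V} {A : Fin 2 → Set V}
    (hR : ∀ i, ConnSet G (R i) ∧ R i ⊆ U) (hA : ∀ i, ConnSet G (A i) ∧ A i ⊆ U)
    (hAd : Disjoint (A 0) (A 1))
    (hRR : ∀ i j, i ≠ j → Disjoint (R i) (R j) ∧ AdjSet G (R i) (R j))
    (hRA : ∀ i, (Disjoint (R i) (A 0) ∧ AdjSet G (R i) (A 0)) ∧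
      Disjoint (R i) (A 1) ∧ AdjSet G (R i) (A 1)) : MinorIn (doubleWheel 3) G U := by
  refine minorIn_doubleWheel hR hA (fun i j h => (hRR i j h).1) hAd (fun i j => ?_)
    (fun i j h => (hRR i j h).2) (fun i j => ?_)
  · fin_cases j
    exacts [(hRA i).1.1, (hRA i).2.1]
  · fin_cases j
    exacts [(hRA i).1.2, (hRA i).2.2]

/-- Three disjoint connected sets, each seeing both `v₁` and `v₂`. -/
theorem exists_three_parts [Finite V] (hv₁ : v₁ ∈ U) (hv₂ : v₂ ∈ U) (hne : v₁ ≠ v₂)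
    (hadj : ¬ G.Adj v₁ v₂) (h3 : ∀ S, Sep G U S → 3 ≤ S.ncard)
    (hW : ConnSet G (U \ {v₁, v₂})) :
    ∃ Q : Fin 3 → Set V, (∀ i, ConnSet G (Q i) ∧ AdjSet G (Q i) {v₁} ∧ AdjSet G (Q i) {v₂}) ∧
      (Pairwise fun i j => Disjoint (Q i) (Q j)) ∧ ⋃ i, Q i = U \ {v₁, v₂} := by
  obtain ⟨P, hP, hPd, hPm⟩ := menger (restr G (U \ {v₁, v₂})) ({a | G.Adj a v₁} ∩ (U \ {v₁, v₂}))
    ({a | G.Adj a v₂} ∩ (U \ {v₁, v₂})) 3 fun T hT => by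
      have hT' : ((T ∩ U) \ {v₁, v₂}).ncard < 3 := (Set.ncard_le_ncard
        (Set.sdiff_subset.trans Set.inter_subset_left) (Set.toFinite _)).trans_lt hT
      have h₁ : v₁ ∈ U \ ((T ∩ U) \ {v₁, v₂}) := ⟨hv₁, fun h => h.2 (by simp)⟩
      have h₂ : v₂ ∈ U \ ((T ∩ U) \ {v₁, v₂}) := ⟨hv₂, fun h => h.2 (by simp)⟩
      have hcomp : v₂ ∈ comp G (U \ ((T ∩ U) \ {v₁, v₂})) v₁ := by
        by_contra hcon
        have := h3 _ ⟨Set.sdiff_subset.trans Set.inter_subset_right, v₁, h₁, v₂, h₂, hcon⟩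
        omega
      obtain ⟨E, hE, hEW, hE₁, hE₂, ⟨a, ha, b, rfl, hab⟩, c, hc, d, rfl, hcd⟩ :=
        (comp_conn h₁).exists_bridge (ConnSet.singleton v₁) (Set.singleton_nonempty v₂)
          (Set.singleton_subset_iff.2 (mem_comp_self h₁)) (Set.singleton_subset_iff.2 hcomp)
          (Set.disjoint_singleton.2 hne) (by
            rintro ⟨a, rfl, b, rfl, hab⟩
            exact hadj hab)
      rw [Set.disjoint_singleton_right] at hE₁ hE₂
      have hEU : E ⊆ U \ {b, d} := fun z hz => ⟨(comp_subset (hEW hz)).1, by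
        rintro (rfl | rfl)
        exacts [hE₁ hz, hE₂ hz]⟩
      exact ⟨E, hE.restr hEU, Set.disjoint_left.2 fun z hz hzT =>
        (comp_subset (hEW hz)).2 ⟨⟨hzT, (hEU hz).1⟩, (hEU hz).2⟩, ⟨a, ha, hab, hEU ha⟩,
        c, hc, hcd, hEU hc⟩
  have hPW : ∀ i, P i ⊆ U \ {v₁, v₂} := fun i => (hP i).subset_of_restr
    ((hPm i).1.mono (Set.inter_subset_inter_right _ Set.inter_subset_right))
  obtain ⟨Q, hQ, hQd, hQu⟩ := hW.exists_partition (fun i => ⟨(hP i).of_le (restr_le _), hPW i⟩) hPd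
  refine ⟨Q, fun i => ⟨(hQ i).1, ?_, ?_⟩, hQd, hQu⟩
  · obtain ⟨a, ha, ha', -⟩ := (hPm i).1
    exact ⟨a, (hQ i).2 ha, v₁, rfl, ha'⟩
  · obtain ⟨a, ha, ha', -⟩ := (hPm i).2
    exact ⟨a, (hQ i).2 ha, v₂, rfl, ha'⟩

/-- If `X`, `Y`, `Z` partition a `2`-connected set and `X`, `Y` are not adjacent, then `Z` splits
into two connected sets each of which sees both `X` and `Y`. -/
theorem exists_split [Finite V] {W X Y Z : Set V} {o : V} (ho : o ∉ W)
    (hW : ∀ c, ∀ u ∈ W \ {c}, ∀ v ∈ W \ {c}, v ∈ comp G (W \ {c}) u) (hX : ConnSet G X)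
    (hY : ConnSet G Y) (hZ : ConnSet G Z) (hXY : Disjoint X Y) (hXZ : Disjoint X Z)
    (hYZ : Disjoint Y Z) (hu : W = X ∪ Y ∪ Z) (hadj : ¬ AdjSet G X Y) :
    ∃ Q : Fin 2 → Set V, (∀ i, ConnSet G (Q i) ∧ AdjSet G (Q i) X ∧ AdjSet G (Q i) Y) ∧
      (Pairwise fun i j => Disjoint (Q i) (Q j)) ∧ ⋃ i, Q i = Z := by
  have hXW : X ⊆ W := hu ▸ Set.subset_union_left.trans Set.subset_union_left
  have hYW : Y ⊆ W := hu ▸ Set.subset_union_right.trans Set.subset_union_left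
  have hZW : Z ⊆ W := hu ▸ Set.subset_union_right
  obtain ⟨P, hP, hPd, hPm⟩ := menger (restr G Z) ({a | AdjSet G {a} X} ∩ Z)
    ({a | AdjSet G {a} Y} ∩ Z) 2 fun T hT => by
      obtain ⟨c, hcX, hcY, hTc⟩ : ∃ c, c ∉ X ∧ c ∉ Y ∧ T ∩ Z ⊆ {c} := by
        rcases (T ∩ Z).eq_empty_or_nonempty with h | ⟨c, hcT, hcZ⟩
        · exact ⟨o, fun h => ho (hXW h), fun h => ho (hYW h), by simp [h]⟩
        · exact ⟨c, fun h => Set.disjoint_left.1 hXZ h hcZ, fun h => Set.disjoint_left.1 hYZ h hcZ,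
            fun z hz => (Set.ncard_le_one (Set.toFinite _)).1 (by omega : T.ncard ≤ 1) z hz.1 c hcT⟩
      obtain ⟨x, hx⟩ := hX.1
      have hXc : X ⊆ W \ {c} := fun z hz => ⟨hXW hz, by
        rintro rfl
        exact hcX hz⟩
      have hYc : Y ⊆ W \ {c} := fun z hz => ⟨hYW hz, by
        rintro rfl
        exact hcY hz⟩
      obtain ⟨E, hE, hEW, hEX, hEY, ⟨a, ha, b, hb, hab⟩, p, hp, q, hq, hpq⟩ :=
        (comp_conn (hXc hx)).exists_bridge hX hY.1 (fun z hz => hW c x (hXc hx) z (hXc hz))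
          (fun z hz => hW c x (hXc hx) z (hYc hz)) hXY hadj
      have hEZ : E ⊆ Z := fun z hz => by
        have hzW := (comp_subset (hEW hz)).1
        rw [hu] at hzW
        rcases hzW with (h | h) | h
        · exact absurd h (Set.disjoint_left.1 hEX hz)
        · exact absurd h (Set.disjoint_left.1 hEY hz)
        · exact h
      exact ⟨E, hE.restr hEZ, Set.disjoint_left.2 fun z hz hzT =>
        (comp_subset (hEW hz)).2 (hTc ⟨hzT, hEZ hz⟩), ⟨a, ha, ⟨a, rfl, b, hb, hab⟩, hEZ ha⟩,
        p, hp, ⟨p, rfl, q, hq, hpq⟩, hEZ hp⟩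
  have hPZ : ∀ i, P i ⊆ Z := fun i => (hP i).subset_of_restr
    ((hPm i).1.mono (Set.inter_subset_inter_right _ Set.inter_subset_right))
  obtain ⟨Q, hQ, hQd, hQu⟩ := hZ.exists_partition (fun i => ⟨(hP i).of_le (restr_le _), hPZ i⟩) hPd
  refine ⟨Q, fun i => ⟨(hQ i).1, ?_, ?_⟩, hQd, hQu⟩
  · obtain ⟨a, ha, ha', -⟩ := (hPm i).1
    exact ha'.mono (Set.singleton_subset_iff.2 ((hQ i).2 ha)) le_rfl
  · obtain ⟨a, ha, ha', -⟩ := (hPm i).2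
    exact ha'.mono (Set.singleton_subset_iff.2 ((hQ i).2 ha)) le_rfl

/-- Two nonadjacent vertices whose removal leaves a `2`-connected set yield `DW_3`. -/
theorem minorIn_doubleWheel_three [Finite V] (hv₁ : v₁ ∈ U) (hv₂ : v₂ ∈ U) (hne : v₁ ≠ v₂)
    (hadj : ¬ G.Adj v₁ v₂) (h3 : ∀ S, Sep G U S → 3 ≤ S.ncard) (hwU : (U \ {v₁, v₂}).Nonempty)
    (hW : ∀ c, ∀ u ∈ (U \ {v₁, v₂}) \ {c}, ∀ v ∈ (U \ {v₁, v₂}) \ {c},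
      v ∈ comp G ((U \ {v₁, v₂}) \ {c}) u) : MinorIn (doubleWheel 3) G U := by
  have ho : v₁ ∉ U \ {v₁, v₂} := fun h => h.2 (by simp)
  have hWc : ConnSet G (U \ {v₁, v₂}) := by
    obtain ⟨w, hw⟩ := hwU
    have h := hW v₁
    rw [Set.sdiff_singleton_eq_self ho] at h
    rw [← comp_subset.antisymm (h w hw)]
    exact comp_conn hw
  obtain ⟨Q, hQ, hQd, hQu⟩ := exists_three_parts hv₁ hv₂ hne hadj h3 hWc
  have hQW : ∀ i, Q i ⊆ U \ {v₁, v₂} := fun i => hQu ▸ Set.subset_iUnion Q i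
  have hQU : ∀ i, Q i ⊆ U := fun i => (hQW i).trans Set.sdiff_subset
  have hQ₁ : ∀ i, Disjoint (Q i) {v₁} := fun i => Set.disjoint_singleton_right.2 fun h =>
    (hQW i h).2 (by simp)
  have hQ₂ : ∀ i, Disjoint (Q i) {v₂} := fun i => Set.disjoint_singleton_right.2 fun h =>
    (hQW i h).2 (by simp)
  by_cases hall : ∀ i j, i ≠ j → AdjSet G (Q i) (Q j)
  · refine minorIn_doubleWheel_of_family (R := Q) (A := ![{v₁}, {v₂}])
      (fun i => ⟨(hQ i).1, hQU i⟩) (fun i => ?_) (Set.disjoint_singleton.2 hne)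
      (fun i j h => ⟨hQd h, hall i j h⟩)
      fun i => ⟨⟨hQ₁ i, (hQ i).2.1⟩, hQ₂ i, (hQ i).2.2⟩
    fin_cases i
    exacts [⟨ConnSet.singleton v₁, Set.singleton_subset_iff.2 hv₁⟩,
      ⟨ConnSet.singleton v₂, Set.singleton_subset_iff.2 hv₂⟩]
  push Not at hall
  obtain ⟨i, j, hij, hXY⟩ := hall
  obtain ⟨l, hl, hlu⟩ : ∃ l : Fin 3, (i ≠ l ∧ j ≠ l) ∧ ∀ k, k = i ∨ k = j ∨ k = l := by
    clear * - hij
    revert i j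
    decide
  obtain ⟨R, hR, hRd, hRu⟩ := exists_split ho hW (hQ i).1 (hQ j).1 (hQ l).1 (hQd hij) (hQd hl.1)
    (hQd hl.2) (by
      rw [← hQu]
      refine subset_antisymm (Set.iUnion_subset fun k => ?_) (Set.union_subset (Set.union_subset
        (Set.subset_iUnion Q i) (Set.subset_iUnion Q j)) (Set.subset_iUnion Q l))
      rcases hlu k with rfl | rfl | rfl
      · exact Set.subset_union_left.trans Set.subset_union_left
      · exact Set.subset_union_right.trans Set.subset_union_left
      · exact Set.subset_union_right) hXY
  have hRQ : ∀ p, R p ⊆ Q l := fun p => hRu ▸ Set.subset_iUnion R p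
  obtain ⟨a, ha, b, rfl, hab⟩ := (hQ l).2.2
  rw [← hRu] at ha
  obtain ⟨p, hap⟩ := Set.mem_iUnion.1 ha
  obtain ⟨q, hpq, hqu⟩ : ∃ q : Fin 2, p ≠ q ∧ ∀ k, k = p ∨ k = q := by
    clear * -
    revert p
    decide
  have hRR : AdjSet G (R p) (R q) := by
    obtain ⟨c, hc⟩ := (hR q).1.1
    obtain ⟨d, -, hdp, e, he, hep, hde⟩ := (hQ l).1.exit (T := R p) ⟨a, hRQ p hap, hap⟩
      ⟨c, hRQ q hc, fun h => Set.disjoint_left.1 (hRd hpq) h hc⟩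
    rw [← hRu] at he
    obtain ⟨k, hk⟩ := Set.mem_iUnion.1 he
    rcases hqu k with rfl | rfl
    · exact absurd hk hep
    · exact ⟨d, hdp, e, hk, hde⟩
  have hdR : ∀ r, Disjoint (Q i ∪ {v₁}) (R r) ∧ AdjSet G (Q i ∪ {v₁}) (R r) := fun r =>
    ⟨Set.disjoint_union_left.2 ⟨(hQd hl.1).mono_right (hRQ r), (hQ₁ l).symm.mono_right (hRQ r)⟩,
      (hR r).2.1.symm.mono Set.subset_union_left le_rfl⟩
  have hdY : ∀ r, Disjoint (Q j) (R r) ∧ AdjSet G (Q j) (R r) := fun r =>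
    ⟨(hQd hl.2).mono_right (hRQ r), (hR r).2.2.symm⟩
  refine minorIn_doubleWheel_of_family (R := ![Q i ∪ {v₁}, Q j, R p]) (A := ![R q, {b}])
    (fun k => ?_) (fun k => ?_) ((hQ₂ l).mono_left (hRQ q))
    (pairwise_fin_three (fun i j h => ⟨h.1.symm, h.2.symm⟩)
      ⟨Set.disjoint_union_left.2 ⟨hQd hij, (hQ₁ j).symm⟩,
        (hQ j).2.1.symm.mono Set.subset_union_right le_rfl⟩ (hdR p) (hdY p)) fun k => ?_
  · fin_cases k
    · exact ⟨(hQ i).1.union_adj (ConnSet.singleton v₁) (hQ i).2.1,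
        Set.union_subset (hQU i) (Set.singleton_subset_iff.2 hv₁)⟩
    · exact ⟨(hQ j).1, hQU j⟩
    · exact ⟨(hR p).1, (hRQ p).trans (hQU l)⟩
  · fin_cases k
    · exact ⟨(hR q).1, (hRQ q).trans (hQU l)⟩
    · exact ⟨ConnSet.singleton b, Set.singleton_subset_iff.2 hv₂⟩
  · fin_cases k
    · exact ⟨hdR q, Set.disjoint_union_left.2 ⟨hQ₂ i, Set.disjoint_singleton.2 hne⟩,
        (hQ i).2.2.mono Set.subset_union_left le_rfl⟩
    · exact ⟨hdY q, hQ₂ j, (hQ j).2.2⟩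
    · exact ⟨⟨hRd hpq, hRR⟩, (hQ₂ l).mono_left (hRQ p), a, hap, b, rfl, hab⟩

end

section

variable {V : Type*} {α : Type*} {H : SimpleGraph α} {G : SimpleGraph V} {U S C D : Set V}
  {u v w x a b c : V} {k : ℕ}

/-- A large clique contains every small graph as a minor. -/
theorem minorIn_of_clique [Finite V] [Fintype α] (hU : Fintype.card α ≤ U.ncard)
    (h : ∀ a ∈ U, ∀ b ∈ U, a ≠ b → G.Adj a b) : MinorIn H G U := by
  have := Fintype.ofFinite U
  obtain ⟨f⟩ := Function.Embedding.nonempty_of_card_le (α := α) (β := U) (by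
    rwa [← Nat.card_eq_fintype_card (α := U)])
  have hf : ∀ i j, i ≠ j → (f i : V) ≠ f j := fun i j hij h => hij (f.injective (Subtype.ext h))
  exact ⟨fun i => {(f i : V)}, fun i => ⟨ConnSet.singleton _,
    Set.singleton_subset_iff.2 (f i).2⟩, fun i j hij => Set.disjoint_singleton.2 (hf i j hij),
    fun i j hij => ⟨_, rfl, _, rfl, h _ (f i).2 _ (f j).2 (hf i j hij.ne)⟩⟩

/-- `G[U]` is a counterexample, with a minimum number of vertices, to the claim that graphs without
an `H` minor have a tree decomposition with bags of size at most `k`. -/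
def Critical (H : SimpleGraph α) (k : ℕ) (G : SimpleGraph V) (U : Set V) : Prop :=
  ¬ MinorIn H G U ∧ (¬ ∃ 𝓑, TreeDec G k U 𝓑) ∧ ∀ (G' : SimpleGraph V) (U' : Set V),
    U'.ncard < U.ncard → ¬ MinorIn H G' U' → ∃ 𝓑, TreeDec G' k U' 𝓑

theorem Critical.lt_ncard (h : Critical H k G U) : k < U.ncard := by
  by_contra! hcon
  exact h.2.1 ⟨_, .leaf U hcon⟩

/-- No separation of a minimum counterexample is rooted on both sides. -/
theorem Critical.not_rooted [Finite V] (h : Critical H k G U) (hSU : S ⊆ U) (hC : C ⊆ U \ S)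
    (hCne : C.Nonempty) (hCc : ∀ a ∈ C, ∀ b ∈ U \ S, G.Adj a b → b ∈ C) (hz : u ∈ U \ S)
    (hzC : u ∉ C) (rC : RootedClique G S C)
    (rD : RootedClique G S ((U \ S) \ C) ∨ (S ∪ C).ncard ≤ k) : False := by
  have hAB : (S ∪ (U \ S) \ C) ∩ (S ∪ C) = S := by
    ext v
    simp only [Set.mem_inter_iff, Set.mem_union, Set.mem_sdiff]
    tauto
  have hU : (S ∪ (U \ S) \ C) ∪ (S ∪ C) = U := by
    ext v
    have h₁ : v ∈ C → v ∈ U := fun h => (hC h).1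
    have h₂ : v ∈ S → v ∈ U := fun h => hSU h
    simp only [Set.mem_union, Set.mem_sdiff]
    tauto
  have hAU : (S ∪ (U \ S) \ C) ∪ C = U := by
    refine Eq.trans ?_ hU
    generalize (U \ S) \ C = D
    ext v
    simp only [Set.mem_union]
    tauto
  have hBU : (S ∪ C) ∪ (U \ S) \ C = U := by
    refine Eq.trans ?_ hU
    generalize (U \ S) \ C = D
    ext v
    simp only [Set.mem_union]
    tauto
  have hAC : Disjoint (S ∪ (U \ S) \ C) C := Set.disjoint_left.2 fun v hv hvC =>
    hv.elim (hC hvC).2 fun h => h.2 hvC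
  have hBD : Disjoint (S ∪ C) ((U \ S) \ C) := Set.disjoint_left.2 fun v hv hvD =>
    hv.elim hvD.1.2 hvD.2
  have hAlt : (S ∪ (U \ S) \ C).ncard < U.ncard := by
    obtain ⟨c, hc⟩ := hCne
    exact Set.ncard_lt_ncard ⟨hAU.subset.trans' Set.subset_union_left, fun hh =>
      Set.disjoint_left.1 hAC (hh (hC hc).1) hc⟩ (Set.toFinite _)
  have hBlt : (S ∪ C).ncard < U.ncard :=
    Set.ncard_lt_ncard ⟨hBU.subset.trans' Set.subset_union_left, fun hh =>
      Set.disjoint_left.1 hBD (hh hz.1) ⟨hz, hzC⟩⟩ (Set.toFinite _)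
  refine h.2.1 (hU ▸ treeDec_of_separation hAB (h.2.2 _ _ hAlt fun hm => h.1 ?_) ?_ ?_)
  · exact hAU ▸ rC.minorIn hAC hm
  · rcases rD with rD | hle
    · exact h.2.2 _ _ hBlt fun hm => h.1 (hBU ▸ rD.minorIn hBD hm)
    · exact ⟨_, .leaf _ hle⟩
  · intro a ha haB c hc hcA hac
    have haD : a ∈ (U \ S) \ C := ha.resolve_left fun h => haB (Or.inl h)
    have hcC : c ∈ C := hc.resolve_left fun h => hcA (Or.inl h)
    exact haD.2 (hCc c hcC a haD.1 hac.symm)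

theorem comp_closed_sdiff (w : V) :
    ∀ a ∈ comp G (U \ S) w, ∀ b ∈ U \ S, G.Adj a b → b ∈ comp G (U \ S) w :=
  fun _ ha _ hb hab => comp_closed ha hb hab

theorem Critical.three_le [Finite V] (h : Critical H k G U) (hS : Sep G U S) : 3 ≤ S.ncard := by
  by_contra! hcon
  classical
  have hex : ∃ n S, Sep G U S ∧ S.ncard = n := ⟨_, S, hS, rfl⟩
  obtain ⟨S₀, hS₀, hn⟩ := Nat.find_spec hex
  have hmin : ∀ S', Sep G U S' → S₀.ncard ≤ S'.ncard := fun S' hS' =>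
    hn.le.trans (Nat.find_min' hex ⟨S', hS', rfl⟩)
  have h2 : S₀.ncard ≤ 2 := by
    have := hmin S hS
    omega
  have hroot : ∀ w ∈ U \ S₀, RootedClique G S₀ (comp G (U \ S₀) w) := fun w hw =>
    rootedClique_of_ncard_le_two h2 (comp_conn hw)
      (Set.disjoint_left.2 fun x hx hx' => (comp_subset hx').2 hx) fun x hx =>
        hS₀.attached hmin hw hx
  have hS₀' := hS₀
  obtain ⟨hSU, u, hu, v, hv, hvu⟩ := hS₀'
  refine h.not_rooted hSU comp_subset ⟨u, mem_comp_self hu⟩ (comp_closed_sdiff u) hv hvu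
    (hroot u hu) (Or.inl ((hroot v hv).mono fun z hz => ⟨comp_subset hz, fun hzu =>
      Set.disjoint_left.1 (comp_disjoint hvu) hzu hz⟩))

theorem Critical.exists_of_sep_three [Finite V] (h : Critical H k G U) (hsep : Sep G U S)
    (hS : S.ncard = 3) : ∃ w ∈ U \ S, ∀ z ∈ U, G.Adj w z → z ∈ S := by
  have hsep' := hsep
  obtain ⟨hSU, u, hu, v, hv, hvu⟩ := hsep'
  by_contra! hcon
  obtain ⟨e, he, hue, heS⟩ := hcon u hu
  obtain ⟨f, hf, hvf, hfS⟩ := hcon v hv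
  have hC := comp_closed_sdiff (G := G) (U := U) (S := S) u
  have hu' := mem_comp_self (G := G) hu
  have hD : ∀ a ∈ (U \ S) \ comp G (U \ S) u, ∀ b ∈ U \ S, G.Adj a b →
      b ∈ (U \ S) \ comp G (U \ S) u := fun a ha b hb hab =>
    ⟨hb, fun hbu => ha.2 (hC b hbu a ha.1 hab.symm)⟩
  have hvD : v ∈ (U \ S) \ comp G (U \ S) u := ⟨hv, hvu⟩
  refine h.not_rooted hSU comp_subset ⟨u, hu'⟩ hC hv hvu
    (rootedClique_of_sep_three (fun _ => h.three_le) hsep hS comp_subset hC hu'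
      (hC u hu' e ⟨he, heS⟩ hue) hue.ne hv hvu)
    (Or.inl (rootedClique_of_sep_three (fun _ => h.three_le) hsep hS Set.sdiff_subset hD hvD
      (hD v hvD f ⟨hf, hfS⟩ hvf) hvf.ne hu fun h => h.2 hu'))

/-- The neighbours of `w` in `U`. -/
def nbhd (G : SimpleGraph V) (U : Set V) (w : V) : Set V := {z ∈ U | G.Adj w z}

theorem sep_nbhd (hw : w ∈ U) (hz : v ∈ U) (hzw : v ≠ w) (hzn : v ∉ nbhd G U w) :
    Sep G U (nbhd G U w) := by
  have hw' : w ∈ U \ nbhd G U w := ⟨hw, fun h => h.2.ne rfl⟩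
  refine ⟨fun z hz => hz.1, w, hw', v, ⟨hz, hzn⟩, fun hcon => hzw ?_⟩
  refine comp_subset_of_closed (D := {w}) rfl (Set.singleton_subset_iff.2 hw') ?_ hcon
  rintro a rfl b hb hab
  exact absurd ⟨hb.1, hab⟩ hb.2

theorem exists_notMem_of_ncard_lt [Finite V] {Z : Set V} (h : Z.ncard < U.ncard) :
    ∃ z ∈ U, z ∉ Z := by
  by_contra! hcon
  exact absurd (Set.ncard_le_ncard hcon (Set.toFinite _)) (by omega)

theorem Critical.three_le_nbhd [Finite V] (h : Critical H k G U) (hk : 4 ≤ k) (hw : w ∈ U) :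
    3 ≤ (nbhd G U w).ncard := by
  by_contra! hcon
  have hlt := h.lt_ncard
  have h1 := Set.ncard_insert_le w (nbhd G U w)
  obtain ⟨z, hz, hzn⟩ := exists_notMem_of_ncard_lt
    (by omega : (insert w (nbhd G U w)).ncard < U.ncard)
  have := h.three_le (sep_nbhd hw hz (fun h => hzn (Or.inl h)) fun h => hzn (Or.inr h))
  omega

/-- The neighbours of a vertex of degree three are pairwise nonadjacent. -/
theorem Critical.not_adj_of_nbhd [Finite V] (h : Critical H k G U) (hk : 4 ≤ k) (hw : w ∈ U)
    (hN : nbhd G U w = {a, b, c}) (hab : a ≠ b) (hac : a ≠ c) (hbc : b ≠ c) : ¬ G.Adj a b := by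
  intro hadj
  have hcard : (nbhd G U w).ncard = 3 := Set.ncard_eq_three.2 ⟨a, b, c, hab, hac, hbc, hN⟩
  have hlt := h.lt_ncard
  have hwN : w ∉ nbhd G U w := fun h => h.2.ne rfl
  have h1 := Set.ncard_insert_le w (nbhd G U w)
  obtain ⟨z, hz, hzn⟩ := exists_notMem_of_ncard_lt
    (by omega : (insert w (nbhd G U w)).ncard < U.ncard)
  have hmem : ∀ x, x = a ∨ x = b ∨ x = c → x ∈ nbhd G U w := fun x hx => by
    rw [hN]
    exact hx
  have ha := hmem a (by simp)
  have hb := hmem b (by simp)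
  have hc := hmem c (by simp)
  refine h.not_rooted (S := nbhd G U w) (C := {w}) (u := z) (fun z hz => hz.1)
    (Set.singleton_subset_iff.2 ⟨hw, hwN⟩) (Set.singleton_nonempty w) ?_
    ⟨hz, fun h => hzn (Or.inr h)⟩ (fun h => hzn (Or.inl h)) ?_ (Or.inr ?_)
  · rintro a rfl b hb hab
    exact absurd ⟨hb.1, hab⟩ hb.2
  · have hlast : ∀ x ∈ nbhd G U w, x ≠ c → Disjoint {x} ({c, w} : Set V) ∧
        AdjSet G {x} ({c, w} : Set V) := fun x hx hxc =>
      ⟨Set.disjoint_singleton_left.2 (by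
        rintro (rfl | rfl)
        exacts [hxc rfl, hwN hx]), x, rfl, w, by simp, hx.2.symm⟩
    refine rootedClique_of_family (y := ![a, b, c]) (R := ![{a}, {b}, {c, w}]) ?_ ?_
      (pairwise_fin_three (fun i j h => ⟨h.1.symm, h.2.symm⟩)
        ⟨Set.disjoint_singleton.2 hab, a, rfl, b, rfl, hadj⟩ (hlast a ha hac) (hlast b hb hbc))
    · intro x hx
      rw [hN] at hx
      rcases hx with rfl | rfl | rfl
      exacts [⟨0, rfl⟩, ⟨1, rfl⟩, ⟨2, rfl⟩]
    · intro i
      fin_cases i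
      · exact ⟨ConnSet.singleton a, rfl, Set.singleton_subset_iff.2 (Or.inl ha)⟩
      · exact ⟨ConnSet.singleton b, rfl, Set.singleton_subset_iff.2 (Or.inl hb)⟩
      · exact ⟨ConnSet.pair hc.2.symm, by simp, Set.insert_subset (Or.inl hc)
          (Set.singleton_subset_iff.2 (Or.inr rfl))⟩
  · have := Set.ncard_union_le (nbhd G U w) {w}
    rw [Set.ncard_singleton] at this
    omega

/-- A graph with three pairwise nonadjacent vertices has a tree decomposition into three bags. -/
theorem treeDec_of_independent [Finite V] (ha : a ∈ U) (hb : b ∈ U) (hc : c ∈ U) (hab : a ≠ b)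
    (hac : a ≠ c) (hbc : b ≠ c) (nab : ¬ G.Adj a b) (nac : ¬ G.Adj a c) (nbc : ¬ G.Adj b c)
    (hU : U.ncard ≤ k + 2) : ∃ 𝓑, TreeDec G k U 𝓑 := by
  have hle : ∀ x y, x ∈ U → y ∈ U → x ≠ y → (U \ {x, y}).ncard ≤ k := fun x y hx hy hxy => by
    have h1 := Set.ncard_sdiff_add_ncard_of_subset
      (Set.insert_subset hx (Set.singleton_subset_iff.2 hy))
    rw [Set.ncard_pair hxy] at h1
    omega
  have h₁ : TreeDec G k (U \ {a, b} ∪ U \ {b, c}) _ :=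
    .glue (.leaf _ (hle a b ha hb hab)) (.leaf _ (hle b c hb hc hbc)) rfl rfl le_rfl (by
      intro x hx hx' y hy hy' hxy
      obtain rfl : x = c := by
        by_contra hne
        simp_all
      obtain rfl : y = a := by
        by_contra hne
        simp_all
      exact nac hxy.symm)
  have h₂ : TreeDec G k ((U \ {a, b} ∪ U \ {b, c}) ∪ U \ {a, c}) _ :=
    .glue h₁ (.leaf _ (hle a c ha hc hac)) (B₁ := U \ {a, b}) (B₂ := U \ {a, c})
      (by simp) rfl (by
        intro x hx
        simp only [Set.mem_inter_iff, Set.mem_union, Set.mem_sdiff, Set.mem_insert_iff,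
          Set.mem_singleton_iff] at hx ⊢
        tauto) (by
      intro x hx hx' y hy hy' hxy
      obtain rfl : y = b := by
        by_contra hne
        simp only [Set.mem_union, Set.mem_sdiff, Set.mem_insert_iff,
          Set.mem_singleton_iff] at *
        tauto
      have : x = a ∨ x = c := by
        by_contra hne
        simp only [Set.mem_union, Set.mem_sdiff, Set.mem_insert_iff,
          Set.mem_singleton_iff] at *
        tauto
      rcases this with rfl | rfl
      exacts [nab hxy, nbc hxy.symm])
  have hU' : (U \ {a, b} ∪ U \ {b, c}) ∪ U \ {a, c} = U := by
    ext x
    simp only [Set.mem_union, Set.mem_sdiff, Set.mem_insert_iff, Set.mem_singleton_iff]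
    by_cases hxa : x = a
    · subst hxa
      simp [ha, hab, hac]
    · by_cases hxb : x = b
      · subst hxb
        simp [hb, hab.symm, hbc]
      · simp +contextual [hxa, hxb]
  exact ⟨_, hU' ▸ h₂⟩

/-- There are two nonadjacent vertices without common neighbours of degree at most three. -/
theorem Critical.exists_pair [Finite V] [Fintype α] (h : Critical H k G U) (hk : 8 ≤ k)
    (hα : Fintype.card α ≤ k) : ∃ v₁ ∈ U, ∃ v₂ ∈ U, v₁ ≠ v₂ ∧ ¬ G.Adj v₁ v₂ ∧
      ∀ w ∈ U, G.Adj w v₁ → G.Adj w v₂ → 4 ≤ (nbhd G U w).ncard := by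
  classical
  have hlt := h.lt_ncard
  by_cases hdeg : ∀ w ∈ U, 4 ≤ (nbhd G U w).ncard
  · by_contra! hcon
    refine h.1 (minorIn_of_clique (by omega) fun a ha b hb hab => ?_)
    by_contra hadj
    obtain ⟨w, hw, -, -, hw'⟩ := hcon a ha b hb hab hadj
    exact absurd (hdeg w hw) (by omega)
  push Not at hdeg
  obtain ⟨u, hu, hu4⟩ := hdeg
  have hu3 := h.three_le_nbhd (by omega) hu
  obtain ⟨a, b, c, hab, hac, hbc, hN⟩ := Set.ncard_eq_three.1 (by omega : (nbhd G U u).ncard = 3)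
  have hmem : ∀ x, x = a ∨ x = b ∨ x = c → x ∈ nbhd G U u := fun x hx => by
    rw [hN]
    exact hx
  have nab := h.not_adj_of_nbhd (by omega) hu hN hab hac hbc
  have nac := h.not_adj_of_nbhd (by omega) hu
    (hN.trans (by rw [Set.pair_comm b c])) hac hab hbc.symm
  have nbc := h.not_adj_of_nbhd (by omega) hu
    (hN.trans (by rw [Set.insert_comm, Set.pair_comm a c])) hbc hab.symm hac.symm
  have hbig : k + 2 < U.ncard := by
    by_contra! hcon
    exact h.2.1 (treeDec_of_independent (hmem a (by simp)).1 (hmem b (by simp)).1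
      (hmem c (by simp)).1 hab hac hbc nab nac nbc hcon)
  set f : V → Set V := fun w => if (nbhd G U w).ncard ≤ 3 then nbhd G U w \ {u} else ∅ with hf
  have hfc : ∀ w ∈ nbhd G U u, (f w).ncard ≤ 2 := by
    intro w hw
    simp only [hf]
    split_ifs with hw3
    · have := Set.ncard_sdiff_singleton_lt_of_mem (s := nbhd G U w) ⟨hu, hw.2.symm⟩
      omega
    · simp
  have hfa := hfc a (hmem a (by simp))
  have hfb := hfc b (hmem b (by simp))
  have hfc := hfc c (hmem c (by simp))
  have c1 := Set.ncard_insert_le u (nbhd G U u ∪ (f a ∪ (f b ∪ f c)))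
  have c2 := Set.ncard_union_le (nbhd G U u) (f a ∪ (f b ∪ f c))
  have c3 := Set.ncard_union_le (f a) (f b ∪ f c)
  have c4 := Set.ncard_union_le (f b) (f c)
  obtain ⟨v, hv, hvZ⟩ := exists_notMem_of_ncard_lt
    (by omega : (insert u (nbhd G U u ∪ (f a ∪ (f b ∪ f c)))).ncard < U.ncard)
  simp only [Set.mem_insert_iff, Set.mem_union, not_or] at hvZ
  obtain ⟨hvu, hvN, hva, hvb, hvc⟩ := hvZ
  refine ⟨u, hu, v, hv, Ne.symm hvu, fun huv => hvN ⟨hv, huv⟩, fun w hw hwu hwv => ?_⟩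
  have hvw : v ∉ f w := by
    have hwN : w ∈ nbhd G U u := ⟨hw, hwu.symm⟩
    rw [hN] at hwN
    rcases hwN with rfl | rfl | rfl <;> assumption
  by_contra! hw4
  simp only [hf, if_pos (by omega : (nbhd G U w).ncard ≤ 3)] at hvw
  exact hvw ⟨⟨hv, hwv⟩, hvu⟩

/-- Removing two vertices as in `Critical.exists_pair` leaves a `2`-connected set. -/
theorem Critical.mem_comp [Finite V] (h : Critical H k G U) {v₁ v₂ : V} (hv₁ : v₁ ∈ U)
    (hv₂ : v₂ ∈ U) (hdeg : ∀ w ∈ U, G.Adj w v₁ → G.Adj w v₂ → 4 ≤ (nbhd G U w).ncard) (c : V)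
    (hu : u ∈ (U \ {v₁, v₂}) \ {c}) (hv : v ∈ (U \ {v₁, v₂}) \ {c}) :
    v ∈ comp G ((U \ {v₁, v₂}) \ {c}) u := by
  by_contra hcon
  set S := U ∩ ({v₁, v₂} ∪ {c}) with hSdef
  have hSe : (U \ {v₁, v₂}) \ {c} = U \ S := by
    rw [Set.sdiff_sdiff, hSdef, Set.sdiff_self_inter]
  rw [hSe] at hu hv hcon
  have hsep : Sep G U S := ⟨Set.inter_subset_left, u, hu, v, hv, hcon⟩
  have hle : S.ncard ≤ 3 := by
    have h1 := Set.ncard_le_ncard (Set.inter_subset_right : S ⊆ {v₁, v₂} ∪ {c}) (Set.toFinite _)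
    have h2 := Set.ncard_union_le {v₁, v₂} {c}
    have h3 := Set.ncard_insert_le v₁ {v₂}
    rw [Set.ncard_singleton] at h2 h3
    exact h1.trans (by omega)
  obtain ⟨w, hw, hwS⟩ := h.exists_of_sep_three hsep (hle.antisymm (h.three_le hsep))
  have hadj : ∀ x ∈ S, G.Adj w x := fun x hx => by
    obtain ⟨y, rfl, z, hz, hyz⟩ := hsep.attached (fun S' hS' => hle.trans (h.three_le hS')) hw hx
    obtain rfl : z = w := comp_subset_of_closed (D := {w}) rfl (Set.singleton_subset_iff.2 hw) (by
      rintro a rfl b hb hab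
      exact absurd (hwS b hb.1 hab) hb.2) hz
    exact hyz.symm
  have h4 := hdeg w hw.1 (hadj v₁ ⟨hv₁, by simp⟩) (hadj v₂ ⟨hv₂, by simp⟩)
  have := Set.ncard_le_ncard (fun z hz => hwS z hz.1 hz.2 : nbhd G U w ⊆ S) (Set.toFinite _)
  omega

theorem exists_treeDec_of_not_minorIn [Finite V] (G : SimpleGraph V) (U : Set V)
    (hm : ¬ MinorIn (doubleWheel 3) G U) : ∃ 𝓑, TreeDec G 8 U 𝓑 := by
  induction hn : U.ncard using Nat.strong_induction_on generalizing G U with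
  | _ n ih =>
  by_contra hcon
  have h : Critical (doubleWheel 3) 8 G U := ⟨hm, hcon, fun G' U' hlt hm' =>
    ih U'.ncard (hn ▸ hlt) G' U' hm' rfl⟩
  obtain ⟨v₁, hv₁, v₂, hv₂, hne, hadj, hdeg⟩ := h.exists_pair le_rfl (by simp)
  have hlt := h.lt_ncard
  have h2 := Set.ncard_insert_le v₁ {v₂}
  rw [Set.ncard_singleton] at h2
  obtain ⟨z, hz, hz'⟩ := exists_notMem_of_ncard_lt (by omega : ({v₁, v₂} : Set V).ncard < U.ncard)
  exact hm (minorIn_doubleWheel_three hv₁ hv₂ hne hadj (fun S => h.three_le) ⟨z, hz, hz'⟩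
    fun c u hu v hv => h.mem_comp hv₁ hv₂ hdeg c hu hv)

/-- Graphs of treewidth at least `8` contain `DW_3` as a minor. -/
theorem doubleWheel_three_isMinor [Fintype V] (h : 8 ≤ treewidth G) :
    IsMinor (doubleWheel 3) G := by
  by_contra hcon
  obtain ⟨𝓑, hB⟩ := exists_treeDec_of_not_minorIn G Set.univ fun hm => hcon hm.isMinor
  have := TreeDec.treewidth_le (b := 7) hB
  omega

end

section

theorem rpow_half_mul_self (h : ℕ) :
    (2 : ℝ) ^ ((h : ℝ) / 2) * (2 : ℝ) ^ ((h : ℝ) / 2) = 2 ^ h := by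
  rw [← Real.rpow_add (by norm_num), add_halves, Real.rpow_natCast]

theorem order_le_three {h : ℕ} (hh : 0 < h) (h12 : h ≤ 12) :
    ((2 : ℝ) ^ ((h : ℝ) / 2) - 2) / (2 * h - 3) ≤ 3 := by
  have hs := rpow_half_mul_self h
  have hs0 : 0 < (2 : ℝ) ^ ((h : ℝ) / 2) := by positivity
  generalize (2 : ℝ) ^ ((h : ℝ) / 2) = s at hs hs0
  obtain rfl | h2 : h = 1 ∨ 2 ≤ h := by omega
  · norm_num
    linarith
  have h2' : (2 : ℝ) ≤ h := by exact_mod_cast h2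
  rw [div_le_iff₀ (by linarith)]
  interval_cases h <;> norm_num at hs ⊢ <;> nlinarith

theorem exists_order {h : ℕ} (h13 : 13 ≤ h) : ∃ r : ℕ, 2 < r ∧
    (r : ℝ) ≥ ((2 : ℝ) ^ ((h : ℝ) / 2) - 2) / (2 * h - 3) ∧
    144 * r ^ 2 + 12 * r + 9 ≤ 2 * 2 ^ h - 2 := by
  have hs := rpow_half_mul_self h
  have hs0 : 0 < (2 : ℝ) ^ ((h : ℝ) / 2) := by positivity
  generalize (2 : ℝ) ^ ((h : ℝ) / 2) = s at hs hs0
  have hpow : (2 : ℝ) ^ 13 ≤ 2 ^ h := pow_le_pow_right₀ (by norm_num) h13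
  have hs90 : 90 ≤ s := by nlinarith
  have h13' : (13 : ℝ) ≤ h := by exact_mod_cast h13
  have hx : (s - 2) / (2 * h - 3) ≤ (s - 2) / 23 :=
    div_le_div_of_nonneg_left (by linarith) (by norm_num) (by linarith)
  have hx0 : 0 ≤ (s - 2) / (2 * (h : ℝ) - 3) := div_nonneg (by linarith) (by linarith)
  refine ⟨max 3 ⌈(s - 2) / (2 * (h : ℝ) - 3)⌉₊, by omega,
    (Nat.le_ceil _).trans (Nat.cast_le.2 (le_max_right _ _)), ?_⟩
  have hr : ((max 3 ⌈(s - 2) / (2 * (h : ℝ) - 3)⌉₊ : ℕ) : ℝ) ≤ (s + 21) / 23 := by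
    rw [Nat.cast_max]
    refine max_le ?_ ?_
    · push_cast
      linarith
    · have := Nat.ceil_lt_add_one hx0
      linarith
  generalize max 3 ⌈(s - 2) / (2 * (h : ℝ) - 3)⌉₊ = r at hr
  have hr0 : (0 : ℝ) ≤ r := Nat.cast_nonneg r
  suffices h : 144 * r ^ 2 + 12 * r + 9 + 2 ≤ 2 * 2 ^ h by omega
  rify
  rw [← hs]
  have hr2 : (r : ℝ) ^ 2 ≤ ((s + 21) / 23) ^ 2 := pow_le_pow_left₀ hr0 hr 2
  nlinarith

end

end DoubleWheelMinor

/-- If `h > 0` and `tw(G) ≥ 6·2^h - 4`, then `G` contains as a minor a double wheel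
of order `r` for some integer `r > 2` with `r ≥ (2^(h/2) - 2)/(2h - 3)`. -/
theorem doubleWheel_minor_of_treewidth_pow {V : Type*} [Fintype V] (h : ℕ) (hh : 0 < h)
    (G : SimpleGraph V) (htw : treewidth G ≥ 6 * 2 ^ h - 4) :
    ∃ r : ℕ, 2 < r ∧
      (r : ℝ) ≥ ((2 : ℝ) ^ ((h : ℝ) / 2) - 2) / (2 * h - 3) ∧
      IsMinor (doubleWheel r) G := by
  obtain h12 | h13 : h ≤ 12 ∨ 13 ≤ h := by omega
  · have hpow : 2 ^ 1 ≤ 2 ^ h := Nat.pow_le_pow_right (by norm_num) hh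
    exact ⟨3, by norm_num, by exact_mod_cast DoubleWheelMinor.order_le_three hh h12,
      DoubleWheelMinor.doubleWheel_three_isMinor (by omega)⟩
  · obtain ⟨r, hr2, hr, hk⟩ := DoubleWheelMinor.exists_order h13
    have hpow : 0 < 2 ^ h := by positivity
    obtain ⟨β, hβ⟩ := DoubleWheelMinor.exists_haven (G := G) (k := 2 * 2 ^ h - 2) (by omega)
    exact ⟨r, hr2, hr, hβ.doubleWheel_minor hr2.le hk⟩
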